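/- Deletion theorem for tameness: Let (A,m) be a tame multiarrangement on an essential arrangement A in K^ℓ and H ∈ A. Assume that the Euler restriction (A^H, m^*) is free and that (A,m) is locally free along H. Then (A, m−δ_H) is tame. -/

import Mathlib

noncomputable section
open Classical MvPolynomial

/-- `pdLE R n M` : the `R`-module `M` has projective dimension at most `n`. -/
def pdLE (R : Type) [CommRing R] : ℕ → (M : Type) → [AddCommGroup M] → [Module R M] → Prop
  | 0, M, _, _ => Module.Projective R M
  | n + 1, M, _, _ => ∃ (ι : Type) (f : (ι →₀ R) →ₗ[R] M),
      Function.Surjective f ∧ pdLE R n (LinearMap.ker f)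

/-- Projective dimension as an element of `ℕ∞`. -/
def pdim (R : Type) [CommRing R] (M : Type) [AddCommGroup M] [Module R M] : ℕ∞ :=
  sInf {n : ℕ∞ | ∃ k : ℕ, pdLE R k M ∧ n = (k : ℕ∞)}

/-- The coordinate ring `S = K[x_1, …, x_ℓ]`. -/
abbrev PS (K : Type) [Field K] (ℓ : ℕ) : Type := MvPolynomial (Fin ℓ) K

/-- The free `S`-module of polynomial differential forms of all degrees, realized as the
exterior algebra over `S` on the free module `S^ℓ` (with `dx_i` the standard basis). -/
abbrev ExtF (K : Type) [Field K] (ℓ : ℕ) : Type :=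
  ExteriorAlgebra (PS K ℓ) (Fin ℓ → PS K ℓ)

variable {K : Type} [Field K] {ℓ : ℕ}

/-- The module `Ω^p_V` of polynomial differential `p`-forms. -/
def formsP (K : Type) [Field K] (ℓ : ℕ) (p : ℕ) : Submodule (PS K ℓ) (ExtF K ℓ) :=
  (LinearMap.range (ExteriorAlgebra.ι (PS K ℓ) :
      (Fin ℓ → PS K ℓ) →ₗ[PS K ℓ] ExtF K ℓ)) ^ p

/-- The defining linear form `α = ∑ c_i x_i` of the hyperplane with coefficient vector `c`. -/
def linP (c : Fin ℓ → K) : PS K ℓ := ∑ i, MvPolynomial.C (c i) * MvPolynomial.X i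

/-- The constant one-form `dα = ∑ c_i dx_i`. -/
def dP (c : Fin ℓ → K) : ExtF K ℓ :=
  ExteriorAlgebra.ι (PS K ℓ) (fun i => MvPolynomial.C (c i))

/-- A central hyperplane arrangement in `K^ℓ`: a finite set of (pairwise non-proportional,
nonzero) coefficient vectors of defining linear forms, each representing the hyperplane
`{x : ∑ c_i x_i = 0}`. -/
structure Arrangement (K : Type) [Field K] (ℓ : ℕ) : Type where
  hyps : Finset (Fin ℓ → K)
  ne_zero : ∀ c ∈ hyps, c ≠ 0
  nonprop : ∀ c ∈ hyps, ∀ c' ∈ hyps, c ≠ c' → ∀ t : K, c ≠ t • c'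

/-- The polynomial model of the module `Ω^p(A,m)` of logarithmic `p`-forms of the
multiarrangement `(A,m)`; it is `Q(A,m)·Ω^p(A,m)`, i.e. the image of `Ω^p(A,m)` under the
degree-shifting isomorphism given by multiplication with `Q(A,m)`, so that
`η = Q(A,m)·ω` ranges over polynomial `p`-forms with `dα_H ∧ η ∈ α_H^{m(H)} Ω^{p+1}_V`
for all `H ∈ A`. -/
def Omega (A : Arrangement K ℓ) (m : (Fin ℓ → K) → ℕ) (p : ℕ) :
    Submodule (PS K ℓ) (ExtF K ℓ) :=
  formsP K ℓ p ⊓ ⨅ c ∈ A.hyps,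
    Submodule.comap (LinearMap.mulLeft (PS K ℓ) (dP c))
      (Submodule.map (LinearMap.lsmul (PS K ℓ) (ExtF K ℓ) (linP c ^ m c))
        (formsP K ℓ (p + 1)))

/-- Tameness of a multiarrangement: `pd_S Ω^p(A,m) ≤ p` for all `0 ≤ p ≤ ℓ`. -/
def TameM (A : Arrangement K ℓ) (m : (Fin ℓ → K) → ℕ) : Prop :=
  ∀ p : ℕ, p ≤ ℓ → pdLE (PS K ℓ) p (Omega A m p)

/-- Tameness of a simple arrangement (constant multiplicity `1`). -/
def Tame (A : Arrangement K ℓ) : Prop := TameM A (fun _ => 1)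

/-- Freeness of a multiarrangement: `Ω^1(A,m)` is a free `S`-module. -/
def FreeM (A : Arrangement K ℓ) (m : (Fin ℓ → K) → ℕ) : Prop :=
  Module.Free (PS K ℓ) (Omega A m 1)

/-- An arrangement is essential when the intersection of its hyperplanes is `{0}`,
equivalently the defining forms span the dual space. -/
def Essential (A : Arrangement K ℓ) : Prop :=
  Submodule.span K (A.hyps : Set (Fin ℓ → K)) = ⊤

/-- The localization `A_x = {H ∈ A : x ∈ H}` of an arrangement at a point `x`. -/
def locArr (A : Arrangement K ℓ) (x : Fin ℓ → K) : Arrangement K ℓ where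
  hyps := A.hyps.filter (fun c => ∑ i, c i * x i = 0)
  ne_zero := fun c hc => A.ne_zero c (Finset.mem_filter.mp hc).1
  nonprop := fun c hc c' hc' =>
    A.nonprop c (Finset.mem_filter.mp hc).1 c' (Finset.mem_filter.mp hc').1

/-- `(A,m)` is locally free along the hyperplane `{x : ∑ (c0)_i x_i = 0}` :
`(A_x, m_x)` is free for every nonzero point `x` of this hyperplane. -/
def LocallyFreeAlong (A : Arrangement K ℓ) (m : (Fin ℓ → K) → ℕ) (c0 : Fin ℓ → K) : Prop :=
  ∀ x : Fin ℓ → K, x ≠ 0 → (∑ i, c0 i * x i = 0) → FreeM (locArr A x) m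

/-- The deletion `A ∖ {H}`. -/
def delArr (A : Arrangement K ℓ) (c0 : Fin ℓ → K) : Arrangement K ℓ where
  hyps := A.hyps.erase c0
  ne_zero := fun c hc => A.ne_zero c (Finset.mem_of_mem_erase hc)
  nonprop := fun c hc c' hc' =>
    A.nonprop c (Finset.mem_of_mem_erase hc) c' (Finset.mem_of_mem_erase hc')

/-- The coefficient vector of the restriction of the linear form `c` to the hyperplane `H`
along the linear identification `e : K^{ℓ-1} ≃ H`. -/
def restrictForm (e : (Fin (ℓ - 1) → K) →ₗ[K] (Fin ℓ → K)) (c : Fin ℓ → K) :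
    Fin (ℓ - 1) → K := fun i => ∑ j, c j * e (Pi.single i 1) j

/-- The linear form on `K^ℓ` with coefficient vector `c`. -/
def dotLin (c : Fin ℓ → K) : (Fin ℓ → K) →ₗ[K] K := ∑ i, c i • LinearMap.proj i

/-- `e` identifies `K^{ℓ-1}` with the hyperplane `ker(α_{c0})`. -/
def IsHypEmbedding (c0 : Fin ℓ → K) (e : (Fin (ℓ - 1) → K) →ₗ[K] (Fin ℓ → K)) : Prop :=
  Function.Injective e ∧ LinearMap.range e = LinearMap.ker (dotLin c0)

/-- `B` (an arrangement in `K^{ℓ-1}`) represents the restriction `A^H` of `A` to the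
hyperplane `H` determined by `c0 ∈ A`, via the identification `e : K^{ℓ-1} ≃ H`:
its hyperplanes are exactly the restrictions to `H` of the hyperplanes of `A ∖ {H}`. -/
def IsRestrictionOf (B : Arrangement K (ℓ - 1)) (A : Arrangement K ℓ) (c0 : Fin ℓ → K)
    (e : (Fin (ℓ - 1) → K) →ₗ[K] (Fin ℓ → K)) : Prop :=
  (∀ c ∈ A.hyps, c ≠ c0 → ∃ c' ∈ B.hyps, ∃ t : K, t ≠ 0 ∧ restrictForm e c = t • c') ∧
  (∀ c' ∈ B.hyps, ∃ c ∈ A.hyps, c ≠ c0 ∧ ∃ t : K, t ≠ 0 ∧ restrictForm e c = t • c')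
/-- The Ziegler multiplicity `m^H` on the restriction: `m^H(X) = #{L ∈ A∖{H} : L ∩ H = X}`. -/
def zieglerMult (A : Arrangement K ℓ) (c0 : Fin ℓ → K)
    (e : (Fin (ℓ - 1) → K) →ₗ[K] (Fin ℓ → K)) (c' : Fin (ℓ - 1) → K) : ℕ :=
  (A.hyps.filter (fun c => c ≠ c0 ∧ ∃ t : K, t ≠ 0 ∧ restrictForm e c = t • c')).card

/-- The wedge `dx_{i_1} ∧ ⋯ ∧ dx_{i_p}` for a list of indices. -/
def wedgeList (l : List (Fin ℓ)) : ExtF K ℓ :=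
  (l.map (fun i => ExteriorAlgebra.ι (PS K ℓ) (Pi.single i (1 : PS K ℓ)))).prod

/-- A polynomial `p`-form is homogeneous of (coefficient) degree `d` if it is a sum of
terms `f · dx_{i_1} ∧ ⋯ ∧ dx_{i_p}` with `f` homogeneous of degree `d`. -/
def IsHomogForm (p d : ℕ) (η : ExtF K ℓ) : Prop :=
  η ∈ AddSubgroup.closure {ξ : ExtF K ℓ | ∃ (f : PS K ℓ) (l : List (Fin ℓ)),
    f.IsHomogeneous d ∧ l.length = p ∧ ξ = f • wedgeList l}

/-- `|m| = ∑_{H ∈ A} m(H)`. -/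
def msum (A : Arrangement K ℓ) (m : (Fin ℓ → K) → ℕ) : ℕ := ∑ c ∈ A.hyps, m c

/-- The multiarrangement `(A,m)` is free with exponents `(d_1, …, d_ℓ)`: the polynomial
model of `Ω^1(A,m)` has a homogeneous basis whose `i`-th member has coefficient degree
`|m| - d_i`. -/
def FreeWithExp (A : Arrangement K ℓ) (m : (Fin ℓ → K) → ℕ) (d : Fin ℓ → ℕ) : Prop :=
  ∃ b : Fin ℓ → ExtF K ℓ,
    (∀ i, b i ∈ Omega A m 1) ∧
    (∀ i, IsHomogForm 1 (msum A m - d i) (b i)) ∧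
    LinearIndependent (PS K ℓ) b ∧
    Omega A m 1 ≤ Submodule.span (PS K ℓ) (Set.range b)

/-- The exponent vector `(d_1, d_2, 0, …, 0)`. -/
def expVec (d1 d2 : ℕ) : Fin ℓ → ℕ := fun i =>
  if (i : ℕ) = 0 then d1 else if (i : ℕ) = 1 then d2 else 0

/-- The localization `A_X` of `A` at the lattice element `X = H ∩ L` corresponding,
via the identification `e` of `H` with `K^{ℓ-1}`, to the hyperplane of `H`
with coefficient vector `c'`. -/
def locOnRestr (A : Arrangement K ℓ) (e : (Fin (ℓ - 1) → K) →ₗ[K] (Fin ℓ → K))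
    (c' : Fin (ℓ - 1) → K) : Arrangement K ℓ where
  hyps := A.hyps.filter (fun c => ∃ t : K, restrictForm e c = t • c')
  ne_zero := fun c hc => A.ne_zero c (Finset.mem_filter.mp hc).1
  nonprop := fun c hc c'' hc'' =>
    A.nonprop c (Finset.mem_filter.mp hc).1 c'' (Finset.mem_filter.mp hc'').1

/-- The multiplicity `m - δ_H`. -/
def mdel (m : (Fin ℓ → K) → ℕ) (c0 : Fin ℓ → K) : (Fin ℓ → K) → ℕ :=
  fun c => if c = c0 then m c - 1 else m c

/-- `ms` is the Euler multiplicity `m^*` on the restriction `B = A^H` (presented via the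
identification `e`): for each `X ∈ A^H` the rank-two localization `(A_X, m_X)` is free
with exponents `(d_1^X, d_2^X, 0, …, 0)` ordered so that `(A_X, m_X - δ_H)` is free with
exponents `(d_1^X - 1, d_2^X, 0, …, 0)`, and `m^*(X) = d_2^X`. -/
def IsEulerMult (A : Arrangement K ℓ) (m : (Fin ℓ → K) → ℕ) (c0 : Fin ℓ → K)
    (e : (Fin (ℓ - 1) → K) →ₗ[K] (Fin ℓ → K)) (B : Arrangement K (ℓ - 1))
    (ms : (Fin (ℓ - 1) → K) → ℕ) : Prop :=
  ∀ c' ∈ B.hyps, ∃ d1 d2 : ℕ,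
    FreeWithExp (locOnRestr A e c') m (expVec d1 d2) ∧
    FreeWithExp (locOnRestr A e c') (mdel m c0) (expVec (d1 - 1) d2) ∧
    ms c' = d2

/-- An arrangement is generic if any `k ≤ ℓ-1` of its hyperplanes intersect in
codimension `k`, i.e. any `≤ ℓ-1` of its defining forms are linearly independent. -/
def GenericArr (A : Arrangement K ℓ) : Prop :=
  ∀ s : Finset (Fin ℓ → K), s ⊆ A.hyps → s.card ≤ ℓ - 1 →
    LinearIndependent K (fun x : {c // c ∈ s} => (x : Fin ℓ → K))

/-- An arrangement is irreducible if it is not a product of two lower-dimensional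
arrangements, i.e. its defining forms cannot be split into two complementary proper
subspaces of the dual space. -/
def IrreducibleArr (A : Arrangement K ℓ) : Prop :=
  ¬ ∃ U1 U2 : Submodule K (Fin ℓ → K), U1 ≠ ⊥ ∧ U2 ≠ ⊥ ∧ U1 ⊓ U2 = ⊥ ∧ U1 ⊔ U2 = ⊤ ∧
      ∀ c ∈ A.hyps, c ∈ U1 ∨ c ∈ U2

/-- The defining polynomial `Q(A,m) = ∏_{H ∈ A} α_H^{m(H)}`. -/
def Qpoly (A : Arrangement K ℓ) (m : (Fin ℓ → K) → ℕ) : PS K ℓ :=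
  ∏ c ∈ A.hyps, linP c ^ m c

section ProjectiveDimension

open CategoryTheory

/-- The `R`-module `M` has projective dimension strictly less than `n`. -/
abbrev PdLT (R : Type) [CommRing R] (M : Type) [AddCommGroup M] [Module R M] (n : ℕ) : Prop :=
  HasProjectiveDimensionLT (ModuleCat.of R M) n

variable {R : Type} [CommRing R] {M N L : Type} [AddCommGroup M] [Module R M]
  [AddCommGroup N] [Module R N] [AddCommGroup L] [Module R L]

theorem PdLT.congr {n : ℕ} (e : M ≃ₗ[R] N) (h : PdLT R M n) : PdLT R N n := by
  have := h
  exact hasProjectiveDimensionLT_of_iso e.toModuleIso n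

theorem PdLT.mono {n k : ℕ} (hnk : n ≤ k) (h : PdLT R M n) : PdLT R M k := by
  have := h
  exact hasProjectiveDimensionLT_of_ge _ n k hnk

theorem pdLT_one_iff : PdLT R M 1 ↔ Module.Projective R M := by
  rw [IsProjective.iff_projective, projective_iff_hasProjectiveDimensionLT_one]

theorem pdLT_one [h : Module.Projective R M] {n : ℕ} : PdLT R M (n + 1) :=
  PdLT.mono (by omega) (pdLT_one_iff.2 h)

theorem PdLT.of_ker {f : M →ₗ[R] N} (hf : Function.Surjective f) {n : ℕ}
    (h₁ : PdLT R (LinearMap.ker f) n) (h₂ : PdLT R M (n + 1)) : PdLT R N (n + 1) :=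
  (LinearMap.shortExact_shortComplexKer hf).hasProjectiveDimensionLT_X₃ n h₁ h₂

theorem PdLT.ker {f : M →ₗ[R] N} (hf : Function.Surjective f) {n : ℕ}
    (h₁ : PdLT R M n) (h₂ : PdLT R N (n + 1)) : PdLT R (LinearMap.ker f) n :=
  (LinearMap.shortExact_shortComplexKer hf).hasProjectiveDimensionLT_X₁ n h₁ h₂

theorem PdLT.middle {f : M →ₗ[R] N} (hf : Function.Surjective f) {n : ℕ}
    (h₁ : PdLT R (LinearMap.ker f) n) (h₂ : PdLT R N n) : PdLT R M n :=
  (LinearMap.shortExact_shortComplexKer hf).hasProjectiveDimensionLT_X₂ n h₁ h₂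

theorem pdLE_iff {n : ℕ} : ∀ {M : Type} [AddCommGroup M] [Module R M],
    pdLE R n M ↔ PdLT R M (n + 1) := by
  induction n with
  | zero => intro M _ _; exact pdLT_one_iff.symm
  | succ n ih =>
    intro M _ _
    constructor
    · rintro ⟨ι, f, hf, h⟩
      exact PdLT.of_ker hf (ih.1 h) pdLT_one
    · intro h
      exact ⟨M, Finsupp.linearCombination R id,
        Finsupp.linearCombination_id_surjective R M,
        ih.2 (PdLT.ker (Finsupp.linearCombination_id_surjective R M) pdLT_one h)⟩

theorem PdLT.of_retract {n : ℕ} (i : M →ₗ[R] N) (r : N →ₗ[R] M) (h : r ∘ₗ i = LinearMap.id)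
    (hN : PdLT R N n) : PdLT R M n := by
  have := hN
  have : Retract (ModuleCat.of R M) (ModuleCat.of R N) :=
    { i := ModuleCat.ofHom i
      r := ModuleCat.ofHom r
      retract := by rw [← ModuleCat.ofHom_comp, h]; rfl }
  exact this.hasProjectiveDimensionLT n

/-- A submodule of a finite-rank-free module cut out by linear equations with values in a
module embedded in a projective one is a second syzygy. -/
theorem PdLT.ker_of_global {d : ℕ} (hgl : ∀ (X : Type) [AddCommGroup X] [Module R X],
      PdLT R X (d + 1)) [Module.Projective R M] [Module.Projective R N] (f : M →ₗ[R] N) :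
    PdLT R (LinearMap.ker f) (max 1 (d - 1)) := by
  have key : ∀ k, d ≤ k + 2 → PdLT R (LinearMap.ker f) (k + 1) := by
    intro k hk
    have h1 : PdLT R (N ⧸ LinearMap.range f) (k + 3) := PdLT.mono (by omega) (hgl _)
    have h2 : PdLT R (LinearMap.ker (LinearMap.range f).mkQ) (k + 2) :=
      PdLT.ker (Submodule.mkQ_surjective _) pdLT_one h1
    have h3 : PdLT R (LinearMap.range f) (k + 2) :=
      h2.congr (LinearEquiv.ofEq _ _ (Submodule.ker_mkQ _))
    have h4 : PdLT R (LinearMap.ker f.rangeRestrict) (k + 1) :=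
      PdLT.ker f.surjective_rangeRestrict pdLT_one h3
    exact h4.congr (LinearEquiv.ofEq _ _ (LinearMap.ker_rangeRestrict f))
  exact PdLT.mono (by omega) (key (d - 2) (by omega))

end ProjectiveDimension

section HilbertSyzygy

open TensorProduct

variable {R : Type} [CommRing R] {G : Type} [AddCommGroup G] [Module R G]

/-- The `i`-th coefficient map `R[X] ⊗ G → G`. -/
def polyCoeffMap (R G : Type) [CommRing R] [AddCommGroup G] [Module R G] (i : ℕ) :
    Polynomial R ⊗[R] G →ₗ[R] G :=
  TensorProduct.lift ((LinearMap.lsmul R G).comp (Polynomial.lcoeff R i))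

theorem polyCoeffMap_tmul (i : ℕ) (p : Polynomial R) (g : G) :
    polyCoeffMap R G i (p ⊗ₜ g) = p.coeff i • g := by
  simp [polyCoeffMap]

theorem exists_polyCoeffMap_eq (t : Polynomial R ⊗[R] G) :
    ∃ N₀, ∀ N ≥ N₀, t = ∑ i ∈ Finset.range N, (Polynomial.X ^ i : Polynomial R) ⊗ₜ[R]
      polyCoeffMap R G i t := by
  induction t with
  | zero => exact ⟨0, fun N _ => by simp⟩
  | add x y hx hy =>
    obtain ⟨a, ha⟩ := hx
    obtain ⟨b, hb⟩ := hy
    refine ⟨max a b, fun N hN => ?_⟩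
    simp only [map_add, TensorProduct.tmul_add, Finset.sum_add_distrib]
    rw [← ha N (by omega), ← hb N (by omega)]
  | tmul p g =>
    refine ⟨p.natDegree + 1, fun N hN => ?_⟩
    conv_lhs => rw [p.as_sum_range' N (by omega), TensorProduct.sum_tmul]
    exact Finset.sum_congr rfl fun i _ => by
      rw [polyCoeffMap_tmul, ← TensorProduct.smul_tmul, Polynomial.smul_X_eq_monomial]

theorem polyCoeffMap_eventually_zero (t : Polynomial R ⊗[R] G) :
    ∃ N₀, ∀ N ≥ N₀, polyCoeffMap R G N t = 0 := by
  induction t with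
  | zero => exact ⟨0, fun N _ => by simp⟩
  | add x y hx hy =>
    obtain ⟨a, ha⟩ := hx
    obtain ⟨b, hb⟩ := hy
    refine ⟨max a b, fun N hN => ?_⟩
    rw [map_add, ha N (by omega), hb N (by omega), add_zero]
  | tmul p g =>
    refine ⟨p.natDegree + 1, fun N hN => ?_⟩
    rw [polyCoeffMap_tmul, Polynomial.coeff_eq_zero_of_natDegree_lt (by omega), zero_smul]

variable [Module (Polynomial R) G] [IsScalarTower R (Polynomial R) G]

/-- The action map `R[X] ⊗ G → G` of an `R[X]`-module `G`. -/
def polyActMap (R G : Type) [CommRing R] [AddCommGroup G] [Module R G]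
    [Module (Polynomial R) G] [IsScalarTower R (Polynomial R) G] :
    Polynomial R ⊗[R] G →ₗ[Polynomial R] G :=
  AlgebraTensorModule.lift
    { toFun := fun p => ((LinearMap.lsmul (Polynomial R) G p).restrictScalars R)
      map_add' := fun p q => by ext; simp
      map_smul' := fun p q => by ext; simp [mul_smul] }

/-- The map `X ⊗ 1 - 1 ⊗ X` on `R[X] ⊗ G`. -/
def polyCharMap (R G : Type) [CommRing R] [AddCommGroup G] [Module R G]
    [Module (Polynomial R) G] [IsScalarTower R (Polynomial R) G] :
    Polynomial R ⊗[R] G →ₗ[Polynomial R] Polynomial R ⊗[R] G :=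
  LinearMap.lsmul (Polynomial R) _ Polynomial.X -
    LinearMap.baseChange (Polynomial R)
      ((LinearMap.lsmul (Polynomial R) G Polynomial.X).restrictScalars R)

theorem polyActMap_tmul (p : Polynomial R) (g : G) : polyActMap R G (p ⊗ₜ g) = p • g := by
  simp [polyActMap]

theorem polyCharMap_tmul (p : Polynomial R) (g : G) :
    polyCharMap R G (p ⊗ₜ g) =
        (Polynomial.X * p) ⊗ₜ g - p ⊗ₜ ((Polynomial.X : Polynomial R) • g) := by
  simp [polyCharMap, TensorProduct.smul_tmul']

theorem polyCoeffMap_polyCharMap (i : ℕ) (t : Polynomial R ⊗[R] G) :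
    polyCoeffMap R G (i + 1) (polyCharMap R G t) =
      polyCoeffMap R G i t - (Polynomial.X : Polynomial R) • polyCoeffMap R G (i + 1) t := by
  induction t with
  | zero => simp
  | add x y hx hy => simp only [map_add, hx, hy, smul_add]; abel
  | tmul p g =>
    simp only [polyCharMap_tmul, map_sub, polyCoeffMap_tmul, Polynomial.coeff_X_mul]
    rw [smul_comm]

theorem polyCharMap_injective : Function.Injective (polyCharMap R G) := by
  rw [injective_iff_map_eq_zero]
  intro t ht
  have h1 : ∀ i, polyCoeffMap R G i t =
      (Polynomial.X : Polynomial R) • polyCoeffMap R G (i + 1) t := fun i => by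
    have := polyCoeffMap_polyCharMap i t
    rw [ht, map_zero] at this
    exact (sub_eq_zero.1 this.symm)
  have h2 : ∀ k i, polyCoeffMap R G i t =
      (Polynomial.X ^ k : Polynomial R) • polyCoeffMap R G (i + k) t := by
    intro k
    induction k with
    | zero => simp
    | succ k ih => intro i; rw [ih i, h1 (i + k), smul_smul, pow_succ, add_assoc]
  obtain ⟨a, ha⟩ := polyCoeffMap_eventually_zero t
  obtain ⟨b, hb⟩ := exists_polyCoeffMap_eq t
  rw [hb b le_rfl]
  refine Finset.sum_eq_zero fun i _ => ?_
  rw [h2 a i, ha _ (by omega), smul_zero, TensorProduct.tmul_zero]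

theorem range_polyCharMap : LinearMap.range (polyCharMap R G) = LinearMap.ker (polyActMap R G) := by
  apply le_antisymm
  · rintro _ ⟨t, rfl⟩
    rw [LinearMap.mem_ker]
    induction t with
    | zero => simp
    | add x y hx hy => rw [map_add, map_add, hx, hy, add_zero]
    | tmul p g =>
      rw [polyCharMap_tmul, map_sub, polyActMap_tmul, polyActMap_tmul, smul_smul, mul_comm,
        sub_self]
  · intro t ht
    have key : ∀ t : Polynomial R ⊗[R] G,
        t - (1 : Polynomial R) ⊗ₜ[R] polyActMap R G t ∈ LinearMap.range (polyCharMap R G) := by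
      intro t
      induction t with
      | zero => simp
      | add x y hx hy =>
        convert add_mem hx hy using 1
        simp only [map_add, TensorProduct.tmul_add]; abel
      | tmul p g =>
        rw [polyActMap_tmul]
        induction p using Polynomial.induction_on' with
        | add p q hp hq =>
          convert add_mem hp hq using 1
          simp only [add_smul, TensorProduct.tmul_add, TensorProduct.add_tmul]; abel
        | monomial n a =>
          induction n generalizing g with
          | zero =>
            have : (Polynomial.monomial 0 a : Polynomial R) = a • 1 := by
              rw [Polynomial.smul_eq_C_mul, mul_one]; rfl
            rw [this, smul_assoc, one_smul, TensorProduct.smul_tmul, sub_self]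
            exact zero_mem _
          | succ n ih =>
            have h1 := ih ((Polynomial.X : Polynomial R) • g)
            have h2 := LinearMap.mem_range_self (polyCharMap R G)
              ((Polynomial.monomial n a : Polynomial R) ⊗ₜ[R] g)
            convert add_mem h1 h2 using 1
            rw [polyCharMap_tmul, smul_smul, Polynomial.X_mul_monomial, Polynomial.monomial_mul_X]
            abel
    have := key t
    rwa [LinearMap.mem_ker.1 ht, TensorProduct.tmul_zero, sub_zero] at this

theorem polyActMap_surjective : Function.Surjective (polyActMap R G) := fun g =>
  ⟨1 ⊗ₜ g, by rw [polyActMap_tmul, one_smul]⟩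

theorem PdLT.polynomial {n : ℕ} : ∀ {G : Type} [AddCommGroup G] [Module R G]
    [Module (Polynomial R) G] [IsScalarTower R (Polynomial R) G],
    PdLT R G (n + 1) → PdLT (Polynomial R) G (n + 2) := by
  induction n with
  | zero =>
    intro G _ _ _ _ h
    have := pdLT_one_iff.1 h
    refine PdLT.of_ker polyActMap_surjective ?_ pdLT_one
    exact PdLT.congr ((LinearEquiv.ofInjective _ polyCharMap_injective).trans
      (LinearEquiv.ofEq _ _ range_polyCharMap)) pdLT_one
  | succ n ih =>
    intro G _ _ _ _ h
    have hs := Finsupp.linearCombination_id_surjective (Polynomial R) G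
    refine PdLT.of_ker hs (ih ?_) pdLT_one
    have : Module.Free R (G →₀ Polynomial R) := inferInstance
    have h1 := PdLT.ker (f := (Finsupp.linearCombination (Polynomial R)
      (id : G → G)).restrictScalars R) (n := n + 1) hs pdLT_one h
    exact h1

theorem PdLT.of_ringEquiv {R R' : Type} [CommRing R] [CommRing R'] (e : R ≃+* R') {n : ℕ}
    (h : ∀ (X : Type) [AddCommGroup X] [Module R X], PdLT R X (n + 1))
    (X : Type) [AddCommGroup X] [Module R' X] : PdLT R' X (n + 1) := by
  let : Module R X := Module.compHom X e.toRingHom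
  let := RingHomInvPair.of_ringEquiv e
  let : RingHomInvPair (e.symm : R' →+* R) (e : R →+* R') := RingHomInvPair.symm _ _
  have := h X
  let eX : X ≃ₛₗ[(e : R →+* R')] X :=
    { AddEquiv.refl X with
      map_smul' := fun r x => rfl }
  exact ModuleCat.hasProjectiveDimensionLE_of_semiLinearEquiv (M := ModuleCat.of R X)
    (N := ModuleCat.of R' X) e eX n

/-- **Hilbert's syzygy theorem.** -/
theorem hilbert_syzygy : ∀ (ℓ : ℕ) (X : Type) [AddCommGroup X] [Module (PS K ℓ) X],
    PdLT (PS K ℓ) X (ℓ + 1) := by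
  intro ℓ
  induction ℓ with
  | zero =>
    refine PdLT.of_ringEquiv (R := K) (MvPolynomial.isEmptyAlgEquiv K (Fin 0)).symm.toRingEquiv ?_
    intro X _ _
    exact pdLT_one
  | succ ℓ ih =>
    refine PdLT.of_ringEquiv (R := Polynomial (PS K ℓ))
      (MvPolynomial.finSuccEquiv K ℓ).symm.toRingEquiv ?_
    intro X _ _
    let : Module (PS K ℓ) X := Module.compHom X (Polynomial.C : PS K ℓ →+* _)
    have : IsScalarTower (PS K ℓ) (Polynomial (PS K ℓ)) X :=
      ⟨fun a p x => by rw [Polynomial.smul_eq_C_mul, mul_smul]; rfl⟩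
    exact PdLT.polynomial (ih X)

end HilbertSyzygy

section ExtVanishing

open CategoryTheory Abelian

theorem subsingleton_ext_middle {R : Type} [CommRing R] {T M N : Type} [AddCommGroup T] [Module R T]
    [AddCommGroup M] [Module R M] [AddCommGroup N] [Module R N] {f : M →ₗ[R] N}
    (hf : Function.Surjective f) {i : ℕ}
    (h₁ : Subsingleton (Ext (ModuleCat.of R T) (ModuleCat.of R (LinearMap.ker f)) i))
    (h₂ : Subsingleton (Ext (ModuleCat.of R T) (ModuleCat.of R N) i)) :
    Subsingleton (Ext (ModuleCat.of R T) (ModuleCat.of R M) i) := by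
  have hS := LinearMap.shortExact_shortComplexKer hf
  refine subsingleton_of_forall_eq 0 fun x => ?_
  obtain ⟨y, hy⟩ := Ext.covariant_sequence_exact₂ (ModuleCat.of R T) hS x
    (@Subsingleton.elim _ h₂ _ _)
  rw [← hy, @Subsingleton.elim _ h₁ y 0, Ext.zero_comp]

theorem subsingleton_ext_quotient {R : Type} [CommRing R] {T M N : Type} [AddCommGroup T]
    [Module R T] [AddCommGroup M] [Module R M] [AddCommGroup N] [Module R N] {f : M →ₗ[R] N}
    (hf : Function.Surjective f) {i : ℕ}
    (h₁ : Subsingleton (Ext (ModuleCat.of R T) (ModuleCat.of R M) i))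
    (h₂ : Subsingleton (Ext (ModuleCat.of R T) (ModuleCat.of R (LinearMap.ker f)) (i + 1))) :
    Subsingleton (Ext (ModuleCat.of R T) (ModuleCat.of R N) i) := by
  have hS := LinearMap.shortExact_shortComplexKer hf
  refine subsingleton_of_forall_eq 0 fun x => ?_
  obtain ⟨y, hy⟩ := Ext.covariant_sequence_exact₃ (ModuleCat.of R T) hS x rfl
    (@Subsingleton.elim _ h₂ _ _)
  rw [← hy, @Subsingleton.elim _ h₁ y 0, Ext.zero_comp]

theorem subsingleton_ext_of_retract {R : Type} [CommRing R] {T M N : Type} [AddCommGroup T]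
    [Module R T] [AddCommGroup M] [Module R M] [AddCommGroup N] [Module R N]
    (s : N →ₗ[R] M) (f : M →ₗ[R] N) (h : f ∘ₗ s = LinearMap.id) {i : ℕ}
    (h₁ : Subsingleton (Ext (ModuleCat.of R T) (ModuleCat.of R M) i)) :
    Subsingleton (Ext (ModuleCat.of R T) (ModuleCat.of R N) i) := by
  refine subsingleton_of_forall_eq 0 fun x => ?_
  have e : (x.comp (Ext.mk₀ (ModuleCat.ofHom s)) (add_zero i)).comp
      (Ext.mk₀ (ModuleCat.ofHom f)) (add_zero i) = x := by
    rw [Ext.comp_assoc_of_third_deg_zero, Ext.mk₀_comp_mk₀, ← ModuleCat.ofHom_comp, h]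
    exact Ext.comp_mk₀_id x
  rw [← e, @Subsingleton.elim _ h₁ (x.comp _ _) 0, Ext.zero_comp]

/-- If `Ext¹(T, ker f)` vanishes, then a surjection `f : M → T` splits. -/
theorem exists_section_of_subsingleton_ext {R : Type} [CommRing R] {T M : Type} [AddCommGroup T]
    [Module R T] [AddCommGroup M] [Module R M] {f : M →ₗ[R] T} (hf : Function.Surjective f)
    (h : Subsingleton (Ext (ModuleCat.of R T) (ModuleCat.of R (LinearMap.ker f)) 1)) :
    ∃ s : T →ₗ[R] M, f ∘ₗ s = LinearMap.id := by
  have hS := LinearMap.shortExact_shortComplexKer hf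
  obtain ⟨y, hy⟩ := Ext.covariant_sequence_exact₃ (ModuleCat.of R T) hS
    (Ext.mk₀ (𝟙 (ModuleCat.of R T))) rfl (@Subsingleton.elim _ h _ _)
  obtain ⟨g, rfl⟩ := (Ext.mk₀_bijective _ _).2 y
  rw [Ext.mk₀_comp_mk₀] at hy
  have := (Ext.mk₀_bijective _ _).1 hy
  refine ⟨g.hom, ?_⟩
  ext x
  exact congrArg (fun q => q.hom x) this

theorem isRegular_X : RingTheory.Sequence.IsRegular (PS K ℓ)
    (List.ofFn (X : Fin ℓ → PS K ℓ)) := by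
  constructor
  · constructor
    intro i hi
    have hi' : i < ℓ := by simpa using hi
    have hI : (Ideal.ofList ((List.ofFn (X : Fin ℓ → PS K ℓ)).take i) • ⊤ :
        Submodule (PS K ℓ) (PS K ℓ)) = Ideal.span (X '' {j : Fin ℓ | (j : ℕ) < i}) := by
      rw [smul_eq_mul, Ideal.mul_top, Ideal.ofList]
      congr 1
      ext a
      simp only [Set.mem_ofPred_eq, Set.mem_image, List.mem_take_iff_getElem, List.getElem_ofFn]
      constructor
      · rintro ⟨j, hj, rfl⟩
        exact ⟨⟨j, by simp at hj; omega⟩, by simp at hj; simp; omega, rfl⟩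
      · rintro ⟨j, hj, rfl⟩
        exact ⟨j, by simp; omega, rfl⟩
    rw [hI, List.getElem_ofFn]
    rw [isSMulRegular_iff_right_eq_zero_of_smul]
    intro x
    obtain ⟨f, rfl⟩ := Submodule.Quotient.mk_surjective _ x
    rw [← Submodule.Quotient.mk_smul, Submodule.Quotient.mk_eq_zero, Submodule.Quotient.mk_eq_zero]
    intro h
    rw [smul_eq_mul] at h
    change f ∈ Ideal.span (X '' {j : Fin ℓ | (j : ℕ) < i})
    replace h : X ⟨i, hi'⟩ * f ∈ Ideal.span (X '' {j : Fin ℓ | (j : ℕ) < i}) := h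
    rw [MvPolynomial.mem_ideal_span_X_image] at h ⊢
    intro m hm
    obtain ⟨j, hj, hj'⟩ := h (Finsupp.single ⟨i, hi'⟩ 1 + m) (by
      rw [MvPolynomial.mem_support_iff, MvPolynomial.coeff_X_mul]
      exact MvPolynomial.mem_support_iff.1 hm)
    refine ⟨j, hj, ?_⟩
    rw [Finsupp.add_apply, Finsupp.single_apply, if_neg, zero_add] at hj'
    · exact hj'
    · rintro rfl
      simp at hj
  · intro h
    have h1 : (1 : PS K ℓ) ∈ (Ideal.ofList (List.ofFn (X : Fin ℓ → PS K ℓ)) • ⊤ :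
        Submodule (PS K ℓ) (PS K ℓ)) := h ▸ trivial
    rw [smul_eq_mul, Ideal.mul_top] at h1
    have : Ideal.ofList (List.ofFn (X : Fin ℓ → PS K ℓ)) ≤ RingHom.ker
        (constantCoeff : PS K ℓ →+* K) := by
      rw [Ideal.ofList, Ideal.span_le]
      rintro _ ha
      obtain ⟨i, rfl⟩ := (List.mem_ofFn' _ _).1 ha
      simp [RingHom.mem_ker]
    simpa [RingHom.mem_ker] using this h1

/-- Modules supported at the origin have no low-degree extensions into modules of small
projective dimension. -/
theorem subsingleton_ext_of_pd {T : Type} [AddCommGroup T] [Module (PS K ℓ) T]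
    [Module.Finite (PS K ℓ) T] (hT : ∀ (i : Fin ℓ) (t : T), ∃ n : ℕ, (X i : PS K ℓ) ^ n • t = 0)
    {k : ℕ} : ∀ {N : Type} [AddCommGroup N] [Module (PS K ℓ) N] [Module.Finite (PS K ℓ) N],
      PdLT (PS K ℓ) N (k + 1) → ∀ i, i + k < ℓ →
      Subsingleton (Ext (ModuleCat.of (PS K ℓ) T) (ModuleCat.of (PS K ℓ) N) i) := by
  have hself : ∀ i < ℓ,
      Subsingleton (Ext (ModuleCat.of (PS K ℓ) T) (ModuleCat.of (PS K ℓ) (PS K ℓ)) i) := by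
    intro i hi
    refine ModuleCat.subsingleton_ext_of_exists_isRegular
      (Ideal.ofList (List.ofFn (X : Fin ℓ → PS K ℓ))) (ModuleCat.of (PS K ℓ) T) ?_
      (ModuleCat.of (PS K ℓ) (PS K ℓ)) (lt_top_iff_ne_top.2 isRegular_X.top_ne_smul.symm)
      _ (fun r hr => Ideal.subset_span hr) isRegular_X i (by simpa using hi)
    intro P hP
    rw [PrimeSpectrum.mem_zeroLocus]
    refine Ideal.span_le.2 fun r hr => ?_
    obtain ⟨j, rfl⟩ := (List.mem_ofFn' _ _).1 hr
    obtain ⟨t, ht⟩ := Module.mem_support_iff_exists_annihilator.1 hP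
    obtain ⟨n, hn⟩ := hT j t
    exact P.2.mem_of_pow_mem n (ht ((Submodule.mem_annihilator_span_singleton _ _).2 hn))
  have hpi : ∀ (n : ℕ) (i : ℕ), i < ℓ →
      Subsingleton (Ext (ModuleCat.of (PS K ℓ) T) (ModuleCat.of (PS K ℓ) (Fin n → PS K ℓ)) i) := by
    intro n i hi
    induction n with
    | zero =>
      exact subsingleton_ext_of_retract (M := PS K ℓ) 0 0
        (LinearMap.ext fun v => Subsingleton.elim _ _) (hself i hi)
    | succ n ih =>
      let f : (Fin (n + 1) → PS K ℓ) →ₗ[PS K ℓ] PS K ℓ := LinearMap.proj 0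
      let g : (Fin n → PS K ℓ) →ₗ[PS K ℓ] LinearMap.ker f :=
        { toFun := fun v => ⟨Fin.cons 0 v, by simp [f]⟩
          map_add' := fun v w => by ext j; refine Fin.cases ?_ (fun j => ?_) j <;> simp
          map_smul' := fun r w => by ext j; refine Fin.cases ?_ (fun j => ?_) j <;> simp }
      refine subsingleton_ext_middle (f := f) (fun x => ⟨fun _ => x, rfl⟩) ?_ (hself i hi)
      refine subsingleton_ext_of_retract
        ((LinearMap.funLeft (PS K ℓ) (PS K ℓ) Fin.succ).comp (Submodule.subtype _)) g ?_ ih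
      ext ⟨v, hv⟩ j
      have hv' : v 0 = 0 := hv
      refine Fin.cases ?_ (fun j => ?_) j
      · simp [g, hv']
      · simp [g, LinearMap.funLeft]
  induction k with
  | zero =>
    intro N _ _ _ hN i hi
    have := pdLT_one_iff.1 hN
    obtain ⟨n, f, hf⟩ := Module.Finite.exists_fin' (PS K ℓ) N
    obtain ⟨s, hs⟩ := Module.projective_lifting_property f LinearMap.id hf
    exact subsingleton_ext_of_retract s f hs (hpi n i hi)
  | succ k ih =>
    intro N _ _ _ hN i hi
    obtain ⟨n, f, hf⟩ := Module.Finite.exists_fin' (PS K ℓ) N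
    exact subsingleton_ext_quotient hf (hpi n i (by omega))
      (ih (PdLT.ker hf pdLT_one hN) (i + 1) (by omega))

/-- A map with small projective dimensions of source and kernel, which is surjective away from
the origin, is surjective if the target has positive depth. -/
theorem surjective_of_pd {N M : Type} [AddCommGroup N] [Module (PS K ℓ) N]
    [Module.Finite (PS K ℓ) N] [AddCommGroup M] [Module (PS K ℓ) M] [Module.Finite (PS K ℓ) M]
    (g : N →ₗ[PS K ℓ] M) {p : ℕ} (hp : p + 3 ≤ ℓ) (hN : PdLT (PS K ℓ) N (ℓ - 1))
    (hker : PdLT (PS K ℓ) (LinearMap.ker g) (p + 1))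
    (htors : ∀ (i : Fin ℓ) (y : M), ∃ n : ℕ, (X i : PS K ℓ) ^ n • y ∈ LinearMap.range g)
    (hreg : ∃ i : Fin ℓ, ∀ y : M, (X i : PS K ℓ) • y = 0 → y = 0) : Function.Surjective g := by
  have hT : ∀ (i : Fin ℓ) (t : M ⧸ LinearMap.range g), ∃ n : ℕ, (X i : PS K ℓ) ^ n • t = 0 := by
    intro i t
    obtain ⟨y, rfl⟩ := Submodule.Quotient.mk_surjective _ t
    obtain ⟨n, hn⟩ := htors i y
    exact ⟨n, by rwa [← Submodule.Quotient.mk_smul, Submodule.Quotient.mk_eq_zero]⟩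
  obtain ⟨l, rfl⟩ : ∃ l, ℓ = l + 3 := ⟨ℓ - 3, by omega⟩
  have h1 := subsingleton_ext_of_pd hT (N := N) (k := l + 1) hN 1 (by omega)
  have hker' : PdLT (PS K (l + 3)) (LinearMap.ker g.rangeRestrict) (p + 1) :=
    hker.congr (LinearEquiv.ofEq _ _ (LinearMap.ker_rangeRestrict g).symm)
  have h2 := subsingleton_ext_of_pd hT hker' 2 (by omega)
  have h3 := subsingleton_ext_quotient g.surjective_rangeRestrict h1 h2
  have h4 : Subsingleton (Ext (ModuleCat.of (PS K (l + 3)) (M ⧸ LinearMap.range g))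
      (ModuleCat.of (PS K (l + 3)) (LinearMap.ker (LinearMap.range g).mkQ)) 1) := by
    let e := LinearEquiv.ofEq _ _ (Submodule.ker_mkQ (LinearMap.range g))
    exact subsingleton_ext_of_retract e.toLinearMap e.symm.toLinearMap (by ext; simp) h3
  obtain ⟨s, hs⟩ := exists_section_of_subsingleton_ext (Submodule.mkQ_surjective _) h4
  obtain ⟨i, hi⟩ := hreg
  have hpow : ∀ (n : ℕ) (y : M), (X i : PS K (l + 3)) ^ n • y = 0 → y = 0 := by
    intro n
    induction n with
    | zero => simp
    | succ n ih => intro y hy; rw [pow_succ', mul_smul] at hy; exact ih y (hi _ hy)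
  intro y
  have hy : s ((LinearMap.range g).mkQ y) = 0 := by
    obtain ⟨n, hn⟩ := hT i ((LinearMap.range g).mkQ y)
    exact hpow n _ (by rw [← map_smul, hn, map_zero])
  have : (LinearMap.range g).mkQ y = 0 := by
    rw [← LinearMap.id_apply (R := PS K (l + 3)) ((LinearMap.range g).mkQ y), ← hs,
      LinearMap.comp_apply, hy, map_zero]
  exact (Submodule.Quotient.mk_eq_zero _).1 this

end ExtVanishing

section LinearForms

theorem linP_smul (t : K) (c : Fin ℓ → K) : linP (t • c) = C t * linP c := by
  simp [linP, Finset.mul_sum, mul_assoc]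

theorem linP_add (c c' : Fin ℓ → K) : linP (c + c') = linP c + linP c' := by
  simp [linP, add_mul, Finset.sum_add_distrib]

theorem coeff_single_mul_linP (q : PS K ℓ) (c : Fin ℓ → K) (j : Fin ℓ) :
    coeff (Finsupp.single j 1) (q * linP c) = coeff 0 q * c j := by
  rw [linP, Finset.mul_sum, MvPolynomial.coeff_sum]
  have : ∀ i, coeff (Finsupp.single j 1) (q * (C (c i) * X i)) =
      if i = j then coeff 0 q * c i else 0 := by
    intro i
    rw [mul_left_comm, MvPolynomial.coeff_C_mul, MvPolynomial.coeff_mul_X']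
    by_cases h : i = j
    · subst h; simp [mul_comm]
    · simp [h]
  simp [this]

theorem eq_smul_of_linP_dvd {c c' : Fin ℓ → K} (h : linP c ∣ linP c') : ∃ t : K, c' = t • c := by
  obtain ⟨q, hq⟩ := h
  refine ⟨coeff 0 q, funext fun j => ?_⟩
  have h1 := coeff_single_mul_linP q c j
  have h2 := coeff_single_mul_linP 1 c' j
  rw [mul_comm, ← hq] at h1
  rw [one_mul, MvPolynomial.coeff_one, if_pos rfl, one_mul] at h2
  rw [← h2, h1]; rfl

theorem linP_injective {c c' : Fin ℓ → K} (h : linP c = linP c') : c = c' := by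
  funext j
  have h1 := coeff_single_mul_linP 1 c j
  have h2 := coeff_single_mul_linP 1 c' j
  rw [h, h2] at h1
  simpa using h1.symm

theorem linP_zero : linP (0 : Fin ℓ → K) = 0 := by simp [linP]

theorem linP_ne_zero {c : Fin ℓ → K} (h : c ≠ 0) : linP c ≠ 0 := fun h' =>
  h (linP_injective (h'.trans linP_zero.symm))

theorem linP_isHomogeneous (c : Fin ℓ → K) : (linP c).IsHomogeneous 1 := by
  refine MvPolynomial.IsHomogeneous.sum _ _ _ fun i _ => ?_
  simpa using (isHomogeneous_C _ (c i)).mul (isHomogeneous_X K i)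

theorem irreducible_linP {c : Fin ℓ → K} (h : c ≠ 0) : Irreducible (linP c) := by
  apply irreducible_of_totalDegree_eq_one
  · exact (linP_isHomogeneous c).totalDegree (linP_ne_zero h)
  · intro x hx
    obtain ⟨j, hj⟩ := Function.ne_iff.1 h
    have h1 := coeff_single_mul_linP 1 c j
    rw [one_mul, MvPolynomial.coeff_one, if_pos rfl, one_mul] at h1
    exact isUnit_of_dvd_unit (hx (Finsupp.single j 1)) (h1 ▸ isUnit_iff_ne_zero.2 hj)

theorem isRelPrime_linP {c c' : Fin ℓ → K} (hc : c ≠ 0) (h : ∀ t : K, c' ≠ t • c) :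
    IsRelPrime (linP c) (linP c') :=
  (irreducible_linP hc).isRelPrime_iff_not_dvd.2 fun hd => by
    obtain ⟨t, ht⟩ := eq_smul_of_linP_dvd hd
    exact h t ht

theorem Arrangement.isRelPrime (A : Arrangement K ℓ) {c c' : Fin ℓ → K} (hc : c ∈ A.hyps)
    (hc' : c' ∈ A.hyps) (h : c ≠ c') : IsRelPrime (linP c) (linP c') :=
  isRelPrime_linP (A.ne_zero c hc) (A.nonprop c' hc' c hc h.symm)

end LinearForms

section FreeModules

variable {R : Type} [CommRing R]

/-- Coordinatewise divisibility in free modules. -/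
theorem exists_smul_of_forall_coord {ι M : Type} [AddCommGroup M] [Module R M]
    (b : Module.Basis ι R M) (f : R) (x : M) (h : ∀ i, f ∣ b.repr x i) : ∃ y, x = f • y := by
  choose q hq using h
  refine ⟨∑ i ∈ (b.repr x).support, q i • b i, ?_⟩
  conv_lhs => rw [← b.linearCombination_repr x]
  rw [Finsupp.linearCombination_apply, Finsupp.sum, Finset.smul_sum]
  exact Finset.sum_congr rfl fun i _ => by rw [hq i, mul_smul]

variable [DecompositionMonoid R]

theorem exists_smul_of_isRelPrime {M : Type} [AddCommGroup M] [Module R M] [Module.Free R M]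
    {f g : R} (h : IsRelPrime f g) {x y : M} (e : g • x = f • y) : ∃ z, x = f • z := by
  let b := Module.Free.chooseBasis R M
  refine exists_smul_of_forall_coord b f x fun i => ?_
  have := congrArg (fun v => b.repr v i) e
  simp only [map_smul, Finsupp.smul_apply, smul_eq_mul] at this
  exact h.dvd_of_dvd_mul_left (Dvd.intro _ this.symm)

theorem exists_prod_smul {M ι : Type} [AddCommGroup M] [Module R M] [Module.Free R M]
    (s : Finset ι) (f : ι → R) (hf : (s : Set ι).Pairwise fun i j => IsRelPrime (f i) (f j))
    (x : M) (h : ∀ i ∈ s, ∃ y, x = f i • y) : ∃ y, x = (∏ i ∈ s, f i) • y := by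
  let b := Module.Free.chooseBasis R M
  refine exists_smul_of_forall_coord b _ x fun j => ?_
  refine Finset.prod_dvd_of_isRelPrime hf fun i hi => ?_
  obtain ⟨y, rfl⟩ := h i hi
  simp

/-- The three-term divisibility condition used to descend membership along restrictions
holds in projective modules once it holds in the ring. -/
theorem exists_of_smul_eq_add {R M : Type} [CommRing R] [AddCommGroup M] [Module R M]
    [Module.Projective R M] {f g h : R}
    (H : ∀ s a b : R, h * s = f * a + g * b → ∃ a' b', s = f * a' + g * b')
    {s a b : M} (e : h • s = f • a + g • b) : ∃ a' b', s = f • a' + g • b' := by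
  obtain ⟨i, hi⟩ := Module.projective_def'.1 ‹Module.Projective R M›
  have key : ∀ j, ∃ a' b', i s j = f * a' + g * b' := fun j => by
    apply H (i s j) (i a j) (i b j)
    have := congrArg (fun v => i v j) e
    simpa using this
  choose a' b' hab using key
  refine ⟨Finsupp.linearCombination R id (∑ j ∈ (i s).support, Finsupp.single j (a' j)),
    Finsupp.linearCombination R id (∑ j ∈ (i s).support, Finsupp.single j (b' j)), ?_⟩
  rw [← map_smul, ← map_smul, ← map_add]
  have : f • ∑ j ∈ (i s).support, Finsupp.single j (a' j) +
      g • ∑ j ∈ (i s).support, Finsupp.single j (b' j) = i s := by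
    conv_rhs => rw [← Finsupp.sum_single (i s), Finsupp.sum]
    rw [Finset.smul_sum, Finset.smul_sum, ← Finset.sum_add_distrib]
    refine Finset.sum_congr rfl fun j _ => ?_
    rw [hab j, Finsupp.smul_single, Finsupp.smul_single, ← Finsupp.single_add]; rfl
  rw [this]
  exact (LinearMap.congr_fun hi s).symm

/-- Descent of membership in the range of `φ` from two multiples `f • y`, `g • y` to `y`. -/
theorem mem_range_of_smul_mem_range {R N Y : Type} [CommRing R] [AddCommGroup N] [Module R N]
    [AddCommGroup Y] [Module R Y] (φ : N →ₗ[R] Y) [Module.Projective R (LinearMap.ker φ)]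
    {f g h : R} (H : ∀ s a b : R, h * s = f * a + g * b → ∃ a' b', s = f * a' + g * b')
    (hY : ∀ y : Y, h • y = 0)
    (hfY : ∀ y : Y, f • y = 0 → y = 0)
    (H1 : ∀ x y : N, g • x = f • y → ∃ z, x = f • z)
    {y : Y} (hf : f • y ∈ LinearMap.range φ) (hg : g • y ∈ LinearMap.range φ) :
    y ∈ LinearMap.range φ := by
  obtain ⟨u, hu⟩ := hf
  obtain ⟨v, hv⟩ := hg
  have hθ : g • u - f • v ∈ LinearMap.ker φ := by
    rw [LinearMap.mem_ker, map_sub, map_smul, map_smul, hu, hv, smul_comm, sub_self]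
  have hh : ∀ x : N, h • x ∈ LinearMap.ker φ := fun x => by
    rw [LinearMap.mem_ker, map_smul, hY]
  obtain ⟨a, b, hab⟩ := exists_of_smul_eq_add (M := LinearMap.ker φ) (f := f) (g := g) H
    (s := ⟨_, hθ⟩) (a := ⟨_, hh (-v)⟩) (b := ⟨_, hh u⟩) (by
      ext
      simp only [Submodule.coe_smul, Submodule.coe_add, smul_sub, smul_neg]
      rw [smul_comm h g, smul_comm h f]; abel)
  have hab' : g • u - f • v = f • (a : N) + g • (b : N) := congrArg Subtype.val hab
  obtain ⟨z, hz⟩ := H1 (u - b) (v + a) (by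
    rw [smul_sub, smul_add, sub_eq_iff_eq_add.1 hab']; abel)
  refine ⟨z, ?_⟩
  have h1 : f • (φ z - y) = 0 := by
    rw [smul_sub, ← map_smul, ← hz, map_sub, hu, LinearMap.mem_ker.1 b.2, sub_zero, sub_self]
  exact sub_eq_zero.1 (hfY _ h1)

end FreeModules

section ExteriorForms

instance {R M : Type} [CommRing R] [AddCommGroup M] [Module R M] [Module.Free R M] :
    Module.Free R (ExteriorAlgebra R M) :=
  have ⟨I, b⟩ := Module.Free.exists_basis R M
  let : LinearOrder I := linearOrderOfSTO WellOrderingRel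
  Module.Free.of_basis (Module.Basis.ExteriorAlgebra b)

instance (p : ℕ) : Module.Free (PS K ℓ) (formsP K ℓ p) :=
  inferInstanceAs (Module.Free (PS K ℓ) (⋀[PS K ℓ]^p (Fin ℓ → PS K ℓ)))

instance (p : ℕ) : Module.Finite (PS K ℓ) (formsP K ℓ p) :=
  inferInstanceAs (Module.Finite (PS K ℓ) (⋀[PS K ℓ]^p (Fin ℓ → PS K ℓ)))

theorem mul_mem_formsP {p q : ℕ} {x y : ExtF K ℓ} (hx : x ∈ formsP K ℓ p)
    (hy : y ∈ formsP K ℓ q) : x * y ∈ formsP K ℓ (p + q) := by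
  rw [formsP, pow_add]; exact Submodule.mul_mem_mul hx hy

theorem ι_mem_formsP (a : Fin ℓ → PS K ℓ) :
    ExteriorAlgebra.ι (PS K ℓ) a ∈ formsP K ℓ 1 := by
  rw [formsP, pow_one]; exact LinearMap.mem_range_self _ _

theorem dP_mem_formsP (c : Fin ℓ → K) : dP c ∈ formsP K ℓ 1 := ι_mem_formsP _

theorem dP_mul_mem_formsP {p : ℕ} (c : Fin ℓ → K) {x : ExtF K ℓ} (hx : x ∈ formsP K ℓ p) :
    dP c * x ∈ formsP K ℓ (p + 1) := by
  rw [add_comm]; exact mul_mem_formsP (dP_mem_formsP c) hx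

theorem algebraMap_mem_formsP (s : PS K ℓ) :
    algebraMap (PS K ℓ) (ExtF K ℓ) s ∈ formsP K ℓ 0 := by
  rw [formsP, pow_zero]; exact Submodule.algebraMap_mem s

theorem mem_formsP_zero {x : ExtF K ℓ} (h : x ∈ formsP K ℓ 0) :
    ∃ s, x = algebraMap (PS K ℓ) (ExtF K ℓ) s := by
  rw [formsP, pow_zero, Submodule.mem_one] at h
  obtain ⟨s, hs⟩ := h
  exact ⟨s, hs.symm⟩

theorem mem_formsP_one {x : ExtF K ℓ} (h : x ∈ formsP K ℓ 1) :
    ∃ a, x = ExteriorAlgebra.ι (PS K ℓ) a := by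
  rw [formsP, pow_one] at h
  obtain ⟨s, hs⟩ := h
  exact ⟨s, hs.symm⟩

theorem dP_mul_self (c : Fin ℓ → K) : dP c * dP c = 0 := ExteriorAlgebra.ι_sq_zero _

theorem dP_mul_dP_mul (c : Fin ℓ → K) (x : ExtF K ℓ) : dP c * (dP c * x) = 0 := by
  rw [← mul_assoc, dP_mul_self, zero_mul]

theorem dP_smul (t : K) (c : Fin ℓ → K) : dP (t • c) = (C t : PS K ℓ) • dP c := by
  rw [dP, dP, ← map_smul]; congr 1; funext i; simp

theorem dP_add (c c' : Fin ℓ → K) : dP (c + c') = dP c + dP c' := by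
  rw [dP, dP, dP, ← map_add]; congr 1; funext i; simp

theorem dP_zero : dP (0 : Fin ℓ → K) = 0 := by
  simpa using dP_smul (0 : K) (0 : Fin ℓ → K)

/-- Contraction of forms with a linear form on `S^ℓ`. -/
def contr (v : Module.Dual (PS K ℓ) (Fin ℓ → PS K ℓ)) : ExtF K ℓ →ₗ[PS K ℓ] ExtF K ℓ :=
  CliffordAlgebra.contractLeft v

theorem contr_ι_mul (v : Module.Dual (PS K ℓ) (Fin ℓ → PS K ℓ)) (a : Fin ℓ → PS K ℓ)
    (b : ExtF K ℓ) : contr v (ExteriorAlgebra.ι (PS K ℓ) a * b) =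
      v a • b - ExteriorAlgebra.ι (PS K ℓ) a * contr v b :=
  CliffordAlgebra.contractLeft_ι_mul v a b

theorem contr_ι (v : Module.Dual (PS K ℓ) (Fin ℓ → PS K ℓ)) (a : Fin ℓ → PS K ℓ) :
    contr v (ExteriorAlgebra.ι (PS K ℓ) a) = algebraMap (PS K ℓ) _ (v a) :=
  CliffordAlgebra.contractLeft_ι _ v a

theorem contr_mem_formsP (v : Module.Dual (PS K ℓ) (Fin ℓ → PS K ℓ)) (p : ℕ) :
    ∀ {x : ExtF K ℓ}, x ∈ formsP K ℓ (p + 1) → contr v x ∈ formsP K ℓ p := by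
  induction p with
  | zero =>
    intro x hx
    obtain ⟨a, rfl⟩ := mem_formsP_one hx
    rw [contr_ι]; exact algebraMap_mem_formsP _
  | succ p ih =>
    intro x hx
    rw [formsP, pow_succ'] at hx
    induction hx using Submodule.mul_induction_on' with
    | mem_mul_mem a ha b hb =>
      obtain ⟨a, rfl⟩ := ha
      rw [contr_ι_mul]
      exact sub_mem (Submodule.smul_mem _ _ hb)
        (add_comm 1 p ▸ mul_mem_formsP (ι_mem_formsP a) (ih hb))
    | add a _ b _ ha hb => rw [map_add]; exact add_mem ha hb

/-- A constant vector field dual to the nonzero coefficient vector `c`. -/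
theorem exists_dual_eq_one {c : Fin ℓ → K} (hc : c ≠ 0) :
    ∃ v : Module.Dual (PS K ℓ) (Fin ℓ → PS K ℓ), v (fun i => C (c i)) = 1 := by
  obtain ⟨i, hi⟩ := Function.ne_iff.1 hc
  refine ⟨(C (c i)⁻¹ : PS K ℓ) • LinearMap.proj i, ?_⟩
  rw [LinearMap.smul_apply, LinearMap.proj_apply, smul_eq_mul, ← C_mul,
    inv_mul_cancel₀ hi, C_1]

theorem contr_dP_mul {c : Fin ℓ → K} {v : Module.Dual (PS K ℓ) (Fin ℓ → PS K ℓ)}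
    (hv : v (fun i => C (c i)) = 1) (x : ExtF K ℓ) :
    contr v (dP c * x) = x - dP c * contr v x := by
  rw [dP, contr_ι_mul, hv, one_smul]

theorem eq_dP_mul_contr {c : Fin ℓ → K} {v : Module.Dual (PS K ℓ) (Fin ℓ → PS K ℓ)}
    (hv : v (fun i => C (c i)) = 1) {x : ExtF K ℓ} (h : dP c * x = 0) :
    x = dP c * contr v x := by
  have := contr_dP_mul hv x
  rw [h, map_zero] at this
  exact sub_eq_zero.1 this.symm

theorem dP_mul_eq_zero_of_smul {c : Fin ℓ → K} {s : PS K ℓ} (hs : s ≠ 0) {η ξ : ExtF K ℓ}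
    (h : dP c * η = s • ξ) : dP c * ξ = 0 := by
  have : s • (dP c * ξ) = 0 := by rw [← mul_smul_comm, ← h, dP_mul_dP_mul]
  exact (smul_eq_zero.1 this).resolve_left hs

theorem mem_exteriorPower_of_smul {R M : Type} [CommRing R] [IsDomain R] [AddCommGroup M]
    [Module R M] [Module.Free R M] {p : ℕ} {s : R} (hs : s ≠ 0) {x : ExteriorAlgebra R M}
    (h : s • x ∈ ⋀[R]^p M) : x ∈ ⋀[R]^p M := by
  let 𝒜 : ℕ → Submodule R (ExteriorAlgebra R M) := fun i => ⋀[R]^i M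
  have key : ∀ j, j ≠ p → (DirectSum.decompose 𝒜 x j : ExteriorAlgebra R M) = 0 := fun j hj => by
    have h1 : (DirectSum.decompose 𝒜 (s • x) j : ExteriorAlgebra R M) = 0 :=
      DirectSum.decompose_of_mem_ne 𝒜 (i := p) h hj.symm
    rw [DirectSum.decompose_smul] at h1
    have h2 : s • (DirectSum.decompose 𝒜 x j : ExteriorAlgebra R M) = 0 := h1
    exact (smul_eq_zero.1 h2).resolve_left hs
  rw [← DirectSum.sum_support_decompose 𝒜 x]
  refine Submodule.sum_mem _ fun j _ => ?_
  by_cases hj : j = p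
  · subst hj; exact (DirectSum.decompose 𝒜 x j).2
  · rw [key j hj]; exact zero_mem _

theorem mem_formsP_of_smul {p : ℕ} {s : PS K ℓ} (hs : s ≠ 0) {x : ExtF K ℓ}
    (h : s • x ∈ formsP K ℓ p) : x ∈ formsP K ℓ p :=
  mem_exteriorPower_of_smul hs h

end ExteriorForms

section OmegaBasics

theorem mem_Omega {A : Arrangement K ℓ} {m : (Fin ℓ → K) → ℕ} {p : ℕ} {η : ExtF K ℓ} :
    η ∈ Omega A m p ↔ η ∈ formsP K ℓ p ∧
      ∀ c ∈ A.hyps, ∃ ξ : ExtF K ℓ, dP c * η = linP c ^ m c • ξ := by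
  simp only [Omega, Submodule.mem_inf, Submodule.mem_iInf, Submodule.mem_comap,
    Submodule.mem_map, LinearMap.mulLeft_apply, LinearMap.lsmul_apply]
  refine and_congr_right fun hη => forall₂_congr fun c hc => ⟨?_, ?_⟩
  · rintro ⟨ξ, -, h⟩; exact ⟨ξ, h.symm⟩
  · rintro ⟨ξ, h⟩
    exact ⟨ξ, mem_formsP_of_smul (pow_ne_zero _ (linP_ne_zero (A.ne_zero c hc)))
      (h ▸ dP_mul_mem_formsP c hη), h.symm⟩

theorem mem_Omega_succ {A : Arrangement K ℓ} {m : (Fin ℓ → K) → ℕ} {p : ℕ} {η : ExtF K ℓ} :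
    η ∈ Omega A m (p + 1) ↔ η ∈ formsP K ℓ (p + 1) ∧
      ∀ c ∈ A.hyps, ∃ b ∈ formsP K ℓ (p + 1), ∃ a ∈ formsP K ℓ p,
        η = linP c ^ m c • b + dP c * a := by
  rw [mem_Omega]
  refine and_congr_right fun hη => forall₂_congr fun c hc => ⟨?_, ?_⟩
  · rintro ⟨ξ, h⟩
    obtain ⟨v, hv⟩ := exists_dual_eq_one (A.ne_zero c hc)
    have hξ : ξ ∈ formsP K ℓ (p + 1 + 1) :=
      mem_formsP_of_smul (pow_ne_zero _ (linP_ne_zero (A.ne_zero c hc)))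
        (h ▸ dP_mul_mem_formsP c hη)
    refine ⟨contr v ξ, contr_mem_formsP v _ hξ, contr v η, contr_mem_formsP v _ hη, ?_⟩
    rw [← map_smul, ← h, contr_dP_mul hv, sub_add_cancel]
  · rintro ⟨b, -, a, -, h⟩
    exact ⟨dP c * b, by rw [h, mul_add, dP_mul_dP_mul, add_zero, mul_smul_comm]⟩

theorem Omega_le_formsP {A : Arrangement K ℓ} {m : (Fin ℓ → K) → ℕ} {p : ℕ} :
    Omega A m p ≤ formsP K ℓ p := inf_le_left

end OmegaBasics

section OmegaProjDim

theorem Omega_pdLT (A : Arrangement K ℓ) (m : (Fin ℓ → K) → ℕ) (p : ℕ) :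
    PdLT (PS K ℓ) (Omega A m p) (max 1 (ℓ - 1)) := by
  let f : (formsP K ℓ p × (A.hyps → ExtF K ℓ)) →ₗ[PS K ℓ] (A.hyps → ExtF K ℓ) :=
    LinearMap.pi fun c =>
      (LinearMap.mulLeft (PS K ℓ) (dP c.1)) ∘ₗ (formsP K ℓ p).subtype ∘ₗ LinearMap.fst _ _ _ -
      (linP c.1 ^ m c.1) • ((LinearMap.proj c) ∘ₗ LinearMap.snd _ _ _)
  have hf : ∀ x, f x = 0 ↔
      ∀ c : A.hyps, dP c.1 * (x.1 : ExtF K ℓ) = linP c.1 ^ m c.1 • x.2 c := fun x => by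
    rw [funext_iff]
    exact forall_congr' fun c => sub_eq_zero
  let g : LinearMap.ker f →ₗ[PS K ℓ] Omega A m p :=
    LinearMap.codRestrict _
      ((formsP K ℓ p).subtype ∘ₗ LinearMap.fst _ _ _ ∘ₗ (LinearMap.ker f).subtype) fun x =>
        mem_Omega.2 ⟨x.1.1.2, fun c hc => ⟨_, (hf _).1 x.2 ⟨c, hc⟩⟩⟩
  have hg : Function.Bijective g := by
    constructor
    · rw [injective_iff_map_eq_zero]
      rintro ⟨⟨η, ξ⟩, hx⟩ h0
      have hη : (η : ExtF K ℓ) = 0 := congrArg Subtype.val h0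
      have h1 := (hf _).1 hx
      simp only [hη, mul_zero] at h1
      have hξ : ξ = 0 := funext fun c =>
        (smul_eq_zero.1 (h1 c).symm).resolve_left
          (pow_ne_zero _ (linP_ne_zero (A.ne_zero c.1 c.2)))
      ext : 2
      · exact Subtype.ext hη
      · exact hξ
    · rintro ⟨η, hη⟩
      obtain ⟨h1, h2⟩ := mem_Omega.1 hη
      choose ξ hξ using h2
      exact ⟨⟨(⟨η, h1⟩, fun c => ξ c.1 c.2), (hf _).2 fun c => hξ c.1 c.2⟩, rfl⟩
  exact (PdLT.ker_of_global (hilbert_syzygy ℓ) f).congr (LinearEquiv.ofBijective g hg)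

theorem Arrangement.pairwise_isRelPrime_pow (A : Arrangement K ℓ) (m : (Fin ℓ → K) → ℕ)
    {s : Finset (Fin ℓ → K)} (hs : s ⊆ A.hyps) :
    (s : Set (Fin ℓ → K)).Pairwise fun c c' => IsRelPrime (linP c ^ m c) (linP c' ^ m c') :=
  fun _ hc _ hc' h => ((A.isRelPrime (hs hc) (hs hc') h).pow_left).pow_right

theorem dvd_of_smul_dP_eq {c : Fin ℓ → K} (hc : c ≠ 0) {s t : PS K ℓ} {ξ : ExtF K ℓ}
    (h : s • dP c = t • ξ) : t ∣ s := by
  obtain ⟨v, hv⟩ := exists_dual_eq_one hc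
  have h1 := congrArg (fun x => ExteriorAlgebra.algebraMapInv (contr v x)) h
  simp only [map_smul, dP, contr_ι, hv, map_one, smul_eq_mul, mul_one] at h1
  exact Dvd.intro _ h1.symm

theorem Omega_zero_projective (A : Arrangement K ℓ) (m : (Fin ℓ → K) → ℕ) :
    Module.Projective (PS K ℓ) (Omega A m 0) := by
  let g : PS K ℓ →ₗ[PS K ℓ] Omega A m 0 := LinearMap.codRestrict _
    (Qpoly A m • Algebra.linearMap (PS K ℓ) (ExtF K ℓ)) fun s => mem_Omega.2
      ⟨Submodule.smul_mem _ _ (algebraMap_mem_formsP s), fun c hc => by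
        obtain ⟨q, hq⟩ := Finset.dvd_prod_of_mem (fun c => linP c ^ m c) hc
        refine ⟨q • s • dP c, ?_⟩
        rw [LinearMap.smul_apply, Algebra.linearMap_apply, mul_smul_comm, ← Algebra.commutes,
          ← Algebra.smul_def, Qpoly, hq, mul_smul]⟩
  have hQ : Qpoly A m ≠ 0 := Finset.prod_ne_zero_iff.2 fun c hc =>
    pow_ne_zero _ (linP_ne_zero (A.ne_zero c hc))
  have hg : Function.Bijective g := by
    constructor
    · intro s t h
      have h1 : Qpoly A m • algebraMap (PS K ℓ) (ExtF K ℓ) s =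
        Qpoly A m • algebraMap (PS K ℓ) (ExtF K ℓ) t := congrArg Subtype.val h
      exact ExteriorAlgebra.algebraMap_leftInverse _ |>.injective (smul_right_injective _ hQ h1)
    · rintro ⟨η, hη⟩
      obtain ⟨h1, h2⟩ := mem_Omega.1 hη
      obtain ⟨s, rfl⟩ := mem_formsP_zero h1
      have : Qpoly A m ∣ s := Finset.prod_dvd_of_isRelPrime
        (A.pairwise_isRelPrime_pow m subset_rfl) fun c hc => by
          obtain ⟨ξ, hξ⟩ := h2 c hc
          rw [← Algebra.commutes, ← Algebra.smul_def] at hξ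
          exact dvd_of_smul_dP_eq (A.ne_zero c hc) hξ
      obtain ⟨t, rfl⟩ := this
      refine ⟨t, Subtype.ext ?_⟩
      exact (Algebra.smul_def _ _).trans
        (map_mul (algebraMap (PS K ℓ) (ExtF K ℓ)) _ _).symm
  exact Module.Projective.of_equiv (LinearEquiv.ofBijective g hg)

end OmegaProjDim

section Saito

theorem ExteriorAlgebra.apply_eq_pow_smul {R M : Type} [CommRing R] [AddCommGroup M] [Module R M]
    (h : ExteriorAlgebra R M →ₐ[R] ExteriorAlgebra R M) (q : R)
    (hq : ∀ v, h (ExteriorAlgebra.ι R v) = q • ExteriorAlgebra.ι R v) (p : ℕ) :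
    ∀ x ∈ ⋀[R]^p M, h x = q ^ p • x := by
  induction p with
  | zero =>
    intro x hx
    rw [ExteriorAlgebra.exteriorPower, pow_zero, Submodule.mem_one] at hx
    obtain ⟨s, rfl⟩ := hx
    rw [AlgHom.commutes, pow_zero, one_smul]
  | succ p ih =>
    intro x hx
    rw [ExteriorAlgebra.exteriorPower, pow_succ'] at hx
    induction hx using Submodule.mul_induction_on' with
    | mem_mul_mem a ha b hb =>
      obtain ⟨a, rfl⟩ := ha
      rw [map_mul, hq, ih b hb, smul_mul_smul_comm, pow_succ']
    | add a _ b _ ha hb => rw [map_add, ha, hb, smul_add]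

variable {A : Arrangement K ℓ} {m : (Fin ℓ → K) → ℕ}

theorem Qpoly_ne_zero (A : Arrangement K ℓ) (m : (Fin ℓ → K) → ℕ) : Qpoly A m ≠ 0 :=
  Finset.prod_ne_zero_iff.2 fun c hc => pow_ne_zero _ (linP_ne_zero (A.ne_zero c hc))

/-- The product of the `linP c' ^ m c'` over the hyperplanes other than `c`. -/
def Qcompl (A : Arrangement K ℓ) (m : (Fin ℓ → K) → ℕ) (c : Fin ℓ → K) : PS K ℓ :=
  ∏ c' ∈ A.hyps.erase c, linP c' ^ m c'

theorem Qpoly_eq {c : Fin ℓ → K} (hc : c ∈ A.hyps) :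
    Qpoly A m = linP c ^ m c * Qcompl A m c :=
  (Finset.mul_prod_erase _ _ hc).symm

theorem isRelPrime_Qcompl {c : Fin ℓ → K} (hc : c ∈ A.hyps) :
    IsRelPrime (linP c ^ m c) (Qcompl A m c) :=
  IsRelPrime.prod_right fun _ hc' =>
    A.pairwise_isRelPrime_pow m subset_rfl hc (Finset.mem_of_mem_erase hc')
      (Finset.ne_of_mem_erase hc').symm

theorem Qpoly_smul_mem_Omega {p : ℕ} {x : ExtF K ℓ} (hx : x ∈ formsP K ℓ p) :
    Qpoly A m • x ∈ Omega A m p :=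
  mem_Omega.2 ⟨Submodule.smul_mem _ _ hx, fun c hc =>
    ⟨Qcompl A m c • (dP c * x), by rw [Qpoly_eq hc, mul_smul_comm, mul_smul]⟩⟩

theorem Qcompl_smul_dP_mem_Omega (c : Fin ℓ → K) : Qcompl A m c • dP c ∈ Omega A m 1 :=
  mem_Omega.2 ⟨Submodule.smul_mem _ _ (dP_mem_formsP c), fun c' hc' => by
    by_cases h : c' = c
    · subst h
      exact ⟨0, by rw [mul_smul_comm, dP_mul_self, smul_zero, smul_zero]⟩
    · obtain ⟨q, hq⟩ := Finset.dvd_prod_of_mem (fun c => linP c ^ m c)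
        (Finset.mem_erase.2 ⟨h, hc'⟩)
      exact ⟨q • (dP c' * dP c), by rw [Qcompl, hq, mul_smul_comm, mul_smul]⟩⟩

theorem anticomm_dP (c : Fin ℓ → K) {b : ExtF K ℓ} (hb : b ∈ formsP K ℓ 1) :
    dP c * b = - (b * dP c) := by
  obtain ⟨b, rfl⟩ := mem_formsP_one hb
  exact eq_neg_of_add_eq_zero_left (ExteriorAlgebra.ι_add_mul_swap _ _)

theorem mul_mem_smul_Omega {p : ℕ} {n η : ExtF K ℓ} (hn : n ∈ Omega A m 1)
    (hη : η ∈ Omega A m (p + 1)) : ∃ τ ∈ Omega A m (p + 2), n * η = Qpoly A m • τ := by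
  have hnη : n * η ∈ formsP K ℓ (p + 2) := by
    have := mul_mem_formsP (Omega_le_formsP hn) (Omega_le_formsP hη)
    rwa [add_comm] at this
  obtain ⟨τ, hτ⟩ : ∃ τ, n * η = Qpoly A m • τ := by
    refine exists_prod_smul _ _ (A.pairwise_isRelPrime_pow m subset_rfl) _ fun c hc => ?_
    obtain ⟨b, -, a, ha, e⟩ := (mem_Omega_succ.1 hn).2 c hc
    obtain ⟨b', -, a', -, e'⟩ := (mem_Omega_succ.1 hη).2 c hc
    obtain ⟨s, rfl⟩ := mem_formsP_zero ha
    refine ⟨b * η + dP c * algebraMap _ _ s * b', ?_⟩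
    have h1 : dP c * algebraMap _ _ s * (dP c * a') = 0 := by
      rw [mul_assoc, ← mul_assoc (algebraMap _ _ s), Algebra.commutes, mul_assoc,
        dP_mul_dP_mul]
    conv_lhs => rw [e, add_mul]
    rw [smul_add, smul_mul_assoc]
    congr 1
    conv_lhs => rw [e', mul_add, h1, add_zero, mul_smul_comm]
  refine ⟨τ, mem_Omega.2 ⟨mem_formsP_of_smul (Qpoly_ne_zero A m) (hτ ▸ hnη), fun c hc => ?_⟩, hτ⟩
  obtain ⟨b, hb, a, -, e⟩ := (mem_Omega_succ.1 hn).2 c hc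
  obtain ⟨ξ, hξ⟩ := (mem_Omega.1 hη).2 c hc
  have h1 : dP c * (n * η) = linP c ^ m c • linP c ^ m c • (-(b * ξ)) := by
    conv_lhs => rw [e, add_mul, mul_add, mul_assoc (dP c), dP_mul_dP_mul, add_zero,
      smul_mul_assoc, mul_smul_comm, ← mul_assoc, anticomm_dP c hb, neg_mul, mul_assoc, hξ]
    rw [mul_smul_comm, smul_neg, smul_neg, smul_neg]
  rw [hτ, mul_smul_comm, Qpoly_eq hc, mul_smul] at h1
  have h2 := smul_right_injective _ (pow_ne_zero _ (linP_ne_zero (A.ne_zero c hc))) h1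
  exact exists_smul_of_isRelPrime (isRelPrime_Qcompl hc) h2

theorem pow_Omega_one_le (p : ℕ) : ∀ x ∈ Omega A m 1 ^ (p + 1),
    ∃ τ ∈ Omega A m (p + 1), x = Qpoly A m ^ p • τ := by
  induction p with
  | zero => intro x hx; exact ⟨x, by simpa using hx, by simp⟩
  | succ p ih =>
    intro x hx
    rw [pow_succ'] at hx
    induction hx using Submodule.mul_induction_on' with
    | mem_mul_mem a ha b hb =>
      obtain ⟨τ, hτ, rfl⟩ := ih b hb
      obtain ⟨τ', hτ', e⟩ := mul_mem_smul_Omega ha hτ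
      exact ⟨τ', hτ', by rw [mul_smul_comm, e, smul_smul, pow_succ]⟩
    | add a _ b _ ha hb =>
      obtain ⟨τ, hτ, rfl⟩ := ha
      obtain ⟨τ', hτ', rfl⟩ := hb
      exact ⟨_, add_mem hτ hτ', (smul_add _ _ _).symm⟩

/-- The embedding of `S^ℓ` in `Ω^1(A,m)` as the multiples of `Q(A,m)`. -/
def QιOmega (A : Arrangement K ℓ) (m : (Fin ℓ → K) → ℕ) :
    (Fin ℓ → PS K ℓ) →ₗ[PS K ℓ] Omega A m 1 :=
  LinearMap.codRestrict _ (Qpoly A m • ExteriorAlgebra.ι (PS K ℓ)) fun v =>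
    Qpoly_smul_mem_Omega (ι_mem_formsP v)

/-- The algebra map from the exterior algebra on `Ω^1(A,m)` to the algebra of forms. -/
def extOmega (A : Arrangement K ℓ) (m : (Fin ℓ → K) → ℕ) :
    ExteriorAlgebra (PS K ℓ) (Omega A m 1) →ₐ[PS K ℓ] ExtF K ℓ :=
  ExteriorAlgebra.lift (PS K ℓ) ⟨(Omega A m 1).subtype, fun n => by
    obtain ⟨a, ha⟩ := mem_formsP_one (Omega_le_formsP n.2)
    rw [Submodule.subtype_apply, ha, ExteriorAlgebra.ι_sq_zero]⟩

/-- The algebra map induced by `QιOmega`. -/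
def extQι (A : Arrangement K ℓ) (m : (Fin ℓ → K) → ℕ) :
    ExtF K ℓ →ₐ[PS K ℓ] ExteriorAlgebra (PS K ℓ) (Omega A m 1) :=
  ExteriorAlgebra.map (QιOmega A m)

theorem extOmega_ι (n : Omega A m 1) : extOmega A m (ExteriorAlgebra.ι _ n) = n :=
  ExteriorAlgebra.lift_ι_apply _ _ _ _

theorem extQι_ι (v : Fin ℓ → PS K ℓ) :
    extQι A m (ExteriorAlgebra.ι _ v) = ExteriorAlgebra.ι _ (QιOmega A m v) :=
  ExteriorAlgebra.map_apply_ι _ _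

theorem extOmega_extQι {p : ℕ} {x : ExtF K ℓ} (hx : x ∈ formsP K ℓ p) :
    extOmega A m (extQι A m x) = Qpoly A m ^ p • x :=
  ExteriorAlgebra.apply_eq_pow_smul ((extOmega A m).comp (extQι A m)) (Qpoly A m)
    (fun v => by rw [AlgHom.comp_apply, extQι_ι, extOmega_ι]; rfl) p x hx

theorem extQι_extOmega {p : ℕ} {x : ExteriorAlgebra (PS K ℓ) (Omega A m 1)}
    (hx : x ∈ ⋀[PS K ℓ]^p (Omega A m 1)) :
    extQι A m (extOmega A m x) = Qpoly A m ^ p • x :=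
  ExteriorAlgebra.apply_eq_pow_smul ((extQι A m).comp (extOmega A m)) (Qpoly A m)
    (fun n => by
      rw [AlgHom.comp_apply, extOmega_ι, ← map_smul]
      obtain ⟨a, ha⟩ := mem_formsP_one (Omega_le_formsP n.2)
      rw [ha, extQι_ι]
      congr 1
      ext
      rw [Submodule.coe_smul, ha]; rfl) p x hx

theorem map_extOmega (p : ℕ) : (⋀[PS K ℓ]^p (Omega A m 1)).map (extOmega A m).toLinearMap =
    Omega A m 1 ^ p := by
  rw [ExteriorAlgebra.exteriorPower, Submodule.map_pow]
  congr 1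
  ext x
  constructor
  · rintro ⟨_, ⟨n, rfl⟩, rfl⟩
    rw [AlgHom.toLinearMap_apply, extOmega_ι]; exact n.2
  · intro hx
    exact ⟨_, ⟨⟨x, hx⟩, rfl⟩, extOmega_ι _⟩

theorem map_extQι_le (p : ℕ) : ∀ x ∈ formsP K ℓ p, extQι A m x ∈ ⋀[PS K ℓ]^p (Omega A m 1) := by
  intro x hx
  have h : (formsP K ℓ p).map (extQι A m).toLinearMap ≤ ⋀[PS K ℓ]^p (Omega A m 1) := by
    rw [formsP, Submodule.map_pow, ExteriorAlgebra.exteriorPower]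
    refine pow_le_pow_left' ?_ _
    rintro _ ⟨_, ⟨n, rfl⟩, rfl⟩
    rw [AlgHom.toLinearMap_apply, extQι_ι]; exact ⟨_, rfl⟩
  exact h ⟨x, hx, rfl⟩

theorem extQι_mem_smul [Module.Free (PS K ℓ) (Omega A m 1)] {p : ℕ} {ζ : ExtF K ℓ}
    (hζ : ζ ∈ Omega A m (p + 1)) :
    ∃ w ∈ ⋀[PS K ℓ]^(p + 1) (Omega A m 1), extQι A m ζ = Qpoly A m • w := by
  obtain ⟨w, hw⟩ : ∃ w, extQι A m ζ = Qpoly A m • w := by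
    refine exists_prod_smul _ _ (A.pairwise_isRelPrime_pow m subset_rfl) _ fun c hc => ?_
    obtain ⟨b, -, a, -, rfl⟩ := (mem_Omega_succ.1 hζ).2 c hc
    have h1 : extQι A m (dP c) = linP c ^ m c •
        ExteriorAlgebra.ι (PS K ℓ) (⟨_, Qcompl_smul_dP_mem_Omega c⟩ : Omega A m 1) := by
      refine (extQι_ι _).trans ?_
      rw [← map_smul]
      congr 1
      ext
      rw [Submodule.coe_smul, smul_smul, ← Qpoly_eq hc]; rfl
    exact ⟨_, by rw [map_add, map_smul, map_mul, h1, smul_mul_assoc, ← smul_add]⟩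
  exact ⟨w, mem_exteriorPower_of_smul (Qpoly_ne_zero A m)
    (hw ▸ map_extQι_le _ _ (Omega_le_formsP hζ)), hw⟩

theorem FreeM.exists_extOmega_eq (h : FreeM A m) {p : ℕ} {ζ : ExtF K ℓ}
    (hζ : ζ ∈ Omega A m (p + 1)) :
    ∃ w ∈ ⋀[PS K ℓ]^(p + 1) (Omega A m 1), Qpoly A m ^ p • ζ = extOmega A m w := by
  have : Module.Free (PS K ℓ) (Omega A m 1) := h
  obtain ⟨w, hw, e⟩ := extQι_mem_smul hζ
  refine ⟨w, hw, smul_right_injective _ (Qpoly_ne_zero A m) ?_⟩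
  change Qpoly A m • _ = Qpoly A m • _
  rw [← map_smul, ← e, extOmega_extQι (Omega_le_formsP hζ), smul_smul, pow_succ']

theorem FreeM.pow_smul_mem (h : FreeM A m) {p : ℕ} {ζ : ExtF K ℓ}
    (hζ : ζ ∈ Omega A m (p + 1)) : Qpoly A m ^ p • ζ ∈ Omega A m 1 ^ (p + 1) := by
  obtain ⟨w, hw, e⟩ := h.exists_extOmega_eq hζ
  rw [e, ← map_extOmega]
  exact ⟨w, hw, rfl⟩

/-- Saito: for a free multiarrangement all modules of logarithmic forms are projective. -/
theorem FreeM.projective_Omega (h : FreeM A m) (p : ℕ) :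
    Module.Projective (PS K ℓ) (Omega A m p) := by
  obtain _ | p := p
  · exact Omega_zero_projective A m
  have : Module.Free (PS K ℓ) (Omega A m 1) := h
  have hQ := pow_ne_zero p (Qpoly_ne_zero A m)
  let T := ⋀[PS K ℓ]^(p + 1) (Omega A m 1)
  let f : T →ₗ[PS K ℓ] ExtF K ℓ := (extOmega A m).toLinearMap ∘ₗ T.subtype
  let g : Omega A m (p + 1) →ₗ[PS K ℓ] ExtF K ℓ :=
    (Qpoly A m ^ p) • (Omega A m (p + 1)).subtype
  have hf : Function.Injective f := fun x y hxy => by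
    have h1 : extOmega A m x = extOmega A m y := hxy
    have h2 := congrArg (extQι A m) h1
    rw [extQι_extOmega x.2, extQι_extOmega y.2] at h2
    exact Subtype.ext (smul_right_injective _ (pow_ne_zero _ (Qpoly_ne_zero A m)) h2)
  have hg : Function.Injective g := fun x y hxy =>
    Subtype.ext (smul_right_injective (ExtF K ℓ) hQ hxy)
  have hfg : LinearMap.range f = LinearMap.range g := by
    apply le_antisymm
    · rintro _ ⟨w, rfl⟩
      obtain ⟨τ, hτ, e⟩ := pow_Omega_one_le p _
        ((map_extOmega (p + 1)).le ⟨w.1, w.2, rfl⟩)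
      exact ⟨⟨τ, hτ⟩, e.symm⟩
    · rintro _ ⟨ζ, rfl⟩
      obtain ⟨w, hw, e⟩ := h.exists_extOmega_eq ζ.2
      exact ⟨⟨w, hw⟩, e.symm⟩
  exact Module.Projective.of_equiv ((LinearEquiv.ofInjective f hf).trans
    ((LinearEquiv.ofEq _ _ hfg).trans (LinearEquiv.ofInjective g hg).symm))

theorem FreeWithExp.freeM {d : Fin ℓ → ℕ} (h : FreeWithExp A m d) : FreeM A m := by
  obtain ⟨b, hb, -, hli, hspan⟩ := h
  have e : Omega A m 1 = Submodule.span (PS K ℓ) (Set.range b) :=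
    le_antisymm hspan (Submodule.span_le.2 (Set.range_subset_iff.2 hb))
  rw [FreeM, e]
  exact Module.Free.of_basis (Module.Basis.span hli)

end Saito

section Substitution

variable {a b : ℕ}

/-- The pullback of the linear form with coefficient vector `c` along the linear substitution
with matrix `E`. -/
def pullForm (E : Fin a → Fin b → K) (c : Fin a → K) : Fin b → K := fun i => ∑ j, c j * E j i

/-- The linear substitution `x_j ↦ ∑ E_{ji} x_i`. -/
def polyMap (E : Fin a → Fin b → K) : PS K a →ₐ[K] PS K b := aeval fun j => linP (E j)

theorem polyMap_linP (E : Fin a → Fin b → K) (c : Fin a → K) :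
    polyMap E (linP c) = linP (pullForm E c) := by
  simp only [polyMap, linP, pullForm, map_sum, map_mul, aeval_X, Finset.mul_sum, Finset.sum_mul]
  rw [Finset.sum_comm]
  refine Finset.sum_congr rfl fun i _ => Finset.sum_congr rfl fun j _ => ?_
  rw [aeval_C, MvPolynomial.algebraMap_eq, mul_assoc]

theorem pullForm_single (E : Fin a → Fin b → K) (j : Fin a) :
    pullForm E (Pi.single j 1) = E j := by
  funext i; simp [pullForm, Pi.single_apply]

theorem pullForm_pullForm {d : ℕ} (E : Fin a → Fin b → K) (E' : Fin b → Fin d → K)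
    (c : Fin a → K) : pullForm E' (pullForm E c) = pullForm (fun j => pullForm E' (E j)) c := by
  funext i
  simp only [pullForm, Finset.sum_mul, Finset.mul_sum]
  rw [Finset.sum_comm]
  exact Finset.sum_congr rfl fun i _ => Finset.sum_congr rfl fun j _ => mul_assoc _ _ _

theorem linP_single (j : Fin a) : linP (Pi.single j 1 : Fin a → K) = X j := by
  rw [linP, Finset.sum_eq_single j] <;> simp +contextual

variable [Algebra (PS K a) (PS K b)]

/-- The action of a linear substitution on differential forms. -/
def extMap (E : Fin a → Fin b → K) : ExtF K a →ₐ[PS K a] ExtF K b :=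
  ExteriorAlgebra.lift (PS K a)
    ⟨(ExteriorAlgebra.ι (PS K b)).restrictScalars (PS K a) ∘ₗ
      Fintype.linearCombination (PS K a) (fun j i => C (E j i)), fun v => by
        rw [LinearMap.comp_apply, LinearMap.restrictScalars_apply, ExteriorAlgebra.ι_sq_zero]⟩

theorem extMap_ι (E : Fin a → Fin b → K) (v : Fin a → PS K a) :
    extMap E (ExteriorAlgebra.ι _ v) = ∑ j, v j • dP (E j) := by
  rw [extMap, ExteriorAlgebra.lift_ι_apply, LinearMap.comp_apply,
    Fintype.linearCombination_apply, map_sum]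
  exact Finset.sum_congr rfl fun j _ => map_smul _ _ _

theorem extMap_mem_formsP (E : Fin a → Fin b → K) (p : ℕ) :
    ∀ x ∈ formsP K a p, extMap E x ∈ formsP K b p := by
  induction p with
  | zero =>
    intro x hx
    obtain ⟨s, rfl⟩ := mem_formsP_zero hx
    rw [AlgHom.commutes, IsScalarTower.algebraMap_apply (PS K a) (PS K b)]
    exact algebraMap_mem_formsP _
  | succ p ih =>
    intro x hx
    rw [formsP, pow_succ'] at hx
    induction hx using Submodule.mul_induction_on' with
    | mem_mul_mem u hu w hw =>
      obtain ⟨u, rfl⟩ := hu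
      rw [map_mul, extMap_ι, Finset.sum_mul]
      refine Submodule.sum_mem _ fun j _ => ?_
      rw [smul_mul_assoc, ← algebraMap_smul (PS K b)]
      exact Submodule.smul_mem _ _ (dP_mul_mem_formsP _ (ih _ hw))
    | add u _ w _ hu hw => rw [map_add]; exact add_mem hu hw

theorem ι_eq_sum (v : Fin a → PS K a) :
    ExteriorAlgebra.ι (PS K a) v = ∑ j, v j • dP (Pi.single j 1 : Fin a → K) := by
  simp only [dP, ← map_smul, ← map_sum]
  congr 1
  funext i
  simp [Pi.single_apply, Finset.sum_apply, apply_ite]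

variable {E : Fin a → Fin b → K} (hE : ∀ s : PS K a, algebraMap (PS K a) (PS K b) s = polyMap E s)
include hE

theorem C_smul_eq {M : Type} [AddCommGroup M] [Module (PS K b) M] [Module (PS K a) M]
    [IsScalarTower (PS K a) (PS K b) M] (t : K) (x : M) :
    (C t : PS K a) • x = (C t : PS K b) • x := by
  rw [← algebraMap_smul (PS K b), hE, ← MvPolynomial.algebraMap_eq, AlgHom.commutes,
    MvPolynomial.algebraMap_eq]

theorem extMap_dP (c : Fin a → K) : extMap E (dP c) = dP (pullForm E c) := by
  rw [dP, extMap_ι]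
  simp only [C_smul_eq hE, ← dP_smul]
  simp only [dP, ← map_sum]
  congr 1
  funext i
  simp [pullForm]

end Substitution

section HyperplaneRestriction

/-- The matrix of the substitution restricting polynomials along `e`. -/
def resMat (e : (Fin (ℓ - 1) → K) →ₗ[K] (Fin ℓ → K)) : Fin ℓ → Fin (ℓ - 1) → K :=
  fun j i => e (Pi.single i 1) j

theorem restrictForm_eq (e : (Fin (ℓ - 1) → K) →ₗ[K] (Fin ℓ → K)) (c : Fin ℓ → K) :
    restrictForm e c = pullForm (resMat e) c := rfl

theorem dotLin_apply (c x : Fin ℓ → K) : dotLin c x = ∑ i, c i * x i := by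
  simp [dotLin, LinearMap.sum_apply]

theorem dotLin_apply_e (e : (Fin (ℓ - 1) → K) →ₗ[K] (Fin ℓ → K)) (c : Fin ℓ → K)
    (y : Fin (ℓ - 1) → K) : dotLin c (e y) = dotLin (restrictForm e c) y := by
  have : dotLin c ∘ₗ e = dotLin (restrictForm e c) := by
    apply LinearMap.pi_ext'
    intro i
    ext
    simp [dotLin_apply, restrictForm, Pi.single_apply]
  exact LinearMap.congr_fun this y

theorem pullForm_add {a b : ℕ} (E : Fin a → Fin b → K) (c c' : Fin a → K) :
    pullForm E (c + c') = pullForm E c + pullForm E c' := by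
  funext i; simp [pullForm, add_mul, Finset.sum_add_distrib]

theorem pullForm_smul {a b : ℕ} (E : Fin a → Fin b → K) (t : K) (c : Fin a → K) :
    pullForm E (t • c) = t • pullForm E c := by
  funext i; simp [pullForm, Finset.mul_sum, mul_assoc]

variable {c0 : Fin ℓ → K} {e : (Fin (ℓ - 1) → K) →ₗ[K] (Fin ℓ → K)}

theorem IsHypEmbedding.restrictForm_self (he : IsHypEmbedding c0 e) : restrictForm e c0 = 0 := by
  funext i
  have h : e (Pi.single i 1) ∈ LinearMap.ker (dotLin c0) := he.2 ▸ LinearMap.mem_range_self _ _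
  rw [LinearMap.mem_ker, dotLin_apply] at h
  exact h

theorem IsHypEmbedding.exists_smul (he : IsHypEmbedding c0 e) {c : Fin ℓ → K}
    (h : restrictForm e c = 0) : ∃ t : K, c = t • c0 := by
  have h1 : LinearMap.ker (dotLin c0) ≤ LinearMap.ker (dotLin c) := by
    rw [← he.2]
    rintro _ ⟨y, rfl⟩
    rw [LinearMap.mem_ker, dotLin_apply_e, h]
    simp [dotLin_apply]
  obtain ⟨t, ht⟩ := Submodule.mem_span_singleton.1
    (mem_span_of_iInf_ker_le_ker (L := fun _ : Unit => dotLin c0) (K := dotLin c)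
      (by simpa using h1) |> fun h => by simpa using h)
  refine ⟨t, funext fun i => ?_⟩
  have := LinearMap.congr_fun ht (Pi.single i 1)
  simpa [dotLin_apply, Pi.single_apply] using this.symm

theorem IsHypEmbedding.exists_section (he : IsHypEmbedding c0 e) :
    ∃ E' : Fin (ℓ - 1) → Fin ℓ → K, (∀ i, restrictForm e (E' i) = Pi.single i 1) ∧
      ∀ c, ∃ t : K, c = pullForm E' (restrictForm e c) + t • c0 := by
  obtain ⟨π, hπ⟩ := e.exists_leftInverse_of_injective (LinearMap.ker_eq_bot.2 he.1)
  have h1 : ∀ i, restrictForm e (fun j => π (Pi.single j 1) i) = Pi.single i 1 := fun i => by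
    funext k
    have h2 : π (e (Pi.single k 1)) i = (Pi.single k (1 : K) : Fin (ℓ - 1) → K) i := by
      rw [← LinearMap.comp_apply, hπ, LinearMap.id_apply]
    rw [pi_eq_sum_univ' (e (Pi.single k 1)), map_sum, Finset.sum_apply] at h2
    rw [Pi.single_comm, ← h2, restrictForm]
    refine Finset.sum_congr rfl fun j _ => ?_
    rw [map_smul, Pi.smul_apply, smul_eq_mul, mul_comm]
  refine ⟨fun i j => π (Pi.single j 1) i, h1, fun c => ?_⟩
  obtain ⟨t, ht⟩ := he.exists_smul
    (c := c + (-1 : K) • pullForm (fun i j => π (Pi.single j 1) i) (restrictForm e c)) (by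
      rw [restrictForm_eq, pullForm_add, pullForm_smul, pullForm_pullForm]
      simp only [← restrictForm_eq, h1]
      funext i
      simp [pullForm, Pi.single_apply])
  refine ⟨t, ?_⟩
  rw [← ht]; simp

end HyperplaneRestriction

section HyperplaneRestriction

variable {c0 : Fin ℓ → K} {e : (Fin (ℓ - 1) → K) →ₗ[K] (Fin ℓ → K)}

theorem polyMap_section {E' : Fin (ℓ - 1) → Fin ℓ → K}
    (h : ∀ i, restrictForm e (E' i) = Pi.single i 1) (s : PS K (ℓ - 1)) :
    polyMap (resMat e) (polyMap E' s) = s := by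
  have : (polyMap (resMat e)).comp (polyMap E') = AlgHom.id K _ := by
    refine MvPolynomial.algHom_ext fun i => ?_
    rw [AlgHom.comp_apply, ← linP_single, polyMap_linP, polyMap_linP, pullForm_single,
      ← restrictForm_eq, h, AlgHom.id_apply]
  exact AlgHom.congr_fun this s

theorem linP_dvd_sub_section {E' : Fin (ℓ - 1) → Fin ℓ → K}
    (h : ∀ c, ∃ t : K, c = pullForm E' (restrictForm e c) + t • c0) (s : PS K ℓ) :
    linP c0 ∣ s - polyMap E' (polyMap (resMat e) s) := by
  induction s using MvPolynomial.induction_on with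
  | C t => simp [polyMap]
  | add p q hp hq =>
    rw [map_add, map_add, add_sub_add_comm]; exact dvd_add hp hq
  | mul_X p j hp =>
    have h1 : linP c0 ∣ X j - polyMap E' (polyMap (resMat e) (X j : PS K ℓ)) := by
      rw [← linP_single, polyMap_linP, polyMap_linP, ← restrictForm_eq]
      obtain ⟨t, ht⟩ := h (Pi.single j 1)
      conv_rhs => enter [1]; rw [ht]
      rw [linP_add, linP_smul, add_sub_cancel_left]
      exact Dvd.intro_left _ rfl
    rw [map_mul, map_mul]
    have : p * X j - polyMap E' (polyMap (resMat e) p) * polyMap E' (polyMap (resMat e) (X j)) =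
      (p - polyMap E' (polyMap (resMat e) p)) * X j +
      polyMap E' (polyMap (resMat e) p) * (X j - polyMap E' (polyMap (resMat e) (X j))) := by ring
    rw [this]
    exact dvd_add (hp.mul_right _) (h1.mul_left _)

theorem IsHypEmbedding.polyMap_surjective (he : IsHypEmbedding c0 e) :
    Function.Surjective (polyMap (resMat e)) := fun s => by
  obtain ⟨E', h, -⟩ := he.exists_section
  exact ⟨_, polyMap_section h s⟩

theorem IsHypEmbedding.polyMap_eq_zero_iff (he : IsHypEmbedding c0 e) {s : PS K ℓ} :
    polyMap (resMat e) s = 0 ↔ linP c0 ∣ s := by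
  constructor
  · intro h
    obtain ⟨E', -, h'⟩ := he.exists_section
    have := linP_dvd_sub_section h' s
    rwa [h, map_zero, sub_zero] at this
  · rintro ⟨q, rfl⟩
    rw [map_mul, polyMap_linP, ← restrictForm_eq, he.restrictForm_self, linP_zero, zero_mul]

/-- The three-term divisibility condition modulo the linear form of the hyperplane. -/
theorem IsHypEmbedding.three_term (he : IsHypEmbedding c0 e) (hc0 : c0 ≠ 0) {f g : PS K ℓ}
    (hfg : IsRelPrime (polyMap (resMat e) f) (polyMap (resMat e) g))
    (hg0 : polyMap (resMat e) f ≠ 0) (s a b : PS K ℓ) (h : linP c0 * s = f * a + g * b) :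
    ∃ a' b', s = f * a' + g * b' := by
  let r := polyMap (resMat e)
  have h0 : r f * r a + r g * r b = 0 := by
    rw [← map_mul, ← map_mul, ← map_add, ← h, map_mul, he.polyMap_eq_zero_iff.2 dvd_rfl, zero_mul]
  have h1 : r f ∣ r b := hfg.dvd_of_dvd_mul_left
    ⟨- r a, by linear_combination h0⟩
  obtain ⟨q, hq⟩ := h1
  obtain ⟨d, rfl⟩ := he.polyMap_surjective q
  have ha : r a = - (r g * r d) := mul_left_cancel₀ hg0 (by
    change r f * _ = r f * _
    linear_combination h0 - r g * hq)
  obtain ⟨a', ha'⟩ := he.polyMap_eq_zero_iff (s := a + g * d) |>.1 (by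
    rw [map_add, map_mul]; exact (congrArg (· + r g * r d) ha).trans (neg_add_cancel _))
  obtain ⟨b', hb'⟩ := he.polyMap_eq_zero_iff (s := b - f * d) |>.1 (by
    rw [map_sub, map_mul]; exact sub_eq_zero.2 hq)
  refine ⟨a', b', mul_left_cancel₀ (linP_ne_zero hc0) ?_⟩
  linear_combination h + f * ha' + g * hb'

theorem exists_mul_dP (c : Fin ℓ → K) (x : ExtF K ℓ) : ∃ y, x * dP c = dP c * y := by
  induction x using ExteriorAlgebra.induction with
  | algebraMap s => exact ⟨algebraMap _ _ s, Algebra.commutes _ _⟩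
  | ι v => exact ⟨-ExteriorAlgebra.ι _ v, by
      rw [mul_neg, anticomm_dP c (ι_mem_formsP v), neg_neg]⟩
  | mul x y hx hy =>
    obtain ⟨x', hx⟩ := hx
    obtain ⟨y', hy⟩ := hy
    exact ⟨x' * y', by rw [mul_assoc, hy, ← mul_assoc, hx, mul_assoc]⟩
  | add x y hx hy =>
    obtain ⟨x', hx⟩ := hx
    obtain ⟨y', hy⟩ := hy
    exact ⟨x' + y', by rw [add_mul, hx, hy, mul_add]⟩

variable [Algebra (PS K ℓ) (PS K (ℓ - 1))]
  (hE : ∀ s : PS K ℓ, algebraMap (PS K ℓ) (PS K (ℓ - 1)) s = polyMap (resMat e) s)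
include hE

/-- A form restricting to zero is a combination of multiples of the defining linear form and
of its differential. -/
theorem IsHypEmbedding.exists_of_extMap_eq_zero (he : IsHypEmbedding c0 e) {x : ExtF K ℓ}
    (hx : extMap (resMat e) x = 0) : ∃ a b, x = linP c0 • a + dP c0 * b := by
  obtain ⟨E', h1, h2⟩ := he.exists_section
  let alg : Algebra (PS K (ℓ - 1)) (PS K ℓ) := (polyMap E').toRingHom.toAlgebra
  have hE' : ∀ s : PS K (ℓ - 1), algebraMap (PS K (ℓ - 1)) (PS K ℓ) s = polyMap E' s :=
    fun s => rfl
  suffices H : ∀ x : ExtF K ℓ, ∃ a b,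
      x - extMap E' (extMap (resMat e) x) = linP c0 • a + dP c0 * b by
    obtain ⟨a, b, h⟩ := H x
    rw [hx, map_zero, sub_zero] at h
    exact ⟨a, b, h⟩
  clear hx x
  have hmul : ∀ x y : ExtF K ℓ,
      (∃ a b, x - extMap E' (extMap (resMat e) x) = linP c0 • a + dP c0 * b) →
      (∃ a b, y - extMap E' (extMap (resMat e) y) = linP c0 • a + dP c0 * b) →
      ∃ a b, x * y - extMap E' (extMap (resMat e) (x * y)) = linP c0 • a + dP c0 * b := by
    rintro x y ⟨a, b, hx⟩ ⟨a', b', hy⟩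
    obtain ⟨z, hz⟩ := exists_mul_dP c0 (extMap E' (extMap (resMat e) x))
    refine ⟨a * y + extMap E' (extMap (resMat e) x) * a', b * y + z * b', ?_⟩
    have h3 : x * y - extMap E' (extMap (resMat e) (x * y)) =
        (x - extMap E' (extMap (resMat e) x)) * y +
          extMap E' (extMap (resMat e) x) * (y - extMap E' (extMap (resMat e) y)) := by
      rw [map_mul, map_mul]; noncomm_ring
    rw [h3, hx, hy, add_mul, mul_add, mul_add, smul_add, smul_mul_assoc, mul_smul_comm,
      ← mul_assoc _ (dP c0) b', hz, mul_assoc, mul_assoc]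
    abel
  have hadd : ∀ x y : ExtF K ℓ,
      (∃ a b, x - extMap E' (extMap (resMat e) x) = linP c0 • a + dP c0 * b) →
      (∃ a b, y - extMap E' (extMap (resMat e) y) = linP c0 • a + dP c0 * b) →
      ∃ a b, x + y - extMap E' (extMap (resMat e) (x + y)) = linP c0 • a + dP c0 * b := by
    rintro x y ⟨a, b, hx⟩ ⟨a', b', hy⟩
    refine ⟨a + a', b + b', ?_⟩
    rw [map_add, map_add, add_sub_add_comm, hx, hy, smul_add, mul_add]; abel
  have halg : ∀ s : PS K ℓ, ∃ a b, algebraMap (PS K ℓ) (ExtF K ℓ) s -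
      extMap E' (extMap (resMat e) (algebraMap _ _ s)) = linP c0 • a + dP c0 * b := fun s => by
    obtain ⟨q, hq⟩ := linP_dvd_sub_section h2 s
    refine ⟨algebraMap _ _ q, 0, ?_⟩
    rw [AlgHom.commutes,
      IsScalarTower.algebraMap_apply (PS K ℓ) (PS K (ℓ - 1)) (ExtF K (ℓ - 1)), AlgHom.commutes,
      IsScalarTower.algebraMap_apply (PS K (ℓ - 1)) (PS K ℓ) (ExtF K ℓ), hE, hE', ← map_sub, hq,
      mul_zero,
      add_zero, map_mul, Algebra.smul_def]
  intro x
  induction x using ExteriorAlgebra.induction with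
  | algebraMap s => exact halg s
  | mul x y hx hy => exact hmul x y hx hy
  | add x y hx hy => exact hadd x y hx hy
  | ι v =>
    rw [ι_eq_sum]
    refine Finset.sum_induction _ (fun x => ∃ a b,
      x - extMap E' (extMap (resMat e) x) = linP c0 • a + dP c0 * b) hadd ⟨0, 0, by simp⟩ ?_
    intro j _
    rw [Algebra.smul_def]
    refine hmul _ _ (halg _) ?_
    obtain ⟨t, ht⟩ := h2 (Pi.single j 1)
    refine ⟨0, algebraMap (PS K ℓ) _ (C t), ?_⟩
    rw [extMap_dP hE, extMap_dP hE', ← restrictForm_eq]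
    conv_lhs => enter [1]; rw [ht]
    rw [dP_add, add_sub_cancel_left, dP_smul, smul_zero, zero_add, ← Algebra.commutes,
      Algebra.smul_def]

theorem IsHypEmbedding.exists_extMap_eq (he : IsHypEmbedding c0 e) {p : ℕ}
    {y : ExtF K (ℓ - 1)} (hy : y ∈ formsP K (ℓ - 1) p) :
    ∃ x ∈ formsP K ℓ p, extMap (resMat e) x = y := by
  obtain ⟨E', h1, h2⟩ := he.exists_section
  let alg : Algebra (PS K (ℓ - 1)) (PS K ℓ) := (polyMap E').toRingHom.toAlgebra
  have hE' : ∀ s : PS K (ℓ - 1), algebraMap (PS K (ℓ - 1)) (PS K ℓ) s = polyMap E' s :=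
    fun s => rfl
  refine ⟨extMap E' y, extMap_mem_formsP E' p y hy, ?_⟩
  clear hy
  have halg : ∀ s : PS K (ℓ - 1), extMap (resMat e) (extMap E' (algebraMap _ _ s)) =
      algebraMap _ (ExtF K (ℓ - 1)) s := fun s => by
    rw [AlgHom.commutes,
      IsScalarTower.algebraMap_apply (PS K (ℓ - 1)) (PS K ℓ) (ExtF K ℓ), AlgHom.commutes,
      IsScalarTower.algebraMap_apply (PS K ℓ) (PS K (ℓ - 1)) (ExtF K (ℓ - 1)), hE, hE',
      polyMap_section h1]
  induction y using ExteriorAlgebra.induction with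
  | algebraMap s => exact halg s
  | mul x y hx hy => rw [map_mul, map_mul, hx, hy]
  | add x y hx hy => rw [map_add, map_add, hx, hy]
  | ι v =>
    rw [ι_eq_sum, map_sum, map_sum]
    refine Finset.sum_congr rfl fun j _ => ?_
    rw [Algebra.smul_def, map_mul, map_mul, halg, extMap_dP hE', extMap_dP hE,
      pullForm_single, ← restrictForm_eq, h1]

end HyperplaneRestriction

section ResidueMap

/-- Forms `η` with `dα₀ ∧ η` divisible by `α₀ ^ k`. -/
def resDom (c0 : Fin ℓ → K) (k : ℕ) : Submodule (PS K ℓ) (ExtF K ℓ) where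
  carrier := {η | ∃ ξ, dP c0 * η = linP c0 ^ k • ξ}
  zero_mem' := ⟨0, by simp⟩
  add_mem' := by
    rintro _ _ ⟨ξ, h⟩ ⟨ξ', h'⟩
    exact ⟨ξ + ξ', by rw [mul_add, h, h', smul_add]⟩
  smul_mem' := by
    rintro s _ ⟨ξ, h⟩
    exact ⟨s • ξ, by rw [mul_smul_comm, h, smul_comm]⟩

variable {c0 : Fin ℓ → K}

/-- The quotient of `dα₀ ∧ η` by `α₀ ^ k`. -/
def resQuot (hc0 : c0 ≠ 0) (k : ℕ) : resDom c0 k →ₗ[PS K ℓ] ExtF K ℓ where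
  toFun η := η.2.choose
  map_add' x y := smul_right_injective _ (pow_ne_zero k (linP_ne_zero hc0)) (by
    change linP c0 ^ k • _ = linP c0 ^ k • _
    rw [smul_add, ← (x + y).2.choose_spec, ← x.2.choose_spec, ← y.2.choose_spec, ← mul_add]; rfl)
  map_smul' s x := smul_right_injective _ (pow_ne_zero k (linP_ne_zero hc0)) (by
    change linP c0 ^ k • _ = linP c0 ^ k • _
    rw [RingHom.id_apply, smul_comm, ← (s • x).2.choose_spec, ← x.2.choose_spec,
      ← mul_smul_comm]; rfl)

theorem resQuot_spec (hc0 : c0 ≠ 0) (k : ℕ) (η : resDom c0 k) :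
    dP c0 * (η : ExtF K ℓ) = linP c0 ^ k • resQuot hc0 k η := η.2.choose_spec

theorem exists_dP_mul_eq (hc0 : c0 ≠ 0) {k p : ℕ} {η ξ : ExtF K ℓ} (hη : η ∈ formsP K ℓ p)
    (h : dP c0 * η = linP c0 ^ k • ξ) :
    ∃ τ ∈ formsP K ℓ p, dP c0 * η = linP c0 ^ k • (dP c0 * τ) ∧ ξ = dP c0 * τ := by
  obtain ⟨v, hv⟩ := exists_dual_eq_one hc0
  have h0 := pow_ne_zero k (linP_ne_zero hc0)
  have h2 := eq_dP_mul_contr hv (dP_mul_eq_zero_of_smul h0 h)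
  refine ⟨contr v ξ, contr_mem_formsP v p
    (mem_formsP_of_smul h0 (h ▸ dP_mul_mem_formsP c0 hη)), ?_, h2⟩
  rw [← h2, h]

variable [Algebra (PS K ℓ) (PS K (ℓ - 1))]

/-- The residue of `η` along the hyperplane: the restriction of any `τ` such that
`dα₀ ∧ η = α₀ ^ k dα₀ ∧ τ`. -/
def resForm (e : (Fin (ℓ - 1) → K) →ₗ[K] (Fin ℓ → K)) (hc0 : c0 ≠ 0) (k : ℕ) :
    resDom c0 k →ₗ[PS K ℓ] ExtF K (ℓ - 1) :=
  (extMap (resMat e)).toLinearMap ∘ₗ contr (exists_dual_eq_one hc0).choose ∘ₗ resQuot hc0 k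

variable {e : (Fin (ℓ - 1) → K) →ₗ[K] (Fin ℓ → K)}
  (hE : ∀ s : PS K ℓ, algebraMap (PS K ℓ) (PS K (ℓ - 1)) s = polyMap (resMat e) s)
  (he : IsHypEmbedding c0 e)
include hE he

theorem extMap_dP_self : extMap (resMat e) (dP c0) = 0 := by
  rw [extMap_dP hE, ← restrictForm_eq, he.restrictForm_self, dP_zero]

theorem linP_smul_eq_zero (y : ExtF K (ℓ - 1)) : linP c0 • y = 0 := by
  rw [← algebraMap_smul (PS K (ℓ - 1)), hE, he.polyMap_eq_zero_iff.2 dvd_rfl, zero_smul]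

theorem resForm_eq (hc0 : c0 ≠ 0) {k : ℕ} (η : resDom c0 k) {τ : ExtF K ℓ}
    (h : dP c0 * (η : ExtF K ℓ) = linP c0 ^ k • (dP c0 * τ)) :
    resForm e hc0 k η = extMap (resMat e) τ := by
  have h1 : resQuot hc0 k η = dP c0 * τ :=
    smul_right_injective _ (pow_ne_zero k (linP_ne_zero hc0))
      ((resQuot_spec hc0 k η).symm.trans h)
  rw [resForm, LinearMap.comp_apply, LinearMap.comp_apply, h1,
    contr_dP_mul (exists_dual_eq_one hc0).choose_spec, AlgHom.toLinearMap_apply, map_sub, map_mul,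
    extMap_dP_self hE he, zero_mul, sub_zero]

theorem resForm_eq_zero_iff (hc0 : c0 ≠ 0) {k : ℕ} (η : resDom c0 k) :
    resForm e hc0 k η = 0 ↔ (η : ExtF K ℓ) ∈ resDom c0 (k + 1) := by
  constructor
  · intro h
    obtain ⟨a, b, hab⟩ := he.exists_of_extMap_eq_zero hE h
    have h1 := eq_dP_mul_contr (exists_dual_eq_one hc0).choose_spec
      (dP_mul_eq_zero_of_smul (pow_ne_zero k (linP_ne_zero hc0)) (resQuot_spec hc0 k η))
    refine ⟨dP c0 * a, ?_⟩
    have hab' : contr (exists_dual_eq_one hc0).choose (resQuot hc0 k η) =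
      linP c0 • a + dP c0 * b := hab
    rw [resQuot_spec hc0, h1, hab', mul_add, dP_mul_dP_mul, add_zero, mul_smul_comm, smul_smul,
      pow_succ]
  · rintro ⟨ξ, h⟩
    have h1 : resQuot hc0 k η = linP c0 • ξ :=
      smul_right_injective _ (pow_ne_zero k (linP_ne_zero hc0))
        ((resQuot_spec hc0 k η).symm.trans (h.trans (by rw [pow_succ, mul_smul])))
    rw [resForm, LinearMap.comp_apply, LinearMap.comp_apply, h1, map_smul, map_smul,
      linP_smul_eq_zero hE he]

end ResidueMap

section ResidueOfLogForms

variable {A : Arrangement K ℓ} {m : (Fin ℓ → K) → ℕ} {c0 : Fin ℓ → K}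

theorem Omega_le_resDom (hc : c0 ∈ A.hyps) (p : ℕ) : Omega A m p ≤ resDom c0 (m c0) :=
  fun _ hη => (mem_Omega.1 hη).2 c0 hc

theorem mdel_self {K : Type} {ℓ : ℕ} {m : (Fin ℓ → K) → ℕ} {c0 : Fin ℓ → K}
    : mdel m c0 c0 = m c0 - 1 := by simp [mdel]

theorem mdel_of_ne {K : Type} {ℓ : ℕ} {m : (Fin ℓ → K) → ℕ} {c0 : Fin ℓ → K}
    {c : Fin ℓ → K} (h : c ≠ c0) : mdel m c0 c = m c := by simp [mdel, h]

theorem mem_Omega_iff_mdel (hc : c0 ∈ A.hyps) (hm : 0 < m c0) {p : ℕ} {η : ExtF K ℓ} :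
    η ∈ Omega A m p ↔ η ∈ Omega A (mdel m c0) p ∧ η ∈ resDom c0 (mdel m c0 c0 + 1) := by
  rw [mdel_self, Nat.sub_add_cancel hm]
  constructor
  · intro h
    refine ⟨?_, Omega_le_resDom hc p h⟩
    obtain ⟨h1, h2⟩ := mem_Omega.1 h
    refine mem_Omega.2 ⟨h1, fun c hc' => ?_⟩
    obtain ⟨ξ, hξ⟩ := h2 c hc'
    by_cases h : c = c0
    · subst h
      refine ⟨linP c • ξ, ?_⟩
      rw [smul_smul, mdel_self, ← pow_succ, Nat.sub_add_cancel hm, hξ]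
    · exact ⟨ξ, by rw [mdel_of_ne h, hξ]⟩
  · rintro ⟨h, h0⟩
    obtain ⟨h1, h2⟩ := mem_Omega.1 h
    refine mem_Omega.2 ⟨h1, fun c hc' => ?_⟩
    by_cases h : c = c0
    · subst h; exact h0
    · obtain ⟨ξ, hξ⟩ := h2 c hc'
      exact ⟨ξ, by rw [← mdel_of_ne (m := m) h, hξ]⟩

theorem Omega_le_of_subset {A' : Arrangement K ℓ} (h : A'.hyps ⊆ A.hyps) (p : ℕ) :
    Omega A m p ≤ Omega A' m p := fun _ hη =>
  mem_Omega.2 ⟨(mem_Omega.1 hη).1, fun c hc => (mem_Omega.1 hη).2 c (h hc)⟩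

theorem prod_smul_mem_Omega {A' : Arrangement K ℓ} {p : ℕ} {η : ExtF K ℓ} (h : η ∈ Omega A' m p) :
    (∏ c ∈ A.hyps \ A'.hyps, linP c ^ m c) • η ∈ Omega A m p := by
  obtain ⟨h1, h2⟩ := mem_Omega.1 h
  refine mem_Omega.2 ⟨Submodule.smul_mem _ _ h1, fun c hc => ?_⟩
  by_cases hc' : c ∈ A'.hyps
  · obtain ⟨ξ, hξ⟩ := h2 c hc'
    exact ⟨_, by rw [mul_smul_comm, hξ, smul_comm]⟩
  · obtain ⟨q, hq⟩ := Finset.dvd_prod_of_mem (fun c => linP c ^ m c)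
      (Finset.mem_sdiff.2 ⟨hc, hc'⟩)
    exact ⟨q • (dP c * η), by rw [hq, mul_smul_comm, mul_smul]⟩

/-- Divisibility by one of two coprime polynomials inside a module of logarithmic forms. -/
theorem Omega_exists_smul {p : ℕ} {f g : PS K ℓ} (hf : f ≠ 0) (hfg : IsRelPrime f g)
    (x y : Omega A m p) (h : g • x = f • y) : ∃ z : Omega A m p, x = f • z := by
  have h' : g • (x : ExtF K ℓ) = f • (y : ExtF K ℓ) := congrArg Subtype.val h
  obtain ⟨z, hz⟩ := exists_smul_of_isRelPrime hfg h'
  have hz' : (y : ExtF K ℓ) = g • z := smul_right_injective _ hf (by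
    change f • _ = f • _
    rw [← h', hz, smul_comm])
  have hzF : z ∈ formsP K ℓ p := mem_formsP_of_smul hf (hz ▸ Omega_le_formsP x.2)
  refine ⟨⟨z, mem_Omega.2 ⟨hzF, fun c hc => ?_⟩⟩, Subtype.ext hz⟩
  have hirr := irreducible_linP (A.ne_zero c hc)
  by_cases hd : linP c ∣ f
  · have hd' : ¬ linP c ∣ g := fun hd' => hirr.not_isUnit (hfg hd hd')
    obtain ⟨ξ, hξ⟩ := (mem_Omega.1 y.2).2 c hc
    rw [hz', mul_smul_comm] at hξ
    exact exists_smul_of_isRelPrime (hirr.isRelPrime_iff_not_dvd.2 hd').pow_left hξ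
  · obtain ⟨ξ, hξ⟩ := (mem_Omega.1 x.2).2 c hc
    rw [hz, mul_smul_comm] at hξ
    exact exists_smul_of_isRelPrime (hirr.isRelPrime_iff_not_dvd.2 hd).pow_left hξ

variable [Algebra (PS K ℓ) (PS K (ℓ - 1))]

/-- The residue map on logarithmic forms. -/
def resOmega (e : (Fin (ℓ - 1) → K) →ₗ[K] (Fin ℓ → K)) (hc : c0 ∈ A.hyps)
    (m : (Fin ℓ → K) → ℕ) (p : ℕ) : Omega A m p →ₗ[PS K ℓ] ExtF K (ℓ - 1) :=
  resForm e (A.ne_zero c0 hc) (m c0) ∘ₗ Submodule.inclusion (Omega_le_resDom hc p)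

variable {e : (Fin (ℓ - 1) → K) →ₗ[K] (Fin ℓ → K)}
  (hE : ∀ s : PS K ℓ, algebraMap (PS K ℓ) (PS K (ℓ - 1)) s = polyMap (resMat e) s)
  (he : IsHypEmbedding c0 e)
include hE he

theorem resOmega_eq (hc : c0 ∈ A.hyps) {p : ℕ} (η : Omega A m p) {τ : ExtF K ℓ}
    (h : dP c0 * (η : ExtF K ℓ) = linP c0 ^ m c0 • (dP c0 * τ)) :
    resOmega e hc m p η = extMap (resMat e) τ :=
  resForm_eq hE he _ _ h

theorem resOmega_exists (hc : c0 ∈ A.hyps) {p : ℕ} (η : Omega A m p) :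
    ∃ τ ∈ formsP K ℓ p, dP c0 * (η : ExtF K ℓ) = linP c0 ^ m c0 • (dP c0 * τ) ∧
      resOmega e hc m p η = extMap (resMat e) τ := by
  obtain ⟨ξ, hξ⟩ := (mem_Omega.1 η.2).2 c0 hc
  obtain ⟨τ, hτ, h, -⟩ := exists_dP_mul_eq (A.ne_zero c0 hc) (Omega_le_formsP η.2) hξ
  exact ⟨τ, hτ, h, resOmega_eq hE he hc η h⟩

theorem resOmega_mem_formsP (hc : c0 ∈ A.hyps) {p : ℕ} (η : Omega A m p) :
    resOmega e hc m p η ∈ formsP K (ℓ - 1) p := by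
  obtain ⟨τ, hτ, -, h⟩ := resOmega_exists hE he hc η
  exact h ▸ extMap_mem_formsP _ p τ hτ

theorem mem_range_resOmega_iff (hc : c0 ∈ A.hyps) {p : ℕ} {y : ExtF K (ℓ - 1)} :
    y ∈ LinearMap.range (resOmega e hc m p) ↔ ∃ η ∈ Omega A m p, ∃ τ ∈ formsP K ℓ p,
      dP c0 * η = linP c0 ^ m c0 • (dP c0 * τ) ∧ y = extMap (resMat e) τ := by
  constructor
  · rintro ⟨η, rfl⟩
    obtain ⟨τ, hτ, h⟩ := resOmega_exists hE he hc η
    exact ⟨η, η.2, τ, hτ, h⟩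
  · rintro ⟨η, hη, τ, -, h, rfl⟩
    exact ⟨⟨η, hη⟩, resOmega_eq hE he hc ⟨η, hη⟩ h⟩

theorem resOmega_eq_zero_iff (hc : c0 ∈ A.hyps) (hm : 0 < m c0) {p : ℕ}
    (η : Omega A (mdel m c0) p) :
    resOmega e hc (mdel m c0) p η = 0 ↔ (η : ExtF K ℓ) ∈ Omega A m p := by
  rw [mem_Omega_iff_mdel hc hm, resOmega, LinearMap.comp_apply, resForm_eq_zero_iff hE he]
  exact (and_iff_right η.2).symm

/-- The kernel of the residue map is the module of forms for the larger multiplicity. -/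
theorem exists_ker_resOmega_equiv (hc : c0 ∈ A.hyps) (hm : 0 < m c0) (p : ℕ) :
    Nonempty (LinearMap.ker (resOmega e hc (mdel m c0) p) ≃ₗ[PS K ℓ] Omega A m p) := by
  have h : LinearMap.ker (resOmega e hc (mdel m c0) p) =
      (Omega A m p).comap (Omega A (mdel m c0) p).subtype := by
    ext x
    rw [LinearMap.mem_ker, resOmega_eq_zero_iff hE he hc hm, Submodule.mem_comap,
      Submodule.subtype_apply]
  rw [h]
  exact ⟨Submodule.comapSubtypeEquivOfLe fun _ hη => ((mem_Omega_iff_mdel hc hm).1 hη).1⟩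

theorem range_resOmega_le_of_subset {A' : Arrangement K ℓ} (h : A'.hyps ⊆ A.hyps)
    (hc : c0 ∈ A.hyps) (hc' : c0 ∈ A'.hyps) (p : ℕ) :
    LinearMap.range (resOmega e hc m p) ≤ LinearMap.range (resOmega e hc' m p) := fun y hy => by
  rw [mem_range_resOmega_iff hE he] at hy ⊢
  obtain ⟨η, hη, h'⟩ := hy
  exact ⟨η, Omega_le_of_subset h p hη, h'⟩

theorem prod_smul_mem_range_resOmega {A' : Arrangement K ℓ}
    (hc : c0 ∈ A.hyps) (hc' : c0 ∈ A'.hyps) {p : ℕ} {y : ExtF K (ℓ - 1)}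
    (hy : y ∈ LinearMap.range (resOmega e hc' m p)) :
    (∏ c ∈ A.hyps \ A'.hyps, linP c ^ m c) • y ∈ LinearMap.range (resOmega e hc m p) := by
  rw [mem_range_resOmega_iff hE he] at hy ⊢
  obtain ⟨η, hη, τ, hτ, h, rfl⟩ := hy
  exact ⟨_, prod_smul_mem_Omega hη, _, Submodule.smul_mem _ _ hτ, by
    rw [mul_smul_comm, h, mul_smul_comm, smul_comm], by rw [map_smul]⟩

/-- Descent of membership in the image of the residue map for a free multiarrangement. -/
theorem mem_range_resOmega_of_smul (hc : c0 ∈ A.hyps) (hm : 0 < m c0) {p : ℕ}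
    [Module.Projective (PS K ℓ) (Omega A m p)] {f g : PS K ℓ} (hfg : IsRelPrime f g)
    (hr : IsRelPrime (polyMap (resMat e) f) (polyMap (resMat e) g))
    (hf0 : polyMap (resMat e) f ≠ 0) {y : ExtF K (ℓ - 1)}
    (hf : f • y ∈ LinearMap.range (resOmega e hc (mdel m c0) p))
    (hg : g • y ∈ LinearMap.range (resOmega e hc (mdel m c0) p)) :
    y ∈ LinearMap.range (resOmega e hc (mdel m c0) p) := by
  obtain ⟨eqv⟩ := exists_ker_resOmega_equiv hE he hc hm p
  have : Module.Projective (PS K ℓ) (LinearMap.ker (resOmega e hc (mdel m c0) p)) :=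
    Module.Projective.of_equiv eqv.symm
  have hf' : f ≠ 0 := fun h => hf0 (by rw [h, map_zero])
  refine mem_range_of_smul_mem_range (resOmega e hc (mdel m c0) p)
    (he.three_term (A.ne_zero c0 hc) hr hf0) (linP_smul_eq_zero hE he) (fun y hy => ?_)
    (Omega_exists_smul hf' hfg) hf hg
  rw [← algebraMap_smul (PS K (ℓ - 1)), hE] at hy
  exact (smul_eq_zero.1 hy).resolve_left hf0

end ResidueOfLogForms

section Homogeneity

theorem homogeneousComponent_mul_of_isHomogeneous {f g : PS K ℓ} {d : ℕ} (hg : g.IsHomogeneous d)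
    (n : ℕ) : homogeneousComponent n (f * g) =
      if d ≤ n then homogeneousComponent (n - d) f * g else 0 := by
  conv_lhs => rw [← sum_homogeneousComponent f, Finset.sum_mul, map_sum]
  have h : ∀ i, homogeneousComponent n (homogeneousComponent i f * g) =
      if i + d = n then homogeneousComponent i f * g else 0 := fun i => by
    rw [homogeneousComponent_of_mem
      ((mem_homogeneousSubmodule _ _).2 ((homogeneousComponent_isHomogeneous i f).mul hg))]
    simp only [eq_comm]
  simp only [h]
  split_ifs with hd
  · have h' : ∀ i, (if i + d = n then homogeneousComponent i f * g else 0) =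
        if i = n - d then homogeneousComponent i f * g else 0 := fun i => by
      congr 1
      exact propext ⟨fun h => by omega, fun h => by omega⟩
    simp only [h', Finset.sum_ite_eq', Finset.mem_range]
    split_ifs with h2
    · rfl
    · rw [homogeneousComponent_eq_zero _ _ (by omega), zero_mul]
  · exact Finset.sum_eq_zero fun i _ => if_neg (by omega)

theorem homogeneousComponent_eq_self' {f : PS K ℓ} {n : ℕ} (h : f.IsHomogeneous n) :
    homogeneousComponent n f = f :=
  homogeneousComponent_eq_self ((mem_homogeneousSubmodule _ _).2 h)

variable {κ : Type} [Fintype κ] {b : κ → Fin ℓ → PS K ℓ} {d : κ → ℕ}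

/-- The homogeneous components of an element of a module spanned by homogeneous vectors. -/
theorem homogeneousComponent_sum_smul (hb : ∀ i j, (b i j).IsHomogeneous (d i))
    (s : κ → PS K ℓ) (n : ℕ) :
    (fun j => homogeneousComponent n ((∑ i, s i • b i) j)) =
      ∑ i, (if d i ≤ n then homogeneousComponent (n - d i) (s i) else 0) • b i := by
  funext j
  rw [Finset.sum_apply, Finset.sum_apply, map_sum]
  refine Finset.sum_congr rfl fun i _ => ?_
  rw [Pi.smul_apply, smul_eq_mul, homogeneousComponent_mul_of_isHomogeneous (hb i j),
    Pi.smul_apply, smul_eq_mul, ite_mul, zero_mul]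

theorem homogeneousComponent_mem_span (hb : ∀ i j, (b i j).IsHomogeneous (d i))
    {x : Fin ℓ → PS K ℓ} (hx : x ∈ Submodule.span (PS K ℓ) (Set.range b)) (n : ℕ) :
    (fun j => homogeneousComponent n (x j)) ∈ Submodule.span (PS K ℓ) (Set.range b) := by
  obtain ⟨s, rfl⟩ := (Submodule.mem_span_range_iff_exists_fun _).1 hx
  rw [homogeneousComponent_sum_smul hb]
  exact Submodule.sum_mem _ fun i _ =>
    Submodule.smul_mem _ _ (Submodule.subset_span ⟨i, rfl⟩)

theorem exists_homogeneous_coeff (hb : ∀ i j, (b i j).IsHomogeneous (d i))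
    {x : Fin ℓ → PS K ℓ} (hx : x ∈ Submodule.span (PS K ℓ) (Set.range b)) {n : ℕ}
    (hn : ∀ j, (x j).IsHomogeneous n) :
    ∃ s : κ → PS K ℓ, x = ∑ i, s i • b i ∧ (∀ i, (s i).IsHomogeneous (n - d i)) ∧
      ∀ i, n < d i → s i = 0 := by
  obtain ⟨s, hs⟩ := (Submodule.mem_span_range_iff_exists_fun _).1 hx
  refine ⟨fun i => if d i ≤ n then homogeneousComponent (n - d i) (s i) else 0, ?_, ?_, ?_⟩
  · rw [← homogeneousComponent_sum_smul hb, hs]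
    exact funext fun j => (homogeneousComponent_eq_self' (hn j)).symm
  · intro i
    dsimp only
    split_ifs
    · exact homogeneousComponent_isHomogeneous _ _
    · exact isHomogeneous_zero _ _ _
  · exact fun i hi => if_neg (by omega)

/-- Comparison of the exponents of two nested modules with homogeneous bases: the lowest degree
in which the modules differ is determined by the exponents. -/
theorem lowest_degree_of_exponents {b b' : κ → Fin ℓ → PS K ℓ} {d d' : κ → ℕ}
    (hb : ∀ i j, (b i j).IsHomogeneous (d i)) (hb' : ∀ i j, (b' i j).IsHomogeneous (d' i))
    (hli : LinearIndependent (PS K ℓ) b) (hli' : LinearIndependent (PS K ℓ) b')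
    (hle : Submodule.span (PS K ℓ) (Set.range b) ≤ Submodule.span (PS K ℓ) (Set.range b'))
    {i₀ i₁ : κ} (h01 : i₀ ≠ i₁) {D n₀ : ℕ} (hd : d i₁ = D + 1) (hd' : d' i₁ = D)
    (hi : ∀ i, i ≠ i₀ → i ≠ i₁ → D + 1 ≤ d i ∧ D ≤ d' i)
    (h0 : d' i₀ = d i₀ ∨ (D + 1 ≤ d i₀ ∧ D ≤ d' i₀))
    (hlow : ∀ n < n₀, ∀ x ∈ Submodule.span (PS K ℓ) (Set.range b'),
      (∀ j, (x j).IsHomogeneous n) → x ∈ Submodule.span (PS K ℓ) (Set.range b))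
    (hex : ∃ x ∈ Submodule.span (PS K ℓ) (Set.range b'),
      (∀ j, (x j).IsHomogeneous n₀) ∧ x ∉ Submodule.span (PS K ℓ) (Set.range b)) :
    n₀ = D := by
  have mem : ∀ i, b i ∈ Submodule.span (PS K ℓ) (Set.range b) := fun i =>
    Submodule.subset_span ⟨i, rfl⟩
  have mem' : ∀ i, b' i ∈ Submodule.span (PS K ℓ) (Set.range b') := fun i =>
    Submodule.subset_span ⟨i, rfl⟩
  -- a homogeneous vector of degree at most `D` is a multiple of the basis vector `i₀`
  have key : ∀ {x : Fin ℓ → PS K ℓ} {n}, x ∈ Submodule.span (PS K ℓ) (Set.range b) →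
      (∀ j, (x j).IsHomogeneous n) → n ≤ D →
      ∃ s : PS K ℓ, x = s • b i₀ ∧ s.IsHomogeneous (n - d i₀) ∧ (n < d i₀ → s = 0) := by
    intro x n hx hn hnD
    obtain ⟨s, hs, hs1, hs2⟩ := exists_homogeneous_coeff hb hx hn
    refine ⟨s i₀, ?_, hs1 i₀, hs2 i₀⟩
    rw [hs, Finset.sum_eq_single i₀ (fun i _ h => ?_) (fun h => absurd (Finset.mem_univ _) h)]
    by_cases h1 : i = i₁
    · rw [hs2 i (by rw [h1]; omega), zero_smul]
    · rw [hs2 i (by have := (hi i h h1).1; omega), zero_smul]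
  have key' : ∀ {x : Fin ℓ → PS K ℓ} {n}, x ∈ Submodule.span (PS K ℓ) (Set.range b') →
      (∀ j, (x j).IsHomogeneous n) → n < D →
      ∃ s : PS K ℓ, x = s • b' i₀ ∧ s.IsHomogeneous (n - d' i₀) ∧ (n < d' i₀ → s = 0) := by
    intro x n hx hn hnD
    obtain ⟨s, hs, hs1, hs2⟩ := exists_homogeneous_coeff hb' hx hn
    refine ⟨s i₀, ?_, hs1 i₀, hs2 i₀⟩
    rw [hs, Finset.sum_eq_single i₀ (fun i _ h => ?_) (fun h => absurd (Finset.mem_univ _) h)]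
    by_cases h1 : i = i₁
    · rw [hs2 i (by rw [h1]; omega), zero_smul]
    · rw [hs2 i (by have := (hi i h h1).2; omega), zero_smul]
  -- the vectors `b' i₀` and `b' i₁` are not proportional
  have indep : ∀ s t : PS K ℓ, s • b' i₀ = t • b' i₁ → t = 0 := by
    intro s t h
    have h1 := Fintype.linearIndependent_iff.1 hli' (Pi.single i₀ s - Pi.single i₁ t) (by
      simp only [Pi.sub_apply, sub_smul, Finset.sum_sub_distrib, Pi.single_apply, ite_smul,
        zero_smul, Finset.sum_ite_eq', Finset.mem_univ, if_true]
      rw [h, sub_self]) i₁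
    simpa [h01.symm] using h1
  refine le_antisymm (not_lt.1 fun hlt => ?_) (not_lt.1 fun hlt => ?_)
  · obtain ⟨s, hs, hs1, hs2⟩ := key (hlow D hlt _ (mem' i₁) (fun j => hd' ▸ hb' i₁ j))
      (fun j => hd' ▸ hb' i₁ j) le_rfl
    have hs0 : s ≠ 0 := fun h => hli'.ne_zero i₁ (by rw [hs, h, zero_smul])
    have hdD : d i₀ ≤ D := not_lt.1 fun h => hs0 (hs2 h)
    have h0' : d' i₀ = d i₀ := h0.resolve_right fun h => by omega
    obtain ⟨t, ht⟩ : ∃ t : PS K ℓ, b' i₀ = t • b i₀ := by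
      obtain ⟨t, ht, -⟩ := key (hlow (d i₀) (by omega) _ (mem' i₀) (fun j => h0' ▸ hb' i₀ j))
        (fun j => h0' ▸ hb' i₀ j) hdD
      exact ⟨t, ht⟩
    have ht0 := indep s t (by rw [hs, ht, smul_comm])
    exact hli'.ne_zero i₀ (by rw [ht, ht0, zero_smul])
  · obtain ⟨x, hx, hxn, hxb⟩ := hex
    obtain ⟨s, hs, hs1, hs2⟩ := key' hx hxn hlt
    have hs0 : s ≠ 0 := fun h => hxb (by rw [hs, h, zero_smul]; exact Submodule.zero_mem _)
    have hdn : d' i₀ ≤ n₀ := not_lt.1 fun h => hs0 (hs2 h)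
    have h0' : d' i₀ = d i₀ := h0.resolve_right fun h => by omega
    obtain ⟨t, ht, ht1, -⟩ := key' (hle (mem i₀)) (fun j => h0' ▸ hb i₀ j) (by omega)
    rw [h0', Nat.sub_self] at ht1
    have ht2 : t = C (coeff 0 t) := by
      rw [← homogeneousComponent_zero, homogeneousComponent_eq_self' ht1]
    have ht3 : coeff 0 t ≠ 0 := fun h => hli.ne_zero i₀ (by rw [ht, ht2, h, C_0, zero_smul])
    refine hxb (hs ▸ Submodule.smul_mem _ _ ?_)
    have : b' i₀ = (C (coeff 0 t)⁻¹ : PS K ℓ) • b i₀ := by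
      rw [ht, smul_smul]
      nth_rewrite 2 [ht2]
      rw [← C_mul, inv_mul_cancel₀ ht3, C_1, one_smul]
    rw [this]
    exact Submodule.smul_mem _ _ (mem i₀)

theorem IsHomogForm.exists_ι {n : ℕ} {η : ExtF K ℓ} (h : IsHomogForm 1 n η) :
    ∃ v : Fin ℓ → PS K ℓ, η = ExteriorAlgebra.ι (PS K ℓ) v ∧ ∀ j, (v j).IsHomogeneous n := by
  refine AddSubgroup.closure_induction (fun x hx => ?_) ?_ (fun x y _ _ hx hy => ?_)
    (fun x _ hx => ?_) h
  · obtain ⟨f, l, hf, hl, rfl⟩ := hx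
    obtain ⟨i, rfl⟩ := List.length_eq_one_iff.1 hl
    refine ⟨f • Pi.single i 1, by simp [wedgeList], fun j => ?_⟩
    by_cases hj : j = i
    · subst hj; simpa using hf
    · simpa [hj] using isHomogeneous_zero _ _ _
  · exact ⟨0, (map_zero _).symm, fun j => isHomogeneous_zero _ _ _⟩
  · obtain ⟨v, rfl, hv⟩ := hx
    obtain ⟨w, rfl, hw⟩ := hy
    exact ⟨v + w, (map_add _ _ _).symm, fun j => (hv j).add (hw j)⟩
  · obtain ⟨v, rfl, hv⟩ := hx
    exact ⟨-v, (map_neg _ _).symm, fun j => (hv j).neg⟩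

end Homogeneity

section RankTwoResidues

theorem dP_mul_dP_comm (c c' : Fin ℓ → K) (x : ExtF K ℓ) :
    dP c * (dP c' * x) = -(dP c' * (dP c * x)) := by
  rw [← mul_assoc, anticomm_dP c (dP_mem_formsP c'), neg_mul, mul_assoc]

theorem mul_mem_Omega {A : Arrangement K ℓ} {m : (Fin ℓ → K) → ℕ} {p p' : ℕ} {x y : ExtF K ℓ}
    (hx : x ∈ Omega A m p) (hy : y ∈ formsP K ℓ p') : x * y ∈ Omega A m (p + p') := by
  obtain ⟨h1, h2⟩ := mem_Omega.1 hx
  refine mem_Omega.2 ⟨mul_mem_formsP h1 hy, fun c hc => ?_⟩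
  obtain ⟨ξ, hξ⟩ := h2 c hc
  exact ⟨ξ * y, by rw [← mul_assoc, hξ, smul_mul_assoc]⟩

variable {A : Arrangement K ℓ} {m : (Fin ℓ → K) → ℕ} {c0 : Fin ℓ → K}

theorem Qpoly_mdel (hc : c0 ∈ A.hyps) : Qpoly A (mdel m c0) =
    linP c0 ^ mdel m c0 c0 * ∏ c ∈ A.hyps.erase c0, linP c ^ m c := by
  rw [Qpoly, ← Finset.mul_prod_erase _ _ hc]
  congr 1
  exact Finset.prod_congr rfl fun c hc' => by rw [mdel_of_ne (Finset.ne_of_mem_erase hc')]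

variable {e : (Fin (ℓ - 1) → K) →ₗ[K] (Fin ℓ → K)} {β : Fin (ℓ - 1) → K}

theorem IsHypEmbedding.exists_restrictForm_eq (he : IsHypEmbedding c0 e) (hc : c0 ∈ A.hyps)
    (hβ : ∀ c ∈ A.hyps, ∃ t : K, restrictForm e c = t • β) {c : Fin ℓ → K} (hcA : c ∈ A.hyps)
    (hne : c ≠ c0) : ∃ t : K, t ≠ 0 ∧ restrictForm e c = t • β := by
  obtain ⟨t, ht⟩ := hβ c hcA
  refine ⟨t, fun h0 => ?_, ht⟩
  obtain ⟨s, hs⟩ := he.exists_smul (c := c) (by rw [ht, h0, zero_smul])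
  exact A.nonprop c hcA c0 hc hne s hs

theorem IsHypEmbedding.exists_polyMap_prod (he : IsHypEmbedding c0 e) (hc : c0 ∈ A.hyps)
    (hβ : ∀ c ∈ A.hyps, ∃ t : K, restrictForm e c = t • β) :
    ∃ u : K, u ≠ 0 ∧ polyMap (resMat e) (∏ c ∈ A.hyps.erase c0, linP c ^ m c) =
      C u * linP β ^ ∑ c ∈ A.hyps.erase c0, m c := by
  have h : ∀ c, ∃ t : K, c ∈ A.hyps.erase c0 → t ≠ 0 ∧ restrictForm e c = t • β := fun c => by
    by_cases h : c ∈ A.hyps.erase c0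
    · obtain ⟨t, ht⟩ := he.exists_restrictForm_eq hc hβ (Finset.mem_of_mem_erase h)
        (Finset.ne_of_mem_erase h)
      exact ⟨t, fun _ => ht⟩
    · exact ⟨0, fun h' => absurd h' h⟩
  choose t ht using h
  refine ⟨∏ c ∈ A.hyps.erase c0, t c ^ m c,
    Finset.prod_ne_zero_iff.2 fun c hc' => pow_ne_zero _ (ht c hc').1, ?_⟩
  rw [map_prod, ← Finset.prod_pow_eq_pow_sum, map_prod, ← Finset.prod_mul_distrib]
  refine Finset.prod_congr rfl fun c hc' => ?_
  rw [map_pow, polyMap_linP, ← restrictForm_eq, (ht c hc').2, linP_smul, mul_pow, map_pow]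

variable [Algebra (PS K ℓ) (PS K (ℓ - 1))]
  (hE : ∀ s : PS K ℓ, algebraMap (PS K ℓ) (PS K (ℓ - 1)) s = polyMap (resMat e) s)
  (he : IsHypEmbedding c0 e)
include hE

theorem smul_eq_polyMap_smul (s : PS K ℓ) (y : ExtF K (ℓ - 1)) :
    s • y = polyMap (resMat e) s • y := by
  rw [← hE, algebraMap_smul]

include he

theorem smul_mem_range_resOmega (hc : c0 ∈ A.hyps) {p : ℕ} {y : ExtF K (ℓ - 1)}
    (hy : y ∈ LinearMap.range (resOmega e hc m p)) (s : PS K (ℓ - 1)) :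
    s • y ∈ LinearMap.range (resOmega e hc m p) := by
  obtain ⟨s, rfl⟩ := he.polyMap_surjective s
  rw [← smul_eq_polyMap_smul hE]
  exact Submodule.smul_mem _ _ hy

theorem mul_mem_range_resOmega (hc : c0 ∈ A.hyps) {p p' : ℕ} {y z : ExtF K (ℓ - 1)}
    (hy : y ∈ LinearMap.range (resOmega e hc m p)) (hz : z ∈ formsP K (ℓ - 1) p') :
    y * z ∈ LinearMap.range (resOmega e hc m (p + p')) := by
  obtain ⟨τ', hτ', rfl⟩ := he.exists_extMap_eq hE hz
  rw [mem_range_resOmega_iff hE he] at hy ⊢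
  obtain ⟨η, hη, τ, hτ, h, rfl⟩ := hy
  exact ⟨_, mul_mem_Omega hη hτ', _, mul_mem_formsP hτ hτ', by
    rw [← mul_assoc, h, smul_mul_assoc, mul_assoc], by rw [map_mul]⟩

theorem pow_smul_mem_range_resOmega (hc : c0 ∈ A.hyps)
    (hβ : ∀ c ∈ A.hyps, ∃ t : K, restrictForm e c = t • β) {p : ℕ} {y : ExtF K (ℓ - 1)}
    (hy : y ∈ formsP K (ℓ - 1) p) :
    linP β ^ (∑ c ∈ A.hyps.erase c0, m c) • y ∈
      LinearMap.range (resOmega e hc (mdel m c0) p) := by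
  obtain ⟨u, hu, hP⟩ := he.exists_polyMap_prod (m := m) hc hβ
  obtain ⟨τ, hτ, rfl⟩ := he.exists_extMap_eq hE hy
  have h : (∏ c ∈ A.hyps.erase c0, linP c ^ m c) • extMap (resMat e) τ ∈
      LinearMap.range (resOmega e hc (mdel m c0) p) := by
    rw [mem_range_resOmega_iff hE he]
    exact ⟨_, Qpoly_smul_mem_Omega hτ, _, Submodule.smul_mem _ _ hτ, by
      rw [mul_smul_comm, mul_smul_comm, smul_smul, Qpoly_mdel hc], (map_smul _ _ _).symm⟩
  have h2 := smul_mem_range_resOmega hE he hc h (C u⁻¹)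
  rwa [smul_eq_polyMap_smul hE (∏ c ∈ _, _), hP, smul_smul, ← mul_assoc, ← C_mul,
    inv_mul_cancel₀ hu, C_1, one_mul] at h2

/-- The residue of a form along a rank-two localization has a highly divisible wedge product
with the restricted linear form. -/
theorem exists_dP_mul_resOmega_eq (hc : c0 ∈ A.hyps)
    (hβ : ∀ c ∈ A.hyps, ∃ t : K, restrictForm e c = t • β) {c1 : Fin ℓ → K} (hc1 : c1 ∈ A.hyps)
    (hne : c1 ≠ c0) {p : ℕ} {y : ExtF K (ℓ - 1)}
    (hy : y ∈ LinearMap.range (resOmega e hc (mdel m c0) p)) :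
    ∃ ζ, dP β * y = linP β ^ (∑ c ∈ A.hyps.erase c0, m c) • ζ := by
  obtain ⟨u, hu, hP⟩ := he.exists_polyMap_prod (m := m) hc hβ
  obtain ⟨t1, ht1, hct1⟩ := he.exists_restrictForm_eq hc hβ hc1 hne
  obtain ⟨η, hη, τ, hτ, h, rfl⟩ := (mem_range_resOmega_iff hE he hc).1 hy
  have hdiv : ∀ c ∈ A.hyps.erase c0, ∃ z, dP c0 * (dP c1 * τ) = linP c ^ m c • z := by
    intro c hc'
    have hne' := Finset.ne_of_mem_erase hc'
    have hcA := Finset.mem_of_mem_erase hc'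
    obtain ⟨t, ht, hct⟩ := he.exists_restrictForm_eq hc hβ hcA hne'
    obtain ⟨ξ, hξ⟩ := (mem_Omega.1 hη).2 c hcA
    rw [mdel_of_ne hne'] at hξ
    have h1 : linP c0 ^ mdel m c0 c0 • (dP c0 * (dP c * τ)) = linP c ^ m c • (dP c0 * ξ) := by
      rw [dP_mul_dP_comm, smul_neg, ← mul_smul_comm, ← h, dP_mul_dP_comm, neg_neg, hξ,
        mul_smul_comm]
    obtain ⟨z, hz⟩ := exists_smul_of_isRelPrime
      ((A.isRelPrime hcA hc hne').pow_left.pow_right) h1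
    obtain ⟨s, hs⟩ := he.exists_smul (c := c1 + (-(t1 / t)) • c) (by
      rw [restrictForm_eq, pullForm_add, pullForm_smul, ← restrictForm_eq, ← restrictForm_eq,
        hct, hct1, smul_smul, ← add_smul, neg_mul, div_mul_cancel₀ _ ht, add_neg_cancel,
        zero_smul])
    have hc1' : c1 = s • c0 + (t1 / t) • c := by
      rw [← hs, neg_smul, neg_add_cancel_right]
    refine ⟨(C (t1 / t) : PS K ℓ) • z, ?_⟩
    rw [hc1', dP_add, dP_smul, dP_smul, add_mul, mul_add, smul_mul_assoc, mul_smul_comm,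
      dP_mul_dP_mul, smul_zero, zero_add, smul_mul_assoc, mul_smul_comm, hz, smul_comm]
  obtain ⟨ζ, hζ⟩ := exists_prod_smul _ _
    (A.pairwise_isRelPrime_pow m (Finset.erase_subset _ _)) _ hdiv
  have hP0 : (∏ c ∈ A.hyps.erase c0, linP c ^ m c) ≠ 0 := Finset.prod_ne_zero_iff.2 fun c hc' =>
    pow_ne_zero _ (linP_ne_zero (A.ne_zero c (Finset.mem_of_mem_erase hc')))
  obtain ⟨v, hv⟩ := exists_dual_eq_one (A.ne_zero c0 hc)
  have hζ1 := eq_dP_mul_contr hv (dP_mul_eq_zero_of_smul hP0 hζ)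
  rw [hζ1, ← mul_smul_comm, ← sub_eq_zero, ← mul_sub] at hζ
  have h2 := congrArg (extMap (resMat e)) (eq_dP_mul_contr hv hζ)
  rw [map_mul, extMap_dP_self hE he, zero_mul, map_sub, sub_eq_zero, map_mul, map_smul,
    extMap_dP hE, ← restrictForm_eq, hct1, dP_smul, smul_eq_polyMap_smul hE (∏ c ∈ _, _), hP,
    smul_mul_assoc] at h2
  refine ⟨(C (t1⁻¹ * u) : PS K (ℓ - 1)) • extMap (resMat e) (contr v ζ), ?_⟩
  have h3 := congrArg (fun y => (C t1⁻¹ : PS K (ℓ - 1)) • y) h2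
  simp only [smul_smul, ← C_mul, inv_mul_cancel₀ ht1, C_1, one_smul] at h3
  rw [h3, smul_smul, C_mul, ← mul_assoc, mul_comm (linP β ^ _)]

end RankTwoResidues

section RankTwoResidues

variable {A : Arrangement K ℓ} {m : (Fin ℓ → K) → ℕ} {c0 : Fin ℓ → K}
  {e : (Fin (ℓ - 1) → K) →ₗ[K] (Fin ℓ → K)} {β : Fin (ℓ - 1) → K}
  [Algebra (PS K ℓ) (PS K (ℓ - 1))]
  (hE : ∀ s : PS K ℓ, algebraMap (PS K ℓ) (PS K (ℓ - 1)) s = polyMap (resMat e) s)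
  (he : IsHypEmbedding c0 e)
include hE he

/-- The multiples of the restricted linear form occurring as residues form a principal ideal
generated by a power of the linear form. -/
theorem exists_pow_generator (hc : c0 ∈ A.hyps) (hm : 0 < m c0) (hβ0 : β ≠ 0)
    (hβ : ∀ c ∈ A.hyps, ∃ t : K, restrictForm e c = t • β) {c1 : Fin ℓ → K} (hc1 : c1 ∈ A.hyps)
    (hne : c1 ≠ c0) [Module.Projective (PS K ℓ) (Omega A m 1)] :
    ∃ k ≤ ∑ c ∈ A.hyps.erase c0, m c,
      linP β ^ k • dP β ∈ LinearMap.range (resOmega e hc (mdel m c0) 1) ∧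
      ∀ u : PS K (ℓ - 1), u • dP β ∈ LinearMap.range (resOmega e hc (mdel m c0) 1) →
        linP β ^ k ∣ u := by
  have h := pow_smul_mem_range_resOmega (m := m) hE he hc hβ (dP_mem_formsP β)
  have hex : ∃ k, linP β ^ k • dP β ∈ LinearMap.range (resOmega e hc (mdel m c0) 1) := ⟨_, h⟩
  refine ⟨Nat.find hex, Nat.find_min' hex h, Nat.find_spec hex, fun u hu => ?_⟩
  by_cases hu0 : u = 0
  · exact hu0 ▸ dvd_zero _
  obtain ⟨s, hs, hsβ⟩ := (FiniteMultiplicity.of_not_isUnit (irreducible_linP hβ0).not_isUnit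
    hu0).exists_eq_pow_mul_and_not_dvd
  set j := multiplicity (linP β) u
  by_cases hj : Nat.find hex ≤ j
  · exact (pow_dvd_pow _ hj).trans ⟨s, hs⟩
  refine absurd ?_ (Nat.find_min hex (not_le.1 hj))
  obtain ⟨t, ht, hct⟩ := he.exists_restrictForm_eq hc hβ hc1 hne
  obtain ⟨f, rfl⟩ := he.polyMap_surjective s
  have hp1 : polyMap (resMat e) (linP c1) = C t * linP β := by
    rw [polyMap_linP, ← restrictForm_eq, hct, linP_smul]
  have hCt : IsUnit (C t : PS K (ℓ - 1)) := (isUnit_iff_ne_zero.2 ht).map C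
  have hf : ¬ linP c1 ∣ f := fun hd => hsβ (by
    have := map_dvd (polyMap (resMat e)) hd
    rw [hp1] at this
    exact (dvd_mul_left _ _).trans this)
  have hrel : IsRelPrime (linP c1) f :=
    (irreducible_linP (A.ne_zero c1 hc1)).isRelPrime_iff_not_dvd.2 hf
  have hrel' : IsRelPrime (polyMap (resMat e) (linP c1)) (polyMap (resMat e) f) := by
    rw [hp1]
    exact (isRelPrime_mul_unit_left_left hCt).2
      ((irreducible_linP hβ0).isRelPrime_iff_not_dvd.2 hsβ)
  refine mem_range_resOmega_of_smul (f := f)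
    (g := linP c1 ^ ∑ c ∈ A.hyps.erase c0, m c) hE he hc hm hrel.symm.pow_right ?_ ?_ ?_ ?_
  · rw [map_pow]; exact hrel'.symm.pow_right
  · exact fun h0 => hsβ (h0 ▸ dvd_zero _)
  · rwa [smul_eq_polyMap_smul hE, smul_smul, mul_comm, ← hs]
  · rw [smul_eq_polyMap_smul hE, map_pow, hp1, mul_pow, mul_smul]
    refine smul_mem_range_resOmega hE he hc ?_ _
    exact pow_smul_mem_range_resOmega hE he hc hβ (Submodule.smul_mem _ _ (dP_mem_formsP β))

/-- One-forms that occur as residues along a rank-two localization. -/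
theorem exists_eq_of_mem_range_resOmega_one (hc : c0 ∈ A.hyps) (hβ0 : β ≠ 0)
    (hβ : ∀ c ∈ A.hyps, ∃ t : K, restrictForm e c = t • β) {c1 : Fin ℓ → K} (hc1 : c1 ∈ A.hyps)
    (hne : c1 ≠ c0) {k : ℕ} (hk : ∀ u : PS K (ℓ - 1),
      u • dP β ∈ LinearMap.range (resOmega e hc (mdel m c0) 1) → linP β ^ k ∣ u)
    {y : ExtF K (ℓ - 1)} (hy : y ∈ LinearMap.range (resOmega e hc (mdel m c0) 1)) :
    ∃ (a : ExtF K (ℓ - 1)) (u : PS K (ℓ - 1)),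
      y = linP β ^ (∑ c ∈ A.hyps.erase c0, m c) • a + linP β ^ k • u • dP β := by
  obtain ⟨ζ, hζ⟩ := exists_dP_mul_resOmega_eq hE he hc hβ hc1 hne hy
  obtain ⟨v, hv⟩ := exists_dual_eq_one hβ0
  obtain ⟨η, rfl⟩ := hy
  have hF := resOmega_mem_formsP hE he hc η
  obtain ⟨u, hu⟩ := mem_formsP_zero (contr_mem_formsP v 0 hF)
  have h := contr_dP_mul hv (resOmega e hc (mdel m c0) 1 η)
  have hζF : ζ ∈ formsP K (ℓ - 1) 2 := mem_formsP_of_smul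
    (pow_ne_zero (∑ c ∈ A.hyps.erase c0, m c) (linP_ne_zero hβ0)) (hζ ▸ dP_mul_mem_formsP β hF)
  rw [hζ, map_smul, hu, ← Algebra.commutes, ← Algebra.smul_def, eq_sub_iff_add_eq] at h
  obtain ⟨u', rfl⟩ := hk u (by
    have h1 := Submodule.sub_mem _ (LinearMap.mem_range_self (resOmega e hc (mdel m c0) 1) η)
      (pow_smul_mem_range_resOmega (m := m) hE he hc hβ (contr_mem_formsP v 1 hζF))
    rwa [← h, add_sub_cancel_left] at h1)
  exact ⟨_, u', by rw [smul_smul (linP β ^ k), h]⟩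

theorem exists_pow_smul_of_mem_pow (hc : c0 ∈ A.hyps) (hβ0 : β ≠ 0)
    (hβ : ∀ c ∈ A.hyps, ∃ t : K, restrictForm e c = t • β) {c1 : Fin ℓ → K} (hc1 : c1 ∈ A.hyps)
    (hne : c1 ≠ c0) {k : ℕ} (hk : ∀ u : PS K (ℓ - 1),
      u • dP β ∈ LinearMap.range (resOmega e hc (mdel m c0) 1) → linP β ^ k ∣ u) (n : ℕ) :
    ∀ ζ ∈ Omega A (mdel m c0) 1 ^ (n + 1), ∃ (τ : ExtF K ℓ) (a b : ExtF K (ℓ - 1)),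
      dP c0 * ζ = linP c0 ^ (mdel m c0 c0 * (n + 1)) • (dP c0 * τ) ∧
      extMap (resMat e) τ = linP β ^ ((∑ c ∈ A.hyps.erase c0, m c) * n) •
        (linP β ^ (∑ c ∈ A.hyps.erase c0, m c) • a + linP β ^ k • (dP β * b)) := by
  have base : ∀ ζ ∈ Omega A (mdel m c0) 1, ∃ τ ∈ formsP K ℓ 1, ∃ (a : ExtF K (ℓ - 1))
      (u : PS K (ℓ - 1)), dP c0 * ζ = linP c0 ^ mdel m c0 c0 • (dP c0 * τ) ∧
      extMap (resMat e) τ = linP β ^ (∑ c ∈ A.hyps.erase c0, m c) • a +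
        linP β ^ k • u • dP β := by
    intro ζ hζ
    obtain ⟨τ, hτ, h1, h2⟩ := resOmega_exists hE he hc ⟨ζ, hζ⟩
    obtain ⟨a, u, h3⟩ := exists_eq_of_mem_range_resOmega_one hE he hc hβ0 hβ hc1 hne hk
      (LinearMap.mem_range_self _ (⟨ζ, hζ⟩ : Omega A (mdel m c0) 1))
    exact ⟨τ, hτ, a, u, h1, h2 ▸ h3⟩
  set q := ∑ c ∈ A.hyps.erase c0, m c
  induction n with
  | zero =>
    intro ζ hζ
    rw [zero_add, pow_one] at hζ
    obtain ⟨τ, -, a, u, h1, h2⟩ := base ζ hζ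
    refine ⟨τ, a, algebraMap _ _ u, by rw [h1, zero_add, mul_one], ?_⟩
    rw [h2, mul_zero, pow_zero, one_smul, ← Algebra.commutes, ← Algebra.smul_def]
  | succ n ih =>
    intro ζ hζ
    rw [pow_succ'] at hζ
    refine Submodule.mul_induction_on hζ (fun x hx z hz => ?_) (fun x y hx hy => ?_)
    · obtain ⟨τ1, hτ1, a1, u, h1, h2⟩ := base x hx
      obtain ⟨τ, a, b, h3, h4⟩ := ih z hz
      obtain ⟨a', ha'⟩ := exists_mul_dP β a1
      refine ⟨τ1 * τ, a1 * a, u • a + a' * b, ?_, ?_⟩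
      · rw [← mul_assoc, h1, smul_mul_assoc, anticomm_dP c0 hτ1, neg_mul, mul_assoc, h3,
          mul_smul_comm, ← mul_assoc, ← mul_assoc, anticomm_dP c0 hτ1, neg_mul, smul_neg,
          smul_neg, smul_smul]
        congr 3
        ring
      · have h5 : dP β * (dP β * b) = 0 := dP_mul_dP_mul β b
        have h6 : a1 * (dP β * b) = dP β * (a' * b) := by
          rw [← mul_assoc, ha', mul_assoc]
        rw [map_mul, h2, h4]
        simp only [add_mul, mul_add, smul_mul_assoc, mul_smul_comm, h5, h6, smul_zero,
          add_zero, smul_add, smul_smul]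
        rw [add_assoc]
        refine congrArg₂ _ (congrArg₂ _ (by ring) rfl) (congrArg₂ _ (congrArg₂ _ (by ring) rfl)
          (congrArg₂ _ (by ring) rfl))
    · obtain ⟨τ1, a1, b1, h1, h2⟩ := hx
      obtain ⟨τ, a, b, h3, h4⟩ := hy
      refine ⟨τ1 + τ, a1 + a, b1 + b,
        by rw [mul_add (dP c0), mul_add (dP c0), smul_add, h1, h3], ?_⟩
      rw [map_add, h2, h4, ← smul_add, smul_add _ a1, mul_add (dP β), smul_add _ (dP β * b1)]
      congr 1
      abel

/-- Residues along a free rank-two localization are divisible by the power generating the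
ideal of multiples of the restricted linear form. -/
theorem exists_pow_smul_of_mem_range_resOmega (hc : c0 ∈ A.hyps) (hβ0 : β ≠ 0)
    (hβ : ∀ c ∈ A.hyps, ∃ t : K, restrictForm e c = t • β) {c1 : Fin ℓ → K} (hc1 : c1 ∈ A.hyps)
    (hne : c1 ≠ c0) {k : ℕ} (hkq : k ≤ ∑ c ∈ A.hyps.erase c0, m c) (hk : ∀ u : PS K (ℓ - 1),
      u • dP β ∈ LinearMap.range (resOmega e hc (mdel m c0) 1) → linP β ^ k ∣ u)
    (hfree : FreeM A (mdel m c0)) {p : ℕ} {y : ExtF K (ℓ - 1)}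
    (hy : y ∈ LinearMap.range (resOmega e hc (mdel m c0) (p + 1))) :
    ∃ z, y = linP β ^ k • z := by
  obtain ⟨η, hη, τ, hτ, h, rfl⟩ := (mem_range_resOmega_iff hE he hc).1 hy
  obtain ⟨τ', a, b, h1, h2⟩ := exists_pow_smul_of_mem_pow hE he hc hβ0 hβ hc1 hne hk p _
    (hfree.pow_smul_mem hη)
  obtain ⟨u, hu, hP⟩ := he.exists_polyMap_prod (m := m) hc hβ
  have h3 : linP c0 ^ (mdel m c0 c0 * (p + 1)) •
      (dP c0 * ((∏ c ∈ A.hyps.erase c0, linP c ^ m c) ^ p • τ - τ')) = 0 := by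
    rw [mul_sub, smul_sub, ← h1, mul_smul_comm, mul_smul_comm, h, sub_eq_zero, smul_smul,
      smul_smul, Qpoly_mdel hc]
    congr 1
    ring
  obtain ⟨v, hv⟩ := exists_dual_eq_one (A.ne_zero c0 hc)
  have h4 := congrArg (extMap (resMat e)) (eq_dP_mul_contr hv ((smul_eq_zero.1 h3).resolve_left
    (pow_ne_zero _ (linP_ne_zero (A.ne_zero c0 hc)))))
  set q := ∑ c ∈ A.hyps.erase c0, m c
  rw [map_mul, extMap_dP_self hE he, zero_mul, map_sub, sub_eq_zero, h2, map_smul,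
    smul_eq_polyMap_smul hE (_ ^ p), map_pow, hP, mul_pow, ← pow_mul, mul_comm (_ ^ p),
    mul_smul] at h4
  have h5 := smul_right_injective _ (pow_ne_zero (q * p) (linP_ne_zero hβ0)) h4
  refine ⟨(C (u ^ p)⁻¹ : PS K (ℓ - 1)) • (linP β ^ (q - k) • a + dP β * b), ?_⟩
  rw [smul_comm, smul_add, smul_smul, ← pow_add, Nat.add_sub_cancel' hkq, ← h5, smul_smul,
    ← C_pow, ← C_mul, inv_mul_cancel₀ (pow_ne_zero _ hu), C_1, one_smul]

end RankTwoResidues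

section OneFormsModuloHyperplane

/-- The constant vector of polynomials with the given coefficients. -/
def constVec (c : Fin ℓ → K) : Fin ℓ → PS K ℓ := fun i => C (c i)

/-- The projection of one-forms along `c0` with vanishing `j`-th coordinate. -/
def projAlong (c0 : Fin ℓ → K) (j : Fin ℓ) : (Fin ℓ → PS K ℓ) →ₗ[PS K ℓ] (Fin ℓ → PS K ℓ) :=
  LinearMap.id - ((C (c0 j)⁻¹ : PS K ℓ) • LinearMap.proj j).smulRight (constVec c0)

variable {c0 : Fin ℓ → K} {j : Fin ℓ}

theorem projAlong_apply (v : Fin ℓ → PS K ℓ) (i : Fin ℓ) :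
    projAlong c0 j v i = v i - C ((c0 j)⁻¹ * c0 i) * v j := by
  simp [projAlong, constVec, C_mul]
  ring

theorem projAlong_self (hj : c0 j ≠ 0) : projAlong c0 j (constVec c0) = 0 := by
  funext i
  rw [projAlong_apply]
  change C (c0 i) - C ((c0 j)⁻¹ * c0 i) * C (c0 j) = 0
  rw [← C_mul, mul_right_comm, inv_mul_cancel₀ hj, one_mul, sub_self]

theorem projAlong_isHomogeneous {v : Fin ℓ → PS K ℓ} {n : ℕ} (hv : ∀ i, (v i).IsHomogeneous n)
    (i : Fin ℓ) : (projAlong c0 j v i).IsHomogeneous n := by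
  rw [projAlong_apply]
  have h := (isHomogeneous_C (Fin ℓ) ((c0 j)⁻¹ * c0 i)).mul (hv j)
  rw [zero_add] at h
  exact (hv i).sub h

theorem projAlong_homogeneousComponent (v : Fin ℓ → PS K ℓ) (n : ℕ) (i : Fin ℓ) :
    projAlong c0 j (fun i => homogeneousComponent n (v i)) i =
      homogeneousComponent n (projAlong c0 j v i) := by
  rw [projAlong_apply, projAlong_apply, map_sub, homogeneousComponent_C_mul]

theorem projAlong_eq_zero (hc : c0 ≠ 0) (hj : c0 j ≠ 0) {v : Fin ℓ → PS K ℓ}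
    (h : dP c0 * ExteriorAlgebra.ι (PS K ℓ) v = 0) : projAlong c0 j v = 0 := by
  obtain ⟨w, hw⟩ := exists_dual_eq_one hc
  have h1 := eq_dP_mul_contr hw h
  rw [contr_ι, ← Algebra.commutes, ← Algebra.smul_def] at h1
  have h2 : v = w v • constVec c0 := (ExteriorAlgebra.ι_inj (PS K ℓ) _ _).1
    (h1.trans (map_smul _ _ _).symm)
  rw [h2, map_smul, projAlong_self hj, smul_zero]

theorem dP_mul_projAlong (v : Fin ℓ → PS K ℓ) :
    dP c0 * ExteriorAlgebra.ι (PS K ℓ) (projAlong c0 j v) =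
      dP c0 * ExteriorAlgebra.ι (PS K ℓ) v := by
  have h : projAlong c0 j v = v - (C (c0 j)⁻¹ * v j : PS K ℓ) • constVec c0 := rfl
  rw [h, map_sub, map_smul, mul_sub, mul_smul_comm]
  exact sub_eq_self.2 (by rw [show ExteriorAlgebra.ι (PS K ℓ) (constVec c0) = dP c0 from rfl,
    dP_mul_self, smul_zero])

theorem exists_projAlong_eq_iff (hc : c0 ≠ 0) (hj : c0 j ≠ 0) {n : ℕ} {v : Fin ℓ → PS K ℓ} :
    (∃ ξ, dP c0 * ExteriorAlgebra.ι (PS K ℓ) v = linP c0 ^ n • ξ) ↔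
      ∃ u, projAlong c0 j v = linP c0 ^ n • u := by
  constructor
  · rintro ⟨ξ, hξ⟩
    obtain ⟨τ, hτ, h, -⟩ := exists_dP_mul_eq hc (ι_mem_formsP v) hξ
    obtain ⟨t, rfl⟩ := mem_formsP_one hτ
    rw [← mul_smul_comm, ← map_smul, ← sub_eq_zero, ← mul_sub, ← map_sub] at h
    have h1 := projAlong_eq_zero hc hj h
    rw [map_sub, sub_eq_zero, map_smul] at h1
    exact ⟨_, h1⟩
  · rintro ⟨u, hu⟩
    exact ⟨_, by rw [← dP_mul_projAlong (j := j), hu, map_smul, mul_smul_comm]⟩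

theorem exists_smul_of_dP_mul_dP_eq {c a : Fin ℓ → K} (hc : c ≠ 0) {n : ℕ} (hn : 0 < n)
    {ξ : ExtF K ℓ} (h : dP c * dP a = linP c ^ n • ξ) : ∃ s : K, a = s • c := by
  obtain ⟨j, hj⟩ : ∃ j, c j ≠ 0 := Function.ne_iff.1 hc
  obtain ⟨u, hu⟩ := (exists_projAlong_eq_iff (v := constVec a) hc hj).1 ⟨ξ, h⟩
  refine ⟨(c j)⁻¹ * a j, funext fun i => ?_⟩
  have h1 := congrArg constantCoeff (congrFun hu i)
  have h2 : constantCoeff (linP c) = 0 := by simp [linP]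
  rw [projAlong_apply] at h1
  simp only [constVec, Pi.smul_apply, smul_eq_mul, map_mul, map_pow, map_sub, h2,
    zero_pow hn.ne', zero_mul, constantCoeff_C, sub_eq_zero] at h1
  rw [h1, Pi.smul_apply, smul_eq_mul]
  ring

end OneFormsModuloHyperplane

section RankTwoExponents

variable {A : Arrangement K ℓ} {m : (Fin ℓ → K) → ℕ} {c0 : Fin ℓ → K}
  {e : (Fin (ℓ - 1) → K) →ₗ[K] (Fin ℓ → K)} {j : Fin ℓ}

theorem ι_mem_Omega_iff (hc : c0 ∈ A.hyps) (hm : 0 < m c0) (hj : c0 j ≠ 0)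
    {v : Fin ℓ → PS K ℓ} (hv : ExteriorAlgebra.ι (PS K ℓ) v ∈ Omega A (mdel m c0) 1) :
    ExteriorAlgebra.ι (PS K ℓ) v ∈ Omega A m 1 ↔
      ∃ u, projAlong c0 j v = linP c0 ^ (mdel m c0 c0 + 1) • u := by
  rw [mem_Omega_iff_mdel hc hm, ← exists_projAlong_eq_iff (A.ne_zero c0 hc) hj]
  exact and_iff_right hv

variable [Algebra (PS K ℓ) (PS K (ℓ - 1))]
  (hE : ∀ s : PS K ℓ, algebraMap (PS K ℓ) (PS K (ℓ - 1)) s = polyMap (resMat e) s)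
  (he : IsHypEmbedding c0 e)
include hE he

theorem exists_projAlong_eq_of_resOmega_eq (hc : c0 ∈ A.hyps) (hj : c0 j ≠ 0)
    {v z : Fin ℓ → PS K ℓ} (hv : ExteriorAlgebra.ι (PS K ℓ) v ∈ Omega A m 1)
    (h : resOmega e hc m 1 ⟨_, hv⟩ = extMap (resMat e) (ExteriorAlgebra.ι (PS K ℓ) z)) :
    ∃ u, projAlong c0 j v = linP c0 ^ m c0 • (projAlong c0 j z + linP c0 • u) := by
  obtain ⟨τ, hτ, h1, h2⟩ := resOmega_exists hE he hc ⟨_, hv⟩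
  obtain ⟨t, rfl⟩ := mem_formsP_one hτ
  rw [h, eq_comm, ← sub_eq_zero, ← map_sub, ← map_sub] at h2
  obtain ⟨a, b, hab⟩ := he.exists_of_extMap_eq_zero hE h2
  obtain ⟨u, hu⟩ := (exists_projAlong_eq_iff (n := 1) (A.ne_zero c0 hc) hj).1
    ⟨dP c0 * a, by rw [hab, mul_add, dP_mul_dP_mul, add_zero, mul_smul_comm, pow_one]⟩
  change dP c0 * ExteriorAlgebra.ι (PS K ℓ) v = _ at h1
  rw [← mul_smul_comm, ← map_smul, ← sub_eq_zero, ← mul_sub, ← map_sub] at h1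
  have h3 := projAlong_eq_zero (A.ne_zero c0 hc) hj h1
  rw [map_sub, sub_eq_zero, map_smul] at h3
  rw [map_sub, pow_one, sub_eq_iff_eq_add'] at hu
  exact ⟨u, by rw [h3, hu]⟩

end RankTwoExponents

section RankTwoExponents

variable {A : Arrangement K ℓ} {m : (Fin ℓ → K) → ℕ} {c0 : Fin ℓ → K}
  {e : (Fin (ℓ - 1) → K) →ₗ[K] (Fin ℓ → K)} {j : Fin ℓ} {β : Fin (ℓ - 1) → K}

theorem isHomogeneous_linP_pow (c : Fin ℓ → K) (k : ℕ) : (linP c ^ k).IsHomogeneous k := by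
  simpa using (linP_isHomogeneous c).pow k

theorem isHomogeneous_linP_pow_mul (c c' : Fin ℓ → K) (k k' : ℕ) :
    (linP c ^ k * linP c' ^ k').IsHomogeneous (k + k') :=
  (isHomogeneous_linP_pow c k).mul (isHomogeneous_linP_pow c' k')

theorem FreeWithExp.exists_vectors {d : Fin ℓ → ℕ} (h : FreeWithExp A m d) :
    ∃ v : Fin ℓ → Fin ℓ → PS K ℓ, (∀ i j, (v i j).IsHomogeneous (msum A m - d i)) ∧
      LinearIndependent (PS K ℓ) v ∧
      ∀ x, x ∈ Submodule.span (PS K ℓ) (Set.range v) ↔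
        ExteriorAlgebra.ι (PS K ℓ) x ∈ Omega A m 1 := by
  obtain ⟨b, hb, hd, hli, hle⟩ := h
  choose v hv hvd using fun i => (hd i).exists_ι
  have hbv : b = ExteriorAlgebra.ι (PS K ℓ) ∘ v := funext hv
  have hs : Submodule.span (PS K ℓ) (Set.range b) =
      (Submodule.span (PS K ℓ) (Set.range v)).map (ExteriorAlgebra.ι (PS K ℓ)) := by
    rw [Submodule.map_span, hbv, Set.range_comp]
  refine ⟨v, hvd, LinearIndependent.of_comp (ExteriorAlgebra.ι (PS K ℓ)) (hbv ▸ hli), fun x => ?_⟩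
  constructor
  · intro hx
    have h1 : ExteriorAlgebra.ι (PS K ℓ) x ∈ Submodule.span (PS K ℓ) (Set.range b) :=
      hs ▸ Submodule.mem_map_of_mem hx
    exact Submodule.span_le.2 (Set.range_subset_iff.2 hb) h1
  · intro hx
    have h1 := hle hx
    rw [hs] at h1
    obtain ⟨y, hy, hyx⟩ := h1
    rwa [← (ExteriorAlgebra.ι_inj (PS K ℓ) _ _).1 hyx]

variable [Algebra (PS K ℓ) (PS K (ℓ - 1))]
  (hE : ∀ s : PS K ℓ, algebraMap (PS K ℓ) (PS K (ℓ - 1)) s = polyMap (resMat e) s)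

include hE in
theorem linP_pow_smul_eq {c : Fin ℓ → K} {t : K} (h : restrictForm e c = t • β) (k : ℕ)
    (y : ExtF K (ℓ - 1)) :
    linP c ^ k • y = (C (t ^ k) : PS K (ℓ - 1)) • linP β ^ k • y := by
  rw [smul_eq_polyMap_smul hE (linP c ^ k) y, map_pow, polyMap_linP, ← restrictForm_eq, h,
    linP_smul, mul_pow, ← C_pow, mul_smul]

variable (he : IsHypEmbedding c0 e)
include hE he

theorem ι_mem_Omega_of_isHomogeneous_of_lt (hc : c0 ∈ A.hyps) (hm : 0 < m c0) (hβ0 : β ≠ 0)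
    (hβ : ∀ c ∈ A.hyps, ∃ t : K, restrictForm e c = t • β) {c1 : Fin ℓ → K} (hc1 : c1 ∈ A.hyps)
    (hne : c1 ≠ c0) {k : ℕ} (hkq : k ≤ ∑ c ∈ A.hyps.erase c0, m c) (hk : ∀ u : PS K (ℓ - 1),
      u • dP β ∈ LinearMap.range (resOmega e hc (mdel m c0) 1) → linP β ^ k ∣ u)
    {n : ℕ} (hn : n < mdel m c0 c0 + k) {x : Fin ℓ → PS K ℓ}
    (hx : ExteriorAlgebra.ι (PS K ℓ) x ∈ Omega A (mdel m c0) 1)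
    (hxn : ∀ i, (x i).IsHomogeneous n) : ExteriorAlgebra.ι (PS K ℓ) x ∈ Omega A m 1 := by
  obtain ⟨j, hj⟩ : ∃ j, c0 j ≠ 0 := Function.ne_iff.1 (A.ne_zero c0 hc)
  obtain ⟨t, ht, htβ⟩ := he.exists_restrictForm_eq hc hβ hc1 hne
  obtain ⟨a, u, hau⟩ := exists_eq_of_mem_range_resOmega_one hE he hc hβ0 hβ hc1 hne hk
    (LinearMap.mem_range_self _ ⟨_, hx⟩)
  set z : ExtF K (ℓ - 1) :=
    linP β ^ ((∑ c ∈ A.hyps.erase c0, m c) - k) • a + u • dP β with hz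
  have hyz : resOmega e hc (mdel m c0) 1 ⟨_, hx⟩ = linP β ^ k • z := by
    rw [hau, hz, smul_add, smul_smul (linP β ^ k) (linP β ^ _), ← pow_add, Nat.add_sub_cancel' hkq]
  have hzf : z ∈ formsP K (ℓ - 1) 1 :=
    mem_formsP_of_smul (pow_ne_zero k (linP_ne_zero hβ0))
      (hyz ▸ resOmega_mem_formsP hE he hc _)
  obtain ⟨τ, hτ, hτz⟩ := he.exists_extMap_eq hE
    (Submodule.smul_mem _ (C ((t ^ k)⁻¹) : PS K (ℓ - 1)) hzf)
  obtain ⟨w, rfl⟩ := mem_formsP_one hτ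
  obtain ⟨u', hu'⟩ := exists_projAlong_eq_of_resOmega_eq hE he hc hj hx
    (z := linP c1 ^ k • w) (by
      rw [hyz, map_smul, map_smul, hτz, linP_pow_smul_eq hE htβ, smul_comm (linP β ^ k), smul_smul,
        ← C_mul, mul_inv_cancel₀ (pow_ne_zero k ht), C_1, one_smul])
  rw [ι_mem_Omega_iff hc hm hj hx]
  refine ⟨fun i => if mdel m c0 c0 + 1 ≤ n then
    homogeneousComponent (n - (mdel m c0 c0 + 1)) (u' i) else 0, funext fun i => ?_⟩
  have hi : projAlong c0 j x i = projAlong c0 j w i * (linP c0 ^ mdel m c0 c0 * linP c1 ^ k) +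
      u' i * linP c0 ^ (mdel m c0 c0 + 1) := by
    rw [hu', map_smul, Pi.smul_apply, Pi.add_apply, Pi.smul_apply, Pi.smul_apply]
    simp only [smul_eq_mul]
    ring
  have h3 := congrArg (homogeneousComponent n) hi
  rw [homogeneousComponent_eq_self' (projAlong_isHomogeneous hxn i), map_add,
    homogeneousComponent_mul_of_isHomogeneous (isHomogeneous_linP_pow_mul c0 c1 _ k),
    homogeneousComponent_mul_of_isHomogeneous (isHomogeneous_linP_pow c0 _),
    if_neg (by omega), zero_add] at h3
  rw [h3, Pi.smul_apply, smul_eq_mul]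
  split_ifs with h4
  · rw [mul_comm]
  · rw [mul_zero]

theorem exists_ι_notMem_Omega (hc : c0 ∈ A.hyps) (hm : 0 < m c0)
    {c1 : Fin ℓ → K} (hc1 : c1 ∈ A.hyps)
    (hne : c1 ≠ c0) {t : K} (htβ : restrictForm e c1 = t • β) {k : ℕ}
    (hk : linP β ^ k • dP β ∈ LinearMap.range (resOmega e hc (mdel m c0) 1)) :
    ∃ x : Fin ℓ → PS K ℓ, ExteriorAlgebra.ι (PS K ℓ) x ∈ Omega A (mdel m c0) 1 ∧
      ExteriorAlgebra.ι (PS K ℓ)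
        (fun i => homogeneousComponent (mdel m c0 c0 + k) (x i)) ∉ Omega A m 1 := by
  obtain ⟨j, hj⟩ : ∃ j, c0 j ≠ 0 := Function.ne_iff.1 (A.ne_zero c0 hc)
  obtain ⟨⟨η, hη⟩, hηy⟩ := smul_mem_range_resOmega hE he hc hk (C (t ^ (k + 1)))
  obtain ⟨x, rfl⟩ := mem_formsP_one (Omega_le_formsP hη)
  refine ⟨x, hη, fun hmem => ?_⟩
  obtain ⟨u', hu'⟩ := exists_projAlong_eq_of_resOmega_eq hE he hc hj hη
    (z := linP c1 ^ k • constVec c1) (by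
      rw [hηy, map_smul, map_smul, linP_pow_smul_eq hE htβ]
      change _ = _ • _ • extMap (resMat e) (dP c1)
      rw [extMap_dP hE, ← restrictForm_eq, htβ, dP_smul, smul_comm (linP β ^ k),
        smul_smul (C (t ^ k) : PS K (ℓ - 1)) (C t), ← C_mul, ← pow_succ])
  obtain ⟨u, hu⟩ := (exists_projAlong_eq_iff (A.ne_zero c0 hc) hj).1 ((mem_Omega.1 hmem).2 c0 hc)
  have hm1 : m c0 = mdel m c0 c0 + 1 := by rw [mdel_self]; omega
  have hrel := A.isRelPrime hc hc1 hne.symm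
  have hzero : ∀ i, c1 i - (c0 j)⁻¹ * c0 i * c1 j = 0 := fun i => by
    have hi : projAlong c0 j x i = C (c1 i - (c0 j)⁻¹ * c0 i * c1 j) *
        (linP c0 ^ mdel m c0 c0 * linP c1 ^ k) + u' i * linP c0 ^ (mdel m c0 c0 + 1) := by
      rw [hu', map_smul, Pi.smul_apply, Pi.add_apply, Pi.smul_apply, Pi.smul_apply, projAlong_apply]
      simp only [smul_eq_mul, constVec, C_sub, C_mul]
      ring
    have h3 := congrArg (homogeneousComponent (mdel m c0 c0 + k)) hi
    rw [← projAlong_homogeneousComponent, hu, hm1, map_add,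
      homogeneousComponent_mul_of_isHomogeneous (isHomogeneous_linP_pow_mul c0 c1 _ k),
      homogeneousComponent_mul_of_isHomogeneous (isHomogeneous_linP_pow c0 _),
      if_pos le_rfl, Nat.sub_self, homogeneousComponent_zero, coeff_zero_C, Pi.smul_apply,
      smul_eq_mul] at h3
    obtain ⟨r, hr⟩ : ∃ r, (if mdel m c0 c0 + 1 ≤ mdel m c0 c0 + k then
        homogeneousComponent (mdel m c0 c0 + k - (mdel m c0 c0 + 1)) (u' i) *
          linP c0 ^ (mdel m c0 c0 + 1) else 0) = r * linP c0 ^ (mdel m c0 c0 + 1) := by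
      split_ifs
      · exact ⟨_, rfl⟩
      · exact ⟨0, (zero_mul _).symm⟩
    rw [hr] at h3
    have h4 : C (c1 i - (c0 j)⁻¹ * c0 i * c1 j) * linP c1 ^ k = linP c0 * (u i - r) :=
      mul_left_cancel₀ (pow_ne_zero (mdel m c0 c0) (linP_ne_zero (A.ne_zero c0 hc)))
        (by linear_combination -h3)
    have h5 : linP c0 ∣ C (c1 i - (c0 j)⁻¹ * c0 i * c1 j) :=
      hrel.pow_right.dvd_of_dvd_mul_right ⟨_, h4⟩
    obtain ⟨r', hr'⟩ := h5
    simpa [linP] using congrArg constantCoeff hr'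
  have h0 : linP c0 ∣ linP c1 := by
    have : c1 = ((c0 j)⁻¹ * c1 j) • c0 := funext fun i => by
      rw [Pi.smul_apply, smul_eq_mul, mul_right_comm]
      exact sub_eq_zero.1 (hzero i)
    rw [this, linP_smul]
    exact dvd_mul_left _ _
  exact (irreducible_linP (A.ne_zero c0 hc)).not_isUnit (hrel dvd_rfl h0)

/-- The exponent of the generator of the residues along a codimension-two flat is determined by the
exponents of the localization. -/
theorem add_eq_of_exponents (hc : c0 ∈ A.hyps) (hm : ∀ c ∈ A.hyps, 0 < m c) (hβ0 : β ≠ 0)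
    (hβ : ∀ c ∈ A.hyps, ∃ t : K, restrictForm e c = t • β) {c1 : Fin ℓ → K} (hc1 : c1 ∈ A.hyps)
    (hne : c1 ≠ c0) {k : ℕ} (hkq : k ≤ ∑ c ∈ A.hyps.erase c0, m c)
    (hk : linP β ^ k • dP β ∈ LinearMap.range (resOmega e hc (mdel m c0) 1))
    (hk' : ∀ u : PS K (ℓ - 1),
      u • dP β ∈ LinearMap.range (resOmega e hc (mdel m c0) 1) → linP β ^ k ∣ u)
    {d1 d2 : ℕ} (h : FreeWithExp A m (expVec d1 d2))
    (h' : FreeWithExp A (mdel m c0) (expVec (d1 - 1) d2)) :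
    k + d2 = ∑ c ∈ A.hyps.erase c0, m c := by
  obtain ⟨i, -⟩ : ∃ i, β i ≠ 0 := Function.ne_iff.1 hβ0
  have hℓ : 2 ≤ ℓ := by have := i.2; omega
  have hmc := hm c0 hc
  have hsum : msum A m = m c0 + ∑ c ∈ A.hyps.erase c0, m c :=
    (Finset.add_sum_erase _ _ hc).symm
  have hsum' : msum A (mdel m c0) = m c0 - 1 + ∑ c ∈ A.hyps.erase c0, m c := by
    rw [msum, ← Finset.add_sum_erase _ _ hc, mdel_self]
    exact congrArg _ (Finset.sum_congr rfl fun c h => mdel_of_ne (Finset.ne_of_mem_erase h))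
  obtain ⟨v, hv, hvli, hvs⟩ := h.exists_vectors
  obtain ⟨v', hv', hvli', hvs'⟩ := h'.exists_vectors
  have hd0 : ∀ d d' : ℕ, expVec d d' (⟨0, by omega⟩ : Fin ℓ) = d := fun _ _ => rfl
  have hd1 : ∀ d d' : ℕ, expVec d d' (⟨1, by omega⟩ : Fin ℓ) = d' := fun _ _ => rfl
  have hd2 : d2 < msum A m := by
    by_contra! hlt
    obtain ⟨a, ha⟩ : ∃ a : Fin ℓ → K, v ⟨1, by omega⟩ = constVec a := by
      have h1 : ∀ j, ∃ t : K, v ⟨1, by omega⟩ j = C t := fun j => by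
        have h2 := hv ⟨1, by omega⟩ j
        rw [hd1, Nat.sub_eq_zero_of_le hlt] at h2
        exact ⟨_, (totalDegree_eq_zero_iff_eq_C.1 (Nat.le_zero.1 h2.totalDegree_le))⟩
      choose a ha using h1
      exact ⟨a, funext ha⟩
    have hmem := (hvs _).1 (Submodule.subset_span (Set.mem_range_self ⟨1, by omega⟩))
    rw [ha] at hmem
    obtain ⟨ξ, hξ⟩ := (mem_Omega.1 hmem).2 c0 hc
    obtain ⟨ξ', hξ'⟩ := (mem_Omega.1 hmem).2 c1 hc1
    obtain ⟨s, rfl⟩ := exists_smul_of_dP_mul_dP_eq (A.ne_zero c0 hc) hmc hξ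
    obtain ⟨s', hs'⟩ := exists_smul_of_dP_mul_dP_eq (A.ne_zero c1 hc1) (hm c1 hc1) hξ'
    have hs : s ≠ 0 := by
      rintro rfl
      refine hvli.ne_zero ⟨1, by omega⟩ (ha.trans ?_)
      funext j
      simp [constVec]
    exact A.nonprop c0 hc c1 hc1 hne.symm (s⁻¹ * s')
      (by rw [mul_smul, ← hs', smul_smul, inv_mul_cancel₀ hs, one_smul])
  obtain ⟨t, -, htβ⟩ := he.exists_restrictForm_eq hc hβ hc1 hne
  obtain ⟨x, hx, hx'⟩ := exists_ι_notMem_Omega hE he hc hmc hc1 hne htβ hk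
  have hkey := lowest_degree_of_exponents hv hv' hvli hvli'
    (fun x hx => (hvs' x).2 ((mem_Omega_iff_mdel hc hmc).1 ((hvs x).1 hx)).1)
    (i₀ := ⟨0, by omega⟩) (i₁ := ⟨1, by omega⟩) (by simp) (D := msum A m - d2 - 1)
    (n₀ := mdel m c0 c0 + k) (by rw [hd1]; omega) (by rw [hd1]; omega)
    (fun i h0 h1 => by
      have : ∀ d d' : ℕ, expVec d d' i = 0 := fun d d' => by
        rw [expVec, if_neg (fun h => h0 (Fin.ext h)), if_neg (fun h => h1 (Fin.ext h))]
      rw [this, this]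
      omega)
    (by rw [hd0, hd0]; omega)
    (fun n hn x hx hxn => (hvs x).2 (ι_mem_Omega_of_isHomogeneous_of_lt hE he hc hmc hβ0 hβ hc1 hne
      hkq hk' hn ((hvs' x).1 hx) hxn))
    ⟨_, homogeneousComponent_mem_span hv' ((hvs' x).2 hx) _,
      fun i => homogeneousComponent_isHomogeneous _ _, fun h => hx' ((hvs _).1 h)⟩
  rw [mdel_self] at hkey
  omega

end RankTwoExponents

section RankTwoResidueDescription

variable {A : Arrangement K ℓ} {m : (Fin ℓ → K) → ℕ} {c0 : Fin ℓ → K}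
  {e : (Fin (ℓ - 1) → K) →ₗ[K] (Fin ℓ → K)} {β : Fin (ℓ - 1) → K}
  [Algebra (PS K ℓ) (PS K (ℓ - 1))]
  (hE : ∀ s : PS K ℓ, algebraMap (PS K ℓ) (PS K (ℓ - 1)) s = polyMap (resMat e) s)
  (he : IsHypEmbedding c0 e)
include hE he

theorem pow_smul_mem_range_resOmega_of_dP_mul_eq (hc : c0 ∈ A.hyps) (hβ0 : β ≠ 0)
    (hβ : ∀ c ∈ A.hyps, ∃ t : K, restrictForm e c = t • β) {k b : ℕ}
    (hkb : k + b = ∑ c ∈ A.hyps.erase c0, m c)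
    (hk : linP β ^ k • dP β ∈ LinearMap.range (resOmega e hc (mdel m c0) 1))
    {p : ℕ} {z ζ : ExtF K (ℓ - 1)} (hz : z ∈ formsP K (ℓ - 1) (p + 1))
    (h : dP β * z = linP β ^ b • ζ) :
    linP β ^ k • z ∈ LinearMap.range (resOmega e hc (mdel m c0) (p + 1)) := by
  obtain ⟨w, hw⟩ := exists_dual_eq_one hβ0
  have hζ : ζ ∈ formsP K (ℓ - 1) (p + 1 + 1) :=
    mem_formsP_of_smul (pow_ne_zero b (linP_ne_zero hβ0)) (h ▸ dP_mul_mem_formsP β hz)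
  have h1 := contr_dP_mul hw z
  rw [h, map_smul] at h1
  have h2 : linP β ^ k • z = linP β ^ (∑ c ∈ A.hyps.erase c0, m c) • contr w ζ +
      (linP β ^ k • dP β) * contr w z := by
    rw [← hkb, pow_add, mul_smul, h1, smul_sub, smul_mul_assoc, sub_add_cancel]
  rw [h2]
  refine Submodule.add_mem _ (pow_smul_mem_range_resOmega hE he hc hβ (contr_mem_formsP _ _ hζ)) ?_
  rw [add_comm p 1]
  exact mul_mem_range_resOmega hE he hc hk (contr_mem_formsP _ _ hz)

/-- Residues along a codimension-two flat are, up to a power of the restricted linear form, the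
logarithmic forms with the Euler multiplicity. -/
theorem exists_residue_description (hc : c0 ∈ A.hyps) (hm : ∀ c ∈ A.hyps, 0 < m c) (hβ0 : β ≠ 0)
    (hβ : ∀ c ∈ A.hyps, ∃ t : K, restrictForm e c = t • β) {c1 : Fin ℓ → K} (hc1 : c1 ∈ A.hyps)
    (hne : c1 ≠ c0) {d1 d2 : ℕ} (h : FreeWithExp A m (expVec d1 d2))
    (h' : FreeWithExp A (mdel m c0) (expVec (d1 - 1) d2)) :
    ∃ k : ℕ, ∀ p : ℕ,
      (∀ y ∈ LinearMap.range (resOmega e hc (mdel m c0) (p + 1)),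
        ∃ z, y = linP β ^ k • z ∧ ∃ ζ, dP β * z = linP β ^ d2 • ζ) ∧
      ∀ z ∈ formsP K (ℓ - 1) (p + 1), (∃ ζ, dP β * z = linP β ^ d2 • ζ) →
        linP β ^ k • z ∈ LinearMap.range (resOmega e hc (mdel m c0) (p + 1)) := by
  have := h.freeM.projective_Omega 1
  obtain ⟨k, hkq, hk, hk'⟩ := exists_pow_generator hE he hc (hm c0 hc) hβ0 hβ hc1 hne
  have hkb := add_eq_of_exponents hE he hc hm hβ0 hβ hc1 hne hkq hk hk' h h'
  refine ⟨k, fun p => ⟨fun y hy => ?_, fun z hz ⟨ζ, hζ⟩ =>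
    pow_smul_mem_range_resOmega_of_dP_mul_eq hE he hc hβ0 hβ hkb hk hz hζ⟩⟩
  obtain ⟨z, rfl⟩ := exists_pow_smul_of_mem_range_resOmega hE he hc hβ0 hβ hc1 hne hkq hk'
    h'.freeM hy
  obtain ⟨ζ, hζ⟩ := exists_dP_mul_resOmega_eq hE he hc hβ hc1 hne hy
  refine ⟨z, rfl, ζ, ?_⟩
  rw [mul_smul_comm, ← hkb, pow_add, mul_smul] at hζ
  exact smul_right_injective _ (pow_ne_zero k (linP_ne_zero hβ0)) hζ

end RankTwoResidueDescription

section ChangeOfRings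

variable {R R' M : Type} [CommRing R] [CommRing R'] [Algebra R R'] [AddCommGroup M]
  [Module R M] [Module R' M] [IsScalarTower R R' M]

theorem pdLT_finsupp_of_ker_eq_span [IsDomain R]
    (hs : Function.Surjective (algebraMap R R')) {a : R}
    (ha : a ≠ 0) (hker : ∀ s : R, algebraMap R R' s = 0 ↔ a ∣ s) (ι : Type) :
    PdLT R (ι →₀ R') 2 := by
  let f : (ι →₀ R) →ₗ[R] (ι →₀ R') := Finsupp.mapRange.linearMap (Algebra.linearMap R R')
  have hf : Function.Surjective f := Finsupp.mapRange_surjective _ (map_zero _) hs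
  let μ : (ι →₀ R) →ₗ[R] (ι →₀ R) := LinearMap.lsmul R _ a
  have hμ : Function.Injective μ := smul_right_injective _ ha
  have hr : LinearMap.range μ = LinearMap.ker f := by
    ext x
    constructor
    · rintro ⟨y, rfl⟩
      refine Finsupp.ext fun i => ?_
      exact (hker _).2 (Dvd.intro _ rfl)
    · intro hx
      have h : ∀ i, ∃ y, x i = a * y := fun i => (hker _).1 (DFunLike.congr_fun hx i)
      choose y hy using h
      refine ⟨Finsupp.onFinset x.support y fun i hi => ?_, Finsupp.ext fun i => (hy i).symm⟩
      rw [Finsupp.mem_support_iff, hy]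
      exact mul_ne_zero ha hi
  refine PdLT.of_ker (n := 1) hf ?_ pdLT_one
  exact (pdLT_one (M := ι →₀ R) (n := 0)).congr
    ((LinearEquiv.ofInjective μ hμ).trans (LinearEquiv.ofEq _ _ hr))

/-- A projective module over a hypersurface has projective dimension at most one over the ambient
ring. -/
theorem pdLT_two_of_projective [IsDomain R] (hs : Function.Surjective (algebraMap R R')) {a : R}
    (ha : a ≠ 0) (hker : ∀ s : R, algebraMap R R' s = 0 ↔ a ∣ s) [Module.Projective R' M] :
    PdLT R M 2 := by
  obtain ⟨s, hs'⟩ := Module.projective_def'.1 ‹Module.Projective R' M›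
  refine PdLT.of_retract (s.restrictScalars R)
    ((Finsupp.linearCombination R' id).restrictScalars R) ?_
    (pdLT_finsupp_of_ker_eq_span hs ha hker M)
  exact LinearMap.ext fun x => LinearMap.congr_fun hs' x

/-- An element of a minimal prime over `I` becomes nilpotent modulo `I` after localizing. -/
theorem Ideal.exists_mul_pow_mem_of_mem_minimalPrimes {I P : Ideal R} (hP : P ∈ I.minimalPrimes)
    {a : R} (ha : a ∈ P) : ∃ s ∉ P, ∃ n, s * a ^ n ∈ I := by
  have := hP.1.1
  by_contra! h
  obtain ⟨Q, hQ, hIQ, hdis⟩ := I.exists_le_prime_disjoint (P.primeCompl ⊔ Submonoid.powers a) <| by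
    refine Set.disjoint_left.2 fun x hx hx' => ?_
    obtain ⟨s, hs, _, ⟨n, rfl⟩, rfl⟩ := Submonoid.mem_sup.1 hx'
    exact h s hs n hx
  have hQP : Q ≤ P := fun x hx => by
    by_contra hxP
    exact Set.disjoint_left.1 hdis hx (Submonoid.mem_sup_left (S := P.primeCompl) hxP)
  exact Set.disjoint_left.1 hdis (hP.2 ⟨hQ, hIQ⟩ hQP ha)
    (Submonoid.mem_sup_right (Submonoid.mem_powers a))

end ChangeOfRings

section Localizations

variable {A : Arrangement K ℓ} {m : (Fin ℓ → K) → ℕ} {c0 : Fin ℓ → K}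
  {e : (Fin (ℓ - 1) → K) →ₗ[K] (Fin ℓ → K)} {β : Fin (ℓ - 1) → K}

theorem mem_locOnRestr {c : Fin ℓ → K} :
    c ∈ (locOnRestr A e β).hyps ↔ c ∈ A.hyps ∧ ∃ t : K, restrictForm e c = t • β := by
  simp [locOnRestr]

theorem mem_locArr {c : Fin ℓ → K} {x : Fin ℓ → K} :
    c ∈ (locArr A x).hyps ↔ c ∈ A.hyps ∧ ∑ i, c i * x i = 0 := by
  simp [locArr]

theorem IsHypEmbedding.mem_locOnRestr_self (he : IsHypEmbedding c0 e) (hc : c0 ∈ A.hyps) :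
    c0 ∈ (locOnRestr A e β).hyps :=
  mem_locOnRestr.2 ⟨hc, 0, by rw [he.restrictForm_self, zero_smul]⟩

theorem locOnRestr_subset : (locOnRestr A e β).hyps ⊆ A.hyps := fun _ h => (mem_locOnRestr.1 h).1

theorem locArr_subset {x : Fin ℓ → K} : (locArr A x).hyps ⊆ A.hyps := fun _ h => (mem_locArr.1 h).1

/-- A proper ideal of the polynomial ring missing a variable has a nonzero common zero of the
linear forms it contains. -/
theorem exists_zero_of_linP_mem {P : Ideal (PS K ℓ)} {i : Fin ℓ} (hi : (X i : PS K ℓ) ∉ P) :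
    ∃ x : Fin ℓ → K, x ≠ 0 ∧ ∀ c, linP c ∈ P → ∑ j, c j * x j = 0 := by
  let W : Submodule K (Fin ℓ → K) :=
    { carrier := {c | linP c ∈ P}
      add_mem' := fun {a b} ha hb => by
        change linP (a + b) ∈ P
        rw [linP_add]
        exact P.add_mem ha hb
      zero_mem' := by
        change linP 0 ∈ P
        rw [linP_zero]
        exact P.zero_mem
      smul_mem' := fun t c hc => by
        change linP (t • c) ∈ P
        rw [linP_smul]
        exact P.mul_mem_left _ hc }
  have hW : W < ⊤ := by
    refine lt_top_iff_ne_top.2 fun h => hi ?_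
    have h1 : (Pi.single i 1 : Fin ℓ → K) ∈ W := h ▸ Submodule.mem_top
    have h2 : linP (Pi.single i 1 : Fin ℓ → K) ∈ P := h1
    rwa [linP_single] at h2
  obtain ⟨f, hf, hWf⟩ := Submodule.exists_le_ker_of_lt_top W hW
  have hfx : ∀ c, f c = ∑ j, c j * f (Pi.single j 1) := fun c => by
    rw [LinearMap.pi_apply_eq_sum_univ f c]
    refine Finset.sum_congr rfl fun j _ => ?_
    rw [smul_eq_mul]
    congr 2
    funext k
    simp [Pi.single_apply, eq_comm]
  refine ⟨fun j => f (Pi.single j 1), fun h => hf ?_, fun c hc => ?_⟩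
  · ext c
    rw [LinearMap.comp_apply]
    exact congrFun h c
  · rw [← hfx]
    exact hWf hc

end Localizations

section GlobalResidues

variable {A : Arrangement K ℓ} {m : (Fin ℓ → K) → ℕ} {c0 : Fin ℓ → K}
  {e : (Fin (ℓ - 1) → K) →ₗ[K] (Fin ℓ → K)} {B : Arrangement K (ℓ - 1)}
  {ms k : (Fin (ℓ - 1) → K) → ℕ} {p : ℕ}
  [Algebra (PS K ℓ) (PS K (ℓ - 1))]
  (hE : ∀ s : PS K ℓ, algebraMap (PS K ℓ) (PS K (ℓ - 1)) s = polyMap (resMat e) s)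
  (he : IsHypEmbedding c0 e)
include hE he

theorem exists_mem_Omega_of_mem_range_resOmega (hc : c0 ∈ A.hyps)
    (hk : ∀ β ∈ B.hyps, ∀ y ∈ LinearMap.range
      (resOmega e (he.mem_locOnRestr_self (β := β) hc) (mdel m c0) p),
      ∃ z, y = linP β ^ k β • z ∧ ∃ ζ, dP β * z = linP β ^ ms β • ζ)
    {y : ExtF K (ℓ - 1)} (hy : y ∈ LinearMap.range (resOmega e hc (mdel m c0) p)) :
    ∃ z ∈ Omega B ms p, y = (∏ β ∈ B.hyps, linP β ^ k β) • z := by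
  have hloc : ∀ β ∈ B.hyps, ∃ z, y = linP β ^ k β • z ∧ ∃ ζ, dP β * z = linP β ^ ms β • ζ :=
    fun β hβ => hk β hβ y
      (range_resOmega_le_of_subset hE he locOnRestr_subset hc (he.mem_locOnRestr_self hc) p hy)
  obtain ⟨z, hz⟩ := exists_prod_smul B.hyps (fun β => linP β ^ k β)
    (B.pairwise_isRelPrime_pow k subset_rfl) y fun β hβ => by
      obtain ⟨z, hz, -⟩ := hloc β hβ
      exact ⟨z, hz⟩
  have hR : (∏ β ∈ B.hyps, linP β ^ k β) ≠ 0 :=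
    Finset.prod_ne_zero_iff.2 fun β hβ => pow_ne_zero _ (linP_ne_zero (B.ne_zero β hβ))
  have hyf : y ∈ formsP K (ℓ - 1) p := by
    obtain ⟨η, rfl⟩ := hy
    exact resOmega_mem_formsP hE he hc η
  refine ⟨z, mem_Omega.2 ⟨mem_formsP_of_smul hR (hz ▸ hyf), fun β hβ => ?_⟩, hz⟩
  obtain ⟨z', hz', ζ, hζ⟩ := hloc β hβ
  have h1 : z' = (∏ γ ∈ B.hyps.erase β, linP γ ^ k γ) • z := by
    rw [← Finset.mul_prod_erase _ _ hβ, mul_smul, hz'] at hz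
    exact smul_right_injective _ (pow_ne_zero _ (linP_ne_zero (B.ne_zero β hβ))) hz
  rw [h1, mul_smul_comm] at hζ
  have hrel : IsRelPrime (linP β ^ ms β) (∏ γ ∈ B.hyps.erase β, linP γ ^ k γ) :=
    IsRelPrime.prod_right fun γ hγ => ((B.isRelPrime hβ (Finset.mem_of_mem_erase hγ)
      (Finset.ne_of_mem_erase hγ).symm).pow_left).pow_right
  exact exists_smul_of_isRelPrime hrel hζ

theorem prod_smul_prod_smul_mem_range_resOmega (hc : c0 ∈ A.hyps) {β : Fin (ℓ - 1) → K}
    (hβ : β ∈ B.hyps)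
    (hk : ∀ z ∈ formsP K (ℓ - 1) p, (∃ ζ, dP β * z = linP β ^ ms β • ζ) →
        linP β ^ k β • z ∈ LinearMap.range
          (resOmega e (he.mem_locOnRestr_self (β := β) hc) (mdel m c0) p))
    {z : ExtF K (ℓ - 1)} (hz : z ∈ Omega B ms p) :
    (∏ c ∈ A.hyps \ (locOnRestr A e β).hyps, linP c ^ mdel m c0 c) •
      (∏ β ∈ B.hyps, linP β ^ k β) • z ∈ LinearMap.range (resOmega e hc (mdel m c0) p) := by
  refine prod_smul_mem_range_resOmega hE he hc (he.mem_locOnRestr_self hc) ?_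
  rw [← Finset.mul_prod_erase _ _ hβ, mul_smul]
  obtain ⟨hzf, hz⟩ := mem_Omega.1 hz
  obtain ⟨ζ, hζ⟩ := hz β hβ
  refine hk _ (Submodule.smul_mem _ _ hzf)
    ⟨(∏ γ ∈ B.hyps.erase β, linP γ ^ k γ) • ζ, ?_⟩
  rw [mul_smul_comm, hζ, smul_comm]

theorem exists_X_pow_smul_mem_range_resOmega (hc : c0 ∈ A.hyps) (hm : 0 < m c0)
    (hB : IsRestrictionOf B A c0 e) (hB0 : B.hyps.Nonempty) (hlf : LocallyFreeAlong A m c0)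
    {N : Submodule (PS K ℓ) (ExtF K (ℓ - 1))}
    (hN : ∀ β ∈ B.hyps, ∀ y ∈ N,
      (∏ c ∈ A.hyps \ (locOnRestr A e β).hyps, linP c ^ mdel m c0 c) • y ∈
        LinearMap.range (resOmega e hc (mdel m c0) p)) (i : Fin ℓ) :
    ∃ n, ∀ y ∈ N, (X i : PS K ℓ) ^ n • y ∈ LinearMap.range (resOmega e hc (mdel m c0) p) := by
  let J : Ideal (PS K ℓ) :=
    { carrier := {s | ∀ y ∈ N, s • y ∈ LinearMap.range (resOmega e hc (mdel m c0) p)}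
      add_mem' := fun {a b} ha hb y hy => by
        rw [add_smul]
        exact Submodule.add_mem _ (ha y hy) (hb y hy)
      zero_mem' := fun y _ => by
        rw [zero_smul]
        exact Submodule.zero_mem _
      smul_mem' := fun t s hs y hy => by
        rw [smul_assoc]
        exact Submodule.smul_mem _ _ (hs y hy) }
  suffices h : (X i : PS K ℓ) ∈ J.radical by
    obtain ⟨n, hn⟩ := h
    exact ⟨n, hn⟩
  rw [← Ideal.sInf_minimalPrimes, Ideal.mem_sInf]
  intro P hP
  have hPp := hP.1.1
  have hJP : J ≤ P := hP.1.2
  by_contra hi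
  obtain ⟨x, hx, hxP⟩ := exists_zero_of_linP_mem hi
  have hc0P : linP c0 ∈ P := hJP fun y _ => by
    rw [linP_smul_eq_zero hE he]
    exact Submodule.zero_mem _
  have := (hlf x hx (hxP c0 hc0P)).projective_Omega p
  have hcx : c0 ∈ (locArr A x).hyps := mem_locArr.2 ⟨hc, hxP c0 hc0P⟩
  have hprod : ∀ {s : Finset (Fin ℓ → K)}, (∏ c ∈ s, linP c ^ mdel m c0 c) ∈ P →
      ∃ c ∈ s, linP c ∈ P := fun {s} h => by
    obtain ⟨c, hcs, h⟩ := (hPp.prod_mem_iff).1 h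
    exact ⟨c, hcs, hPp.mem_of_pow_mem _ h⟩
  have hout : ∀ β ∈ B.hyps, ∃ c ∈ A.hyps, linP c ∈ P ∧ ∀ t : K, restrictForm e c ≠ t • β :=
    fun β hβ => by
      obtain ⟨c, hcs, h⟩ := hprod (hJP (hN β hβ))
      rw [Finset.mem_sdiff, mem_locOnRestr] at hcs
      exact ⟨c, hcs.1, h, fun t ht => hcs.2 ⟨hcs.1, t, ht⟩⟩
  obtain ⟨β₁, hβ₁⟩ := hB0
  obtain ⟨c, hcA, hcP, hcβ⟩ := hout β₁ hβ₁
  have hcr : restrictForm e c ≠ 0 := fun h => hcβ 0 (by rw [h, zero_smul])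
  obtain ⟨β₂, hβ₂, t, ht, hct⟩ := hB.1 c hcA fun h => hcr (h ▸ he.restrictForm_self)
  obtain ⟨c', hcA', hcP', hcβ'⟩ := hout β₂ hβ₂
  have hnp : ∀ s : K, restrictForm e c' ≠ s • restrictForm e c := fun s h =>
    hcβ' (s * t) (by rw [h, hct, mul_smul])
  have hne : c ≠ c' := fun h => hnp 1 (by rw [one_smul, h])
  obtain ⟨s, hs, n, hsn⟩ := Ideal.exists_mul_pow_mem_of_mem_minimalPrimes hP hcP
  obtain ⟨s', hs', n', hsn'⟩ := Ideal.exists_mul_pow_mem_of_mem_minimalPrimes hP hcP'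
  have hpol : ∀ (c : Fin ℓ → K) (n : ℕ),
      polyMap (resMat e) (linP c ^ n) = linP (restrictForm e c) ^ n := fun c n => by
    rw [map_pow, polyMap_linP, restrictForm_eq]
  have hfin : (∏ c ∈ A.hyps \ (locArr A x).hyps, linP c ^ mdel m c0 c) * (s * s') ∈ P :=
    hJP fun y hy => by
      rw [mul_smul]
      refine prod_smul_mem_range_resOmega hE he hc hcx ?_
      refine mem_range_resOmega_of_smul hE he hcx hm (f := linP c ^ n) (g := linP c' ^ n')
        ((A.isRelPrime hcA hcA' hne).pow_left.pow_right) ?_ ?_ ?_ ?_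
      · rw [hpol, hpol]
        exact (isRelPrime_linP hcr hnp).pow_left.pow_right
      · rw [hpol]
        exact pow_ne_zero _ (linP_ne_zero hcr)
      · refine range_resOmega_le_of_subset hE he locArr_subset hc hcx p ?_
        have h := J.mul_mem_left s' hsn y hy
        rwa [smul_smul, show linP c ^ n * (s * s') = s' * (s * linP c ^ n) by ring]
      · refine range_resOmega_le_of_subset hE he locArr_subset hc hcx p ?_
        have h := J.mul_mem_left s hsn' y hy
        rwa [smul_smul, show linP c' ^ n' * (s * s') = s * (s' * linP c' ^ n') by ring]
  rcases hPp.mem_or_mem hfin with h | h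
  · obtain ⟨a, ha, haP⟩ := hprod h
    rw [Finset.mem_sdiff, mem_locArr] at ha
    exact ha.2 ⟨ha.1, hxP a haP⟩
  · exact (hPp.mem_or_mem h).elim hs hs'

end GlobalResidues

section Deletion

instance Omega_finite (A : Arrangement K ℓ) (m : (Fin ℓ → K) → ℕ) (p : ℕ) :
    Module.Finite (PS K ℓ) (Omega A m p) := by
  have : IsNoetherian (PS K ℓ) (formsP K ℓ p) := isNoetherian_of_isNoetherianRing_of_finite _ _
  exact Module.Finite.of_injective (Submodule.inclusion Omega_le_formsP)
    (Submodule.inclusion_injective _)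

variable {A : Arrangement K ℓ} {m : (Fin ℓ → K) → ℕ} {c0 : Fin ℓ → K}
  {e : (Fin (ℓ - 1) → K) →ₗ[K] (Fin ℓ → K)} {B : Arrangement K (ℓ - 1)}
  {ms k : (Fin (ℓ - 1) → K) → ℕ} {p : ℕ}

theorem IsRestrictionOf.nonempty
    (hB : IsRestrictionOf B A c0 e) (hess : Essential A) (hℓ : 2 ≤ ℓ) : B.hyps.Nonempty := by
  by_contra hB0
  have h0 : ∀ c ∈ A.hyps, c = c0 := fun c hc => by
    by_contra hne
    obtain ⟨β, hβ, -⟩ := hB.1 c hc hne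
    exact hB0 ⟨β, hβ⟩
  have hle : Module.finrank K (Submodule.span K (A.hyps : Set (Fin ℓ → K))) ≤ 1 := by
    refine (finrank_span_finset_le_card A.hyps).trans (Finset.card_le_one.2 fun a ha b hb => ?_)
    rw [h0 a ha, h0 b hb]
  rw [hess, finrank_top, Module.finrank_fin_fun] at hle
  omega

variable [Algebra (PS K ℓ) (PS K (ℓ - 1))]
  (hE : ∀ s : PS K ℓ, algebraMap (PS K ℓ) (PS K (ℓ - 1)) s = polyMap (resMat e) s)
  (he : IsHypEmbedding c0 e)
include hE he

/-- If the residues are, up to a common factor, all forms of the free restriction after removing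
torsion supported at the origin, then the residue sequence is exact on the right and bounds the
projective dimension. -/
theorem pdLT_Omega_mdel (hc : c0 ∈ A.hyps) (hm : 0 < m c0)
    (hB : IsRestrictionOf B A c0 e) (hess : Essential A) (hlf : LocallyFreeAlong A m c0)
    (hBfree : FreeM B ms) (hp : p + 3 ≤ ℓ) (htame : PdLT (PS K ℓ) (Omega A m p) (p + 1))
    (hp0 : 1 ≤ p)
    (hk : ∀ β ∈ B.hyps,
      (∀ y ∈ LinearMap.range
        (resOmega e (he.mem_locOnRestr_self (A := A) (β := β) hc) (mdel m c0) p),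
        ∃ z, y = linP β ^ k β • z ∧ ∃ ζ, dP β * z = linP β ^ ms β • ζ) ∧
      ∀ z ∈ formsP K (ℓ - 1) p, (∃ ζ, dP β * z = linP β ^ ms β • ζ) →
        linP β ^ k β • z ∈ LinearMap.range
          (resOmega e (he.mem_locOnRestr_self (A := A) (β := β) hc) (mdel m c0) p)) :
    PdLT (PS K ℓ) (Omega A (mdel m c0) p) (p + 1) := by
  have hB0 := hB.nonempty hess (by omega)
  have hsurj : Function.Surjective (algebraMap (PS K ℓ) (PS K (ℓ - 1))) := fun s => by
    obtain ⟨t, ht⟩ := he.polyMap_surjective s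
    exact ⟨t, (hE t).trans ht⟩
  have hR : (∏ β ∈ B.hyps, linP β ^ k β) ≠ 0 :=
    Finset.prod_ne_zero_iff.2 fun β hβ => pow_ne_zero _ (linP_ne_zero (B.ne_zero β hβ))
  set R : PS K (ℓ - 1) := ∏ β ∈ B.hyps, linP β ^ k β with hRdef
  have := hBfree.projective_Omega p
  have : Module.Finite (PS K ℓ) (PS K (ℓ - 1)) :=
    Module.Finite.of_surjective (Algebra.linearMap _ _) hsurj
  have : Module.Finite (PS K ℓ) (Omega B ms p) := Module.Finite.trans (PS K (ℓ - 1)) _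
  let μ : Omega B ms p →ₗ[PS K ℓ] ExtF K (ℓ - 1) :=
    ((LinearMap.lsmul (PS K (ℓ - 1)) (ExtF K (ℓ - 1)) R) ∘ₗ
      (Omega B ms p).subtype).restrictScalars (PS K ℓ)
  have hμ : Function.Injective μ := fun a b h =>
    Subtype.ext (smul_right_injective _ hR h)
  let φ := resOmega e hc (mdel m c0) p
  have hφμ : ∀ η, φ η ∈ LinearMap.range μ := fun η => by
    obtain ⟨z, hz, h⟩ := exists_mem_Omega_of_mem_range_resOmega hE he hc
      (fun β hβ => (hk β hβ).1) (LinearMap.mem_range_self φ η)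
    exact ⟨⟨z, hz⟩, h.symm⟩
  let g : Omega A (mdel m c0) p →ₗ[PS K ℓ] Omega B ms p :=
    (LinearEquiv.ofInjective μ hμ).symm.toLinearMap ∘ₗ φ.codRestrict _ hφμ
  have hg : ∀ η, μ (g η) = φ η := fun η =>
    congrArg Subtype.val ((LinearEquiv.ofInjective μ hμ).apply_symm_apply ⟨φ η, hφμ η⟩)
  have hkerg : LinearMap.ker g = LinearMap.ker φ := by
    ext η
    rw [LinearMap.mem_ker, LinearMap.mem_ker, ← hg, map_eq_zero_iff μ hμ]
  have hker : PdLT (PS K ℓ) (LinearMap.ker g) (p + 1) := by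
    obtain ⟨eqv⟩ := exists_ker_resOmega_equiv hE he hc hm p
    exact htame.congr (eqv.symm.trans (LinearEquiv.ofEq _ _ hkerg.symm))
  have hgs : Function.Surjective g := by
    refine surjective_of_pd g hp ((Omega_pdLT A _ p).mono (by omega)) hker (fun i y => ?_) ?_
    · obtain ⟨n, hn⟩ := exists_X_pow_smul_mem_range_resOmega hE he hc hm hB hB0 hlf
        (N := LinearMap.range μ) (p := p) (by
          rintro β hβ _ ⟨z, rfl⟩
          exact prod_smul_prod_smul_mem_range_resOmega hE he hc hβ (hk β hβ).2 z.2) i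
      obtain ⟨η, hη⟩ := hn (μ y) (LinearMap.mem_range_self μ y)
      refine ⟨n, η, hμ ?_⟩
      rw [hg, map_smul]
      exact hη
    · obtain ⟨β, hβ⟩ := hB0
      obtain ⟨c, -, -, t, ht, hct⟩ := hB.2 β hβ
      obtain ⟨i, hi⟩ : ∃ i : Fin ℓ, polyMap (resMat e) (X i) ≠ 0 := by
        by_contra! h
        have h1 := polyMap_linP (resMat e) c
        rw [← restrictForm_eq, hct] at h1
        refine linP_ne_zero (smul_ne_zero ht (B.ne_zero β hβ)) (h1.symm.trans ?_)
        rw [linP, map_sum]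
        exact Finset.sum_eq_zero fun j _ => by rw [map_mul, h j, mul_zero]
      refine ⟨i, fun y hy => ?_⟩
      rw [← algebraMap_smul (PS K (ℓ - 1)) (X i : PS K ℓ) y, hE] at hy
      have : Module.IsTorsionFree (PS K (ℓ - 1)) (Omega B ms p) := inferInstance
      exact (smul_eq_zero.1 hy).resolve_left hi
  refine PdLT.middle hgs hker (PdLT.mono (by omega : 2 ≤ p + 1) ?_)
  exact pdLT_two_of_projective hsurj (linP_ne_zero (A.ne_zero c0 hc)) (fun s => by
    rw [hE, he.polyMap_eq_zero_iff])

end Deletion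

/-- **Deletion theorem for tameness.**  If `(A, m)` is tame, the Euler restriction
`(A^H, m^*)` is free, and `(A, m)` is locally free along `H`, then `(A, m - δ_H)` is
tame. -/
theorem deletion_theorem_for_tameness
    {K : Type} [Field K] {ℓ : ℕ} (A : Arrangement K ℓ) (hess : Essential A)
    (m : (Fin ℓ → K) → ℕ) (hm : ∀ c ∈ A.hyps, 0 < m c)
    (c0 : Fin ℓ → K) (hc0 : c0 ∈ A.hyps)
    (htame : TameM A m)
    (heuler_free : ∃ (e : (Fin (ℓ - 1) → K) →ₗ[K] (Fin ℓ → K)) (B : Arrangement K (ℓ - 1))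
      (ms : (Fin (ℓ - 1) → K) → ℕ),
      IsHypEmbedding c0 e ∧ IsRestrictionOf B A c0 e ∧ IsEulerMult A m c0 e B ms ∧
        FreeM B ms)
    (hlf : LocallyFreeAlong A m c0) :
    TameM A (mdel m c0) := by
  obtain ⟨e, B, ms, he, hB, hms, hBfree⟩ := heuler_free
  intro p hp
  rw [pdLE_iff]
  obtain _ | p := p
  · exact pdLT_one_iff.2 (Omega_zero_projective A _)
  by_cases hpℓ : p + 1 + 3 ≤ ℓ
  swap
  · exact (Omega_pdLT A _ _).mono (by omega)
  let _ : Algebra (PS K ℓ) (PS K (ℓ - 1)) := (polyMap (resMat e)).toRingHom.toAlgebra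
  have hE : ∀ s : PS K ℓ, algebraMap (PS K ℓ) (PS K (ℓ - 1)) s = polyMap (resMat e) s :=
    fun _ => rfl
  have hloc : ∀ β : Fin (ℓ - 1) → K, ∃ k : ℕ, β ∈ B.hyps → ∀ p : ℕ,
      (∀ y ∈ LinearMap.range
        (resOmega e (he.mem_locOnRestr_self (A := A) (β := β) hc0) (mdel m c0) (p + 1)),
        ∃ z, y = linP β ^ k • z ∧ ∃ ζ, dP β * z = linP β ^ ms β • ζ) ∧
      ∀ z ∈ formsP K (ℓ - 1) (p + 1), (∃ ζ, dP β * z = linP β ^ ms β • ζ) →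
        linP β ^ k • z ∈ LinearMap.range
          (resOmega e (he.mem_locOnRestr_self (A := A) (β := β) hc0) (mdel m c0) (p + 1)) := by
    intro β
    by_cases hβ : β ∈ B.hyps
    · obtain ⟨d1, d2, h, h', rfl⟩ := hms β hβ
      obtain ⟨c1, hc1, hne, t, -, ht⟩ := hB.2 β hβ
      obtain ⟨k, hk⟩ := exists_residue_description hE he (he.mem_locOnRestr_self hc0)
        (fun c hc => hm c (locOnRestr_subset hc)) (B.ne_zero β hβ)
        (fun c hc => (mem_locOnRestr.1 hc).2) (mem_locOnRestr.2 ⟨hc1, t, ht⟩) hne h h'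
      exact ⟨k, fun _ => hk⟩
    · exact ⟨0, fun h => absurd h hβ⟩
  choose k hk using hloc
  exact pdLT_Omega_mdel hE he hc0 (hm c0 hc0) hB hess hlf hBfree hpℓ (pdLE_iff.1 (htame _ hp))
    (by omega) fun β hβ => hk β hβ p
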